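/- arXiv:math/0411607 — 2 statements merged into one kernel-verified Lean document; each statement's English description precedes it below -/
import Mathlib

section
/- Every smooth bump function φ_J adapted to an interval J ⊆ ℝ can be written as φ_J = Σ_{k∈ℕ} 2^{-1000k} φ_J^k, where each φ_J^k is a bump function adapted to J with support contained in 2^k J (the interval with the same center as J and length 2^k|J|). -/
open MeasureTheory Set
open scoped ENNReal

noncomputable section

/-- `φ` is a bump function adapted to the interval with center `x0` and length `L`,
with constants `C l α`. -/
def IsBump (C : ℕ → ℕ → ℝ) (x0 L : ℝ) (φ : ℝ → ℂ) : Prop :=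
  ContDiff ℝ (⊤ : ℕ∞) φ ∧ ∀ (l α : ℕ) (x : ℝ),
    ‖iteratedDeriv l φ x‖ ≤
      C l α / (L ^ l * (1 + Metric.infDist x (Set.Icc (x0 - L / 2) (x0 + L / 2)) / L) ^ α)

/-- `Φ` is an `L²`-normalized bump adapted to the interval with center `x0`, length `L`. -/
def IsNormBump (C : ℕ → ℕ → ℝ) (x0 L : ℝ) (Φ : ℝ → ℂ) : Prop :=
  IsBump C x0 L (fun x => (Real.sqrt L : ℂ) * Φ x)

/-- length of the dyadic interval `2^k [n, n+1]` encoded as `(k, n)`. -/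
def dyadLen (p : ℤ × ℤ) : ℝ := (2 : ℝ) ^ p.1

/-- center of the dyadic interval `2^k [n, n+1]`. -/
def dyadCenter (p : ℤ × ℤ) : ℝ := (2 : ℝ) ^ p.1 * ((p.2 : ℝ) + 1 / 2)

/-- the dyadic interval `2^k [n, n+1]` as a set. -/
def dyadIcc (p : ℤ × ℤ) : Set ℝ :=
  Set.Icc ((2 : ℝ) ^ p.1 * (p.2 : ℝ)) ((2 : ℝ) ^ p.1 * ((p.2 : ℝ) + 1))

/-- `ℝ≥0∞`-valued indicator of a dyadic interval. -/
def indE (p : ℤ × ℤ) (x : ℝ) : ℝ≥0∞ := Set.indicator (dyadIcc p) (fun _ => (1 : ℝ≥0∞)) x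

/-- complex scalar product on the line. -/
def pair (f g : ℝ → ℂ) : ℂ := ∫ x : ℝ, f x * (starRingEnd ℂ) (g x)

/-- complex pairing of `g : ℝ² → ℂ` against a tensor product `φ ⊗ ψ`. -/
def pair2 (g : ℝ × ℝ → ℂ) (φ ψ : ℝ → ℂ) : ℂ :=
  ∫ z : ℝ × ℝ, g z * (starRingEnd ℂ) (φ z.1) * (starRingEnd ℂ) (ψ z.2)

/-- partial pairing in the first variable. -/
def pairFst (g : ℝ × ℝ → ℂ) (φ : ℝ → ℂ) (y : ℝ) : ℂ :=
  ∫ x : ℝ, g (x, y) * (starRingEnd ℂ) (φ x)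

/-- partial pairing in the second variable. -/
def pairSnd (g : ℝ × ℝ → ℂ) (ψ : ℝ → ℂ) (x : ℝ) : ℂ :=
  ∫ y : ℝ, g (x, y) * (starRingEnd ℂ) (ψ y)

/-- Hardy–Littlewood maximal function (over intervals). -/
def HLM (f : ℝ → ℂ) (x : ℝ) : ℝ≥0∞ :=
  ⨆ (a : ℝ) (b : ℝ) (_ : a < b) (_ : x ∈ Set.Icc a b),
    ENNReal.ofReal ((b - a)⁻¹ * ∫ y in Set.Icc a b, ‖f y‖)

/-- strong (bi-parameter) maximal function on `ℝ²`. -/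
def MM2 (F : ℝ × ℝ → ℝ) (z : ℝ × ℝ) : ℝ≥0∞ :=
  ⨆ (a : ℝ) (b : ℝ) (c : ℝ) (d : ℝ) (_ : a < b) (_ : c < d)
      (_ : z ∈ Set.Icc a b ×ˢ Set.Icc c d),
    ENNReal.ofReal (((b - a) * (d - c))⁻¹ * ∫ w in Set.Icc a b ×ˢ Set.Icc c d, ‖F w‖)

/-- dyadic rectangle as a subset of `ℝ²`. -/
def rectSet (q : (ℤ × ℤ) × (ℤ × ℤ)) : Set (ℝ × ℝ) := dyadIcc q.1 ×ˢ dyadIcc q.2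

/-- Littlewood–Paley square function associated to a finite family of dyadic intervals. -/
def Sq (𝒟 : Finset (ℤ × ℤ)) (Φ : ℤ × ℤ → ℝ → ℂ) (f : ℝ → ℂ) (x : ℝ) : ℝ :=
  Real.sqrt (∑ p ∈ 𝒟, ‖pair f (Φ p)‖ ^ 2 / dyadLen p * Set.indicator (dyadIcc p) (fun _ => (1 : ℝ)) x)

/-- length of the dilated dyadic interval `I_{λ,t} = 2^{k+λ}[n+t,n+t+1]`. -/
def plen (k : ℤ) (lam : ℝ) : ℝ := (2 : ℝ) ^ ((k : ℝ) + lam)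

/-- center of the dilated/translated dyadic interval `I_{λ,t}`. -/
def pcen (p : ℤ × ℤ) (lam t : ℝ) : ℝ := plen p.1 lam * ((p.2 : ℝ) + t + 1 / 2)

/-- a family of `L²`-normalized bumps adapted to the intervals `I_{λ,t}`. -/
def AdaptedFam (C : ℕ → ℕ → ℝ) (Φ : ℤ × ℤ → ℝ → ℝ → ℝ → ℂ) : Prop :=
  ∀ p : ℤ × ℤ, ∀ lam ∈ Set.Icc (0 : ℝ) 1, ∀ t ∈ Set.Icc (0 : ℝ) 1,
    IsNormBump C (pcen p lam t) (plen p.1 lam) (Φ p lam t)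

/-- the square-maximal function `SM` (with supremum over translation/dilation parameters). -/
def SMfun (𝒟 : Finset ((ℤ × ℤ) × (ℤ × ℤ))) (ΦI ΦJ : ℤ × ℤ → ℝ → ℝ → ℝ → ℂ)
    (g : ℝ × ℝ → ℂ) (z : ℝ × ℝ) : ℝ≥0∞ :=
  (∑ I ∈ 𝒟.image Prod.fst,
      (⨆ (J : ℤ × ℤ) (_ : (I, J) ∈ 𝒟) (l1 ∈ Set.Icc (0 : ℝ) 1) (l2 ∈ Set.Icc (0 : ℝ) 1)
          (t1 ∈ Set.Icc (0 : ℝ) 1) (t2 ∈ Set.Icc (0 : ℝ) 1),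
          ENNReal.ofReal (‖pair2 g (ΦI I l1 t1) (ΦJ J l2 t2)‖ ^ 2 / dyadLen J) * indE J z.2)
        * (ENNReal.ofReal (dyadLen I))⁻¹ * indE I z.1) ^ (1 / 2 : ℝ)

/-- the square-maximal function `SM` (without the parameter suprema). -/
def SMfun0 (𝒟 : Finset ((ℤ × ℤ) × (ℤ × ℤ))) (ΦI ΦJ : ℤ × ℤ → ℝ → ℂ)
    (g : ℝ × ℝ → ℂ) (z : ℝ × ℝ) : ℝ≥0∞ :=
  (∑ I ∈ 𝒟.image Prod.fst,
      (⨆ (J : ℤ × ℤ) (_ : (I, J) ∈ 𝒟),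
          ENNReal.ofReal (‖pair2 g (ΦI I) (ΦJ J)‖ ^ 2 / dyadLen J) * indE J z.2)
        * (ENNReal.ofReal (dyadLen I))⁻¹ * indE I z.1) ^ (1 / 2 : ℝ)

/-- the maximal-square function `MS`. -/
def MSfun0 (𝒟 : Finset ((ℤ × ℤ) × (ℤ × ℤ))) (ΦI ΦJ : ℤ × ℤ → ℝ → ℂ)
    (f : ℝ × ℝ → ℂ) (z : ℝ × ℝ) : ℝ≥0∞ :=
  ⨆ I : ℤ × ℤ,
    ((ENNReal.ofReal (dyadLen I))⁻¹ *
        ∑ q ∈ 𝒟.filter (fun q => q.1 = I),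
          ENNReal.ofReal (‖pair2 f (ΦI I) (ΦJ q.2)‖ ^ 2 / dyadLen q.2) * indE q.2 z.2) ^ (1 / 2 : ℝ)
      * indE I z.1

/-- the double square function `SS`. -/
def SSfun (𝒟 : Finset ((ℤ × ℤ) × (ℤ × ℤ))) (ΦI ΦJ : ℤ × ℤ → ℝ → ℂ)
    (h : ℝ × ℝ → ℂ) (z : ℝ × ℝ) : ℝ≥0∞ :=
  (∑ q ∈ 𝒟, ENNReal.ofReal (‖pair2 h (ΦI q.1) (ΦJ q.2)‖ ^ 2 / (dyadLen q.1 * dyadLen q.2))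
      * indE q.1 z.1 * indE q.2 z.2) ^ (1 / 2 : ℝ)

/-- The cutoff `η`, recentred at `x0` and dilated to scale `r`. -/
def dilate (η : ℝ → ℝ) (x0 r : ℝ) (x : ℝ) : ℝ := η (r⁻¹ * (x - x0))

/-- The dyadic partition of unity obtained from the dilates of `η` at the scales `2 ^ k * L`. -/
def annularCutoff (η : ℝ → ℝ) (x0 L : ℝ) : ℕ → ℝ → ℝ
  | 0, x => dilate η x0 L x
  | k + 1, x => dilate η x0 (2 ^ (k + 1) * L) x - dilate η x0 (2 ^ k * L) x

lemma ContDiff.dilate {η : ℝ → ℝ} {n : WithTop ℕ∞} (hη : ContDiff ℝ n η) (x0 r : ℝ) :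
    ContDiff ℝ n (dilate η x0 r) :=
  hη.comp (contDiff_const.mul (contDiff_id.sub contDiff_const))

lemma ContDiff.annularCutoff {η : ℝ → ℝ} {n : WithTop ℕ∞} (hη : ContDiff ℝ n η) (x0 L : ℝ)
    (k : ℕ) : ContDiff ℝ n (annularCutoff η x0 L k) := by
  cases k with
  | zero => exact hη.dilate x0 L
  | succ k => exact (hη.dilate x0 _).sub (hη.dilate x0 _)

lemma iteratedDeriv_dilate {η : ℝ → ℝ} {j : ℕ} (hη : ContDiff ℝ j η) (x0 r x : ℝ) :
    iteratedDeriv j (dilate η x0 r) x = r⁻¹ ^ j * iteratedDeriv j η (r⁻¹ * (x - x0)) := by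
  have h := congrFun (iteratedDeriv_comp_sub_const j (fun y => η (r⁻¹ * y)) x0) x
  rw [iteratedDeriv_comp_const_mul hη] at h
  exact h

lemma norm_iteratedDeriv_dilate_le {η : ℝ → ℝ} {j : ℕ} (hη : ContDiff ℝ j η) {D : ℝ}
    (hD : ∀ y, ‖iteratedDeriv j η y‖ ≤ D) (x0 : ℝ) {L r : ℝ} (hL : 0 < L) (hr : L ≤ r) (x : ℝ) :
    ‖iteratedDeriv j (dilate η x0 r) x‖ ≤ D / L ^ j := by
  have hr0 : 0 < r := hL.trans_le hr
  rw [iteratedDeriv_dilate hη, norm_mul, norm_pow, norm_inv, Real.norm_of_nonneg hr0.le,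
    inv_pow, ← div_eq_inv_mul]
  have hD0 : 0 ≤ D := (norm_nonneg _).trans (hD 0)
  gcongr
  exact hD _

lemma norm_iteratedDeriv_annularCutoff_le {η : ℝ → ℝ} {j : ℕ} (hη : ContDiff ℝ j η) {D : ℝ}
    (hD : ∀ y, ‖iteratedDeriv j η y‖ ≤ D) (x0 : ℝ) {L : ℝ} (hL : 0 < L) (k : ℕ) (x : ℝ) :
    ‖iteratedDeriv j (annularCutoff η x0 L k) x‖ ≤ 2 * (D / L ^ j) := by
  have hscale (k : ℕ) : L ≤ 2 ^ k * L :=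
    le_mul_of_one_le_left hL.le (one_le_pow₀ (by norm_num))
  cases k with
  | zero =>
    have h := norm_iteratedDeriv_dilate_le hη hD x0 hL le_rfl x
    have h0 := (norm_nonneg _).trans h
    change ‖iteratedDeriv j (dilate η x0 L) x‖ ≤ _
    linarith
  | succ k =>
    change ‖iteratedDeriv j
      (fun y => dilate η x0 (2 ^ (k + 1) * L) y - dilate η x0 (2 ^ k * L) y) x‖ ≤ _
    rw [iteratedDeriv_fun_sub (hη.dilate x0 _).contDiffAt (hη.dilate x0 _).contDiffAt, two_mul]
    exact (norm_sub_le _ _).trans (add_le_add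
      (norm_iteratedDeriv_dilate_le hη hD x0 hL (hscale _) x)
      (norm_iteratedDeriv_dilate_le hη hD x0 hL (hscale _) x))

lemma dilate_eq_one {η : ℝ → ℝ} (hη : ∀ y, |y| ≤ 1 / 4 → η y = 1) {x0 r x : ℝ} (hr : 0 < r)
    (hx : |x - x0| ≤ r / 4) : dilate η x0 r x = 1 := by
  apply hη
  rw [abs_mul, abs_of_pos (inv_pos.2 hr), inv_mul_le_iff₀ hr]
  linarith

lemma dilate_eq_zero {η : ℝ → ℝ} (hη : ∀ y, 1 / 2 ≤ |y| → η y = 0) {x0 r x : ℝ} (hr : 0 < r)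
    (hx : r / 2 ≤ |x - x0|) : dilate η x0 r x = 0 := by
  apply hη
  rw [abs_mul, abs_of_pos (inv_pos.2 hr), le_inv_mul_iff₀ hr]
  linarith

lemma annularCutoff_eq_zero {η : ℝ → ℝ} (hη : ∀ y, 1 / 2 ≤ |y| → η y = 0) {x0 L x : ℝ}
    (hL : 0 < L) {k : ℕ} (hx : 2 ^ k * L / 2 ≤ |x - x0|) : annularCutoff η x0 L k x = 0 := by
  cases k with
  | zero => exact dilate_eq_zero hη hL (by simpa using hx)
  | succ k =>
    have hk : 0 < 2 ^ k * L := by positivity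
    have hx' : 2 ^ k * L / 2 ≤ |x - x0| := by rw [pow_succ] at hx; linarith
    change dilate _ _ _ _ - dilate _ _ _ _ = 0
    rw [dilate_eq_zero hη (by positivity) hx, dilate_eq_zero hη hk hx', sub_zero]

lemma annularCutoff_succ_eq_zero {η : ℝ → ℝ} (hη : ∀ y, |y| ≤ 1 / 4 → η y = 1) {x0 L x : ℝ}
    (hL : 0 < L) {k : ℕ} (hx : |x - x0| ≤ 2 ^ k * L / 4) :
    annularCutoff η x0 L (k + 1) x = 0 := by
  have hk : 0 < 2 ^ k * L := by positivity
  have hx' : |x - x0| ≤ 2 ^ (k + 1) * L / 4 := by rw [pow_succ]; linarith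
  change dilate _ _ _ _ - dilate _ _ _ _ = 0
  rw [dilate_eq_one hη (by positivity) hx, dilate_eq_one hη (by positivity) hx', sub_self]

lemma sum_annularCutoff (η : ℝ → ℝ) (x0 L : ℝ) (n : ℕ) (x : ℝ) :
    ∑ k ∈ Finset.range (n + 1), annularCutoff η x0 L k x = dilate η x0 (2 ^ n * L) x := by
  induction n with
  | zero => simp [annularCutoff]
  | succ n ih => rw [Finset.sum_range_succ, ih, annularCutoff]; ring

lemma hasSum_annularCutoff {η : ℝ → ℝ} (hη : ∀ y, |y| ≤ 1 / 4 → η y = 1) (x0 : ℝ) {L : ℝ}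
    (hL : 0 < L) (x : ℝ) : HasSum (fun k => annularCutoff η x0 L k x) 1 := by
  obtain ⟨n, hn⟩ := pow_unbounded_of_one_lt (4 * |x - x0| / L) (one_lt_two (α := ℝ))
  rw [div_lt_iff₀ hL] at hn
  rw [← dilate_eq_one hη (x0 := x0) (r := 2 ^ n * L) (x := x) (by positivity) (by linarith),
    ← sum_annularCutoff]
  refine hasSum_sum_of_ne_finset_zero fun k hk => ?_
  obtain ⟨m, rfl⟩ : ∃ m, k = m + 1 := ⟨k - 1, by simp at hk; omega⟩
  apply annularCutoff_succ_eq_zero hη hL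
  have hnm : n ≤ m := by simp at hk; omega
  have : (2 : ℝ) ^ n * L ≤ 2 ^ m * L := by gcongr; norm_num
  linarith

/-- Away from the interval the weight is comparable to the relative distance to the centre. -/
lemma le_one_add_infDist_div {x0 L : ℝ} (hL : 0 < L) (x : ℝ) :
    |x - x0| / L ≤ 1 + Metric.infDist x (Icc (x0 - L / 2) (x0 + L / 2)) / L := by
  have h : |x - x0| - L / 2 ≤ Metric.infDist x (Icc (x0 - L / 2) (x0 + L / 2)) := by
    refine (Metric.le_infDist ⟨x0, by constructor <;> linarith⟩).2 fun y hy => ?_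
    have hy' : |y - x0| ≤ L / 2 := abs_le.2 ⟨by linarith [hy.1], by linarith [hy.2]⟩
    rw [Real.dist_eq]
    linarith [abs_sub_le x y x0]
  rw [← sub_le_iff_le_add', le_div_iff₀ hL, sub_mul, div_mul_cancel₀ _ hL.ne']
  linarith

/-- The derivatives of the annular cutoffs gain any power of `2 ^ k` at the cost of the same
power of the weight. -/
lemma pow_mul_norm_iteratedDeriv_annularCutoff_le {η : ℝ → ℝ} {j : ℕ} (hη : ContDiff ℝ j η)
    (hη1 : ∀ y, |y| ≤ 1 / 4 → η y = 1) {D : ℝ} (hD : ∀ y, ‖iteratedDeriv j η y‖ ≤ D) (x0 : ℝ)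
    {L : ℝ} (hL : 0 < L) (M k : ℕ) (x : ℝ) :
    2 ^ (M * k) * ‖iteratedDeriv j (annularCutoff η x0 L k) x‖ ≤
      (8 * (1 + Metric.infDist x (Icc (x0 - L / 2) (x0 + L / 2)) / L)) ^ M *
        (2 * (D / L ^ j)) := by
  have hW := le_one_add_infDist_div (x0 := x0) hL x
  have hd : 0 ≤ Metric.infDist x (Icc (x0 - L / 2) (x0 + L / 2)) / L :=
    div_nonneg Metric.infDist_nonneg hL.le
  set W := 1 + Metric.infDist x (Icc (x0 - L / 2) (x0 + L / 2)) / L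
  have hW1 : 1 ≤ W := by simpa [W] using hd
  have hψ := norm_iteratedDeriv_annularCutoff_le hη hD x0 hL k x
  have hbound (hk : 2 ^ k ≤ 8 * W) : 2 ^ (M * k) *
      ‖iteratedDeriv j (annularCutoff η x0 L k) x‖ ≤ (8 * W) ^ M * (2 * (D / L ^ j)) := by
    rw [mul_comm M k, pow_mul]
    gcongr
  cases k with
  | zero => exact hbound (by rw [pow_zero]; linarith)
  | succ k =>
    rcases lt_or_ge |x - x0| (2 ^ k * L / 4) with hx | hx
    · have hloc : annularCutoff η x0 L (k + 1) =ᶠ[nhds x] fun _ => (0 : ℝ) := by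
        have hopen : IsOpen {y : ℝ | |y - x0| < 2 ^ k * L / 4} :=
          isOpen_lt (by fun_prop) continuous_const
        filter_upwards [hopen.mem_nhds hx] with y hy
        exact annularCutoff_succ_eq_zero hη1 hL (le_of_lt hy)
      have hzero : iteratedDeriv j (annularCutoff η x0 L (k + 1)) x = 0 := by
        rw [hloc.iteratedDeriv_eq]
        simp
      rw [hzero, norm_zero, mul_zero]
      exact mul_nonneg (by positivity) ((norm_nonneg _).trans hψ)
    · apply hbound
      have h : 2 ^ k / 4 ≤ |x - x0| / L := by
        rw [le_div_iff₀ hL]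
        linarith
      rw [pow_succ]
      linarith

lemma norm_iteratedDeriv_smul_le {f : ℝ → ℝ} {g : ℝ → ℂ} {l : ℕ} (hf : ContDiff ℝ l f)
    (hg : ContDiff ℝ l g) (x : ℝ) :
    ‖iteratedDeriv l (fun y => f y • g y) x‖ ≤ ∑ i ∈ Finset.range (l + 1),
      (l.choose i : ℝ) * ‖iteratedDeriv i f x‖ * ‖iteratedDeriv (l - i) g x‖ := by
  simpa only [norm_iteratedFDeriv_eq_norm_iteratedDeriv] using
    norm_iteratedFDeriv_smul_le hf hg x le_rfl

/-- Bump constants of the pieces `2 ^ (M * k) • annularCutoff η x0 L k • φ`, uniform in `k`. -/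
def pieceConst (C : ℕ → ℕ → ℝ) (D : ℕ → ℝ) (M l α : ℕ) : ℝ :=
  ∑ i ∈ Finset.range (l + 1), (l.choose i : ℝ) * (8 ^ M * (2 * D i)) * C (l - i) (α + M)

lemma IsBump.annularCutoff_smul {C : ℕ → ℕ → ℝ} {x0 L : ℝ} (hL : 0 < L) {φ : ℝ → ℂ}
    (hφ : IsBump C x0 L φ) {η : ℝ → ℝ} (hη : ContDiff ℝ (⊤ : ℕ∞) η)
    (hη1 : ∀ y, |y| ≤ 1 / 4 → η y = 1) {D : ℕ → ℝ} (hD : ∀ j y, ‖iteratedDeriv j η y‖ ≤ D j)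
    (M k : ℕ) :
    IsBump (pieceConst C D M) x0 L
      (fun x => (2 ^ (M * k) * annularCutoff η x0 L k x) • φ x) := by
  have hψ : ContDiff ℝ (⊤ : ℕ∞) (fun x => 2 ^ (M * k) * annularCutoff η x0 L k x) :=
    contDiff_const.mul (hη.annularCutoff x0 L k)
  refine ⟨hψ.smul hφ.1, fun l α x => ?_⟩
  refine (norm_iteratedDeriv_smul_le (hψ.of_le (by exact_mod_cast le_top))
    (hφ.1.of_le (by exact_mod_cast le_top)) x).trans ?_
  rw [pieceConst, Finset.sum_div]
  refine Finset.sum_le_sum fun i hi => ?_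
  have hil : i ≤ l := by simpa [Nat.lt_succ_iff] using hi
  have h1 := pow_mul_norm_iteratedDeriv_annularCutoff_le
    (hη.of_le (by exact_mod_cast le_top)) hη1 (hD i) x0 hL M k x
  have h2 := hφ.2 (l - i) (α + M) x
  have hd : 0 ≤ Metric.infDist x (Icc (x0 - L / 2) (x0 + L / 2)) / L :=
    div_nonneg Metric.infDist_nonneg hL.le
  set W := 1 + Metric.infDist x (Icc (x0 - L / 2) (x0 + L / 2)) / L
  have hW : 0 < W := by positivity
  have h3 : ‖iteratedDeriv i (fun x => 2 ^ (M * k) * annularCutoff η x0 L k x) x‖ =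
      2 ^ (M * k) * ‖iteratedDeriv i (annularCutoff η x0 L k) x‖ := by
    rw [iteratedDeriv_const_mul_field, norm_mul, norm_pow, Real.norm_ofNat]
  rw [h3, mul_assoc]
  calc _ ≤ (l.choose i : ℝ) * (((8 * W) ^ M * (2 * (D i / L ^ i))) *
        (C (l - i) (α + M) / (L ^ (l - i) * W ^ (α + M)))) := by
        gcongr
        exact le_trans (by positivity) h1
    _ = _ := by
        rw [← Nat.sub_add_cancel hil, pow_add L, Nat.sub_add_cancel hil, mul_pow, pow_add W]
        field_simp

lemma exists_smooth_cutoff : ∃ (η : ℝ → ℝ) (D : ℕ → ℝ), ContDiff ℝ (⊤ : ℕ∞) η ∧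
    (∀ y, |y| ≤ 1 / 4 → η y = 1) ∧ (∀ y, 1 / 2 ≤ |y| → η y = 0) ∧
    ∀ j y, ‖iteratedDeriv j η y‖ ≤ D j := by
  let η : ContDiffBump (0 : ℝ) := ⟨1 / 4, 1 / 2, by norm_num, by norm_num⟩
  have hbdd (j : ℕ) : ∃ D, ∀ y, ‖iteratedDeriv j η y‖ ≤ D := by
    have hη : ContDiff ℝ j η := η.contDiff
    obtain ⟨D, hD⟩ := (hη.continuous_iteratedFDeriv le_rfl).bounded_above_of_compact_support
      (η.hasCompactSupport.iteratedFDeriv j)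
    exact ⟨D, fun y => by rw [← norm_iteratedFDeriv_eq_norm_iteratedDeriv]; exact hD y⟩
  choose D hD using hbdd
  refine ⟨η, D, η.contDiff, fun y hy => ?_, fun y hy => ?_, hD⟩
  · exact η.one_of_mem_closedBall (by simpa [Real.dist_eq, η] using hy)
  · exact η.zero_of_le_dist (by simpa [Real.dist_eq, η] using hy)

/-- every bump adapted to `J` decomposes as `Σ_k 2^{-1000k} φ_J^k` with
`φ_J^k` a bump adapted to `J` supported in `2^k J`. -/
theorem bump_decomposition (Cb : ℕ → ℕ → ℝ) (x0 L : ℝ) (hL : 0 < L)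
    (φ : ℝ → ℂ) (hφ : IsBump Cb x0 L φ) :
    ∃ (C' : ℕ → ℕ → ℝ) (φk : ℕ → ℝ → ℂ),
      (∀ k : ℕ, IsBump C' x0 L (φk k)) ∧
      (∀ k : ℕ, Function.support (φk k) ⊆
        Set.Icc (x0 - (2 : ℝ) ^ k * L / 2) (x0 + (2 : ℝ) ^ k * L / 2)) ∧
      (∀ x : ℝ, HasSum (fun k : ℕ => ((2 : ℂ) ^ (1000 * k))⁻¹ * φk k x) (φ x)) := by
  obtain ⟨η, D, hη, hη1, hη0, hD⟩ := exists_smooth_cutoff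
  refine ⟨pieceConst Cb D 1000, fun k x => (2 ^ (1000 * k) * annularCutoff η x0 L k x) • φ x,
    fun k => hφ.annularCutoff_smul hL hη hη1 hD 1000 k, fun k x hx => ?_, fun x => ?_⟩
  · by_contra hmem
    refine hx ?_
    have hfar : 2 ^ k * L / 2 ≤ |x - x0| := by
      by_contra! h
      rw [abs_lt] at h
      exact hmem ⟨by linarith [h.1], by linarith [h.2]⟩
    simp only [annularCutoff_eq_zero hη0 hL hfar, mul_zero, zero_smul]
  · have h := (hasSum_annularCutoff hη1 x0 hL x).smul_const (φ x)
    rw [one_smul] at h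
    refine h.congr_fun fun k => ?_
    have h2 : (2 : ℂ) ^ (1000 * k) ≠ 0 := pow_ne_zero _ two_ne_zero
    beta_reduce
    rw [Complex.real_smul, Complex.real_smul, Complex.ofReal_mul, Complex.ofReal_pow,
      Complex.ofReal_ofNat, mul_assoc, inv_mul_cancel_left₀ h2]
end
end

section
/- The 'maximal-square' function MS(f)(x,y) = sup_I |I|^{-1/2}(Σ_{J: I×J∈𝒟} |⟨f,Φ¹_{I×J}⟩|²/|J| χ_J(y))^{1/2} χ_I(x) is pointwise bounded by a square-maximal type function: MS(f)(x,y) ≲ (Σ_J M_x(⟨f,Φ¹_J⟩/|J|^{1/2})²(x) χ_J(y))^{1/2}, and consequently MS is bounded on L^p(ℝ²) for all 1 < p < ∞. -/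
open MeasureTheory Set
open scoped ENNReal

noncomputable section

/-- The uncentered Hardy–Littlewood maximal function of a nonnegative function on the line. -/
def maxFn (f : ℝ → ℝ≥0∞) (x : ℝ) : ℝ≥0∞ :=
  ⨆ (c : ℝ) (r : ℝ) (_ : x ∈ Metric.ball c r),
    (ENNReal.ofReal (2 * r))⁻¹ * ∫⁻ y in Metric.ball c r, f y

theorem lt_maxFn_iff {f : ℝ → ℝ≥0∞} {x : ℝ} {t : ℝ≥0∞} :
    t < maxFn f x ↔ ∃ c r, x ∈ Metric.ball c r ∧
      t < (ENNReal.ofReal (2 * r))⁻¹ * ∫⁻ y in Metric.ball c r, f y := by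
  simp only [maxFn, lt_iSup_iff, exists_prop]

theorem avg_le_maxFn (f : ℝ → ℝ≥0∞) {x c r : ℝ} (hx : x ∈ Metric.ball c r) :
    (ENNReal.ofReal (2 * r))⁻¹ * ∫⁻ y in Metric.ball c r, f y ≤ maxFn f x := by
  unfold maxFn
  exact le_iSup_of_le c (le_iSup_of_le r (le_iSup_of_le hx le_rfl))

theorem lintegral_ball_le_maxFn (f : ℝ → ℝ≥0∞) {x c r : ℝ} (hx : x ∈ Metric.ball c r) :
    ∫⁻ y in Metric.ball c r, f y ≤ ENNReal.ofReal (2 * r) * maxFn f x := by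
  have hr : 0 < r := Metric.pos_of_mem_ball hx
  have h0 : ENNReal.ofReal (2 * r) ≠ 0 := by simp [hr]
  have := avg_le_maxFn f hx
  rwa [ENNReal.inv_mul_le_iff h0 ENNReal.ofReal_ne_top] at this

theorem isOpen_lt_maxFn (f : ℝ → ℝ≥0∞) (t : ℝ≥0∞) : IsOpen {x | t < maxFn f x} := by
  rw [isOpen_iff_forall_mem_open]
  intro x hx
  obtain ⟨c, r, hxc, hlt⟩ := lt_maxFn_iff.1 hx
  exact ⟨Metric.ball c r, fun y hy => lt_maxFn_iff.2 ⟨c, r, hy, hlt⟩, Metric.isOpen_ball, hxc⟩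

theorem measurable_maxFn (f : ℝ → ℝ≥0∞) : Measurable (maxFn f) :=
  measurable_of_Ioi fun t => (isOpen_lt_maxFn f t).measurableSet

theorem maxFn_weak_type (f : ℝ → ℝ≥0∞) (t : ℝ≥0∞) :
    t * volume {x | t < maxFn f x} ≤ 4 * ∫⁻ y, f y := by
  rw [(isOpen_lt_maxFn f t).measure_eq_iSup_isCompact]
  simp only [ENNReal.mul_iSup, iSup_le_iff]
  intro K hKU hK
  choose! c r hxc hlt using fun x (hx : x ∈ K) => lt_maxFn_iff.1 (hKU hx)
  obtain ⟨s, hsK, hcov⟩ := hK.elim_nhds_subcover (fun x => Metric.ball (c x) (r x))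
    fun x hx => Metric.isOpen_ball.mem_nhds (hxc x hx)
  have hpos : ∀ x ∈ s, 0 < r x := fun x hx => Metric.pos_of_mem_ball (hxc x (hsK x hx))
  obtain ⟨R, hR⟩ : ∃ R, ∀ x ∈ (s : Set ℝ), r x ≤ R := by
    obtain ⟨R, hR⟩ := (s.image r).bddAbove
    exact ⟨R, fun x hx => hR (by simpa using ⟨x, hx, rfl⟩)⟩
  obtain ⟨u, hus, hdisj, hu⟩ := Vitali.exists_disjoint_subfamily_covering_enlargement_closedBall
    (s : Set ℝ) c r R hR 4 (by norm_num)
  have hufin : u.Finite := s.finite_toSet.subset hus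
  lift u to Finset ℝ using hufin
  have hKu : K ⊆ ⋃ b ∈ u, Metric.closedBall (c b) (4 * r b) := by
    intro x hx
    obtain ⟨a, ha, hxa⟩ := mem_iUnion₂.1 (hcov hx)
    obtain ⟨b, hb, hsub⟩ := hu a ha
    exact mem_iUnion₂.2 ⟨b, hb, hsub (Metric.ball_subset_closedBall hxa)⟩
  calc t * volume K
      ≤ t * ∑ b ∈ u, volume (Metric.closedBall (c b) (4 * r b)) := by
        gcongr
        exact (measure_mono hKu).trans (measure_biUnion_finset_le _ _)
    _ = ∑ b ∈ u, 4 * (t * ENNReal.ofReal (2 * r b)) := by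
        rw [Finset.mul_sum]
        refine Finset.sum_congr rfl fun b hb => ?_
        rw [Real.volume_closedBall, show 2 * (4 * r b) = 4 * (2 * r b) by ring,
          ENNReal.ofReal_mul (by norm_num)]
        simp only [ENNReal.ofReal_ofNat]
        ring
    _ ≤ ∑ b ∈ u, 4 * ∫⁻ y in Metric.ball (c b) (r b), f y := by
        gcongr with b hb
        have h1 := (hlt b (hsK b (hus hb))).le
        have h0 : ENNReal.ofReal (2 * r b) ≠ 0 := by simp [hpos b (hus hb)]
        rw [← ENNReal.inv_mul_le_iff (ENNReal.inv_ne_zero.2 ENNReal.ofReal_ne_top)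
          (ENNReal.inv_ne_top.2 h0), inv_inv, mul_comm] at h1
        exact h1
    _ = 4 * ∫⁻ y in ⋃ b ∈ u, Metric.ball (c b) (r b), f y := by
        rw [← Finset.mul_sum, lintegral_biUnion_finset]
        · exact fun a ha b hb hab => (hdisj ha hb hab).mono Metric.ball_subset_closedBall
            Metric.ball_subset_closedBall
        · exact fun b _ => measurableSet_ball
    _ ≤ 4 * ∫⁻ y, f y := by
        gcongr
        exact Measure.restrict_le_self

theorem maxFn_add_const_le (f : ℝ → ℝ≥0∞) (s : ℝ≥0∞) {g : ℝ → ℝ≥0∞} (hfg : ∀ y, g y ≤ f y + s)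
    (x : ℝ) : maxFn g x ≤ maxFn f x + s := by
  unfold maxFn
  refine iSup_le fun c => iSup_le fun r => iSup_le fun hx => ?_
  have hr : 0 < r := Metric.pos_of_mem_ball hx
  have h0 : ENNReal.ofReal (2 * r) ≠ 0 := by simp [hr]
  calc (ENNReal.ofReal (2 * r))⁻¹ * ∫⁻ y in Metric.ball c r, g y
      ≤ (ENNReal.ofReal (2 * r))⁻¹ * ((∫⁻ y in Metric.ball c r, f y)
          + s * ENNReal.ofReal (2 * r)) := by
        gcongr
        refine (lintegral_mono hfg).trans ?_
        rw [lintegral_add_right _ measurable_const, setLIntegral_const, Real.volume_ball]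
    _ = (ENNReal.ofReal (2 * r))⁻¹ * (∫⁻ y in Metric.ball c r, f y) + s := by
        rw [mul_add, mul_comm s, ← mul_assoc (_⁻¹), ENNReal.inv_mul_cancel h0 ENNReal.ofReal_ne_top,
          one_mul]
    _ ≤ _ := by
        gcongr
        exact avg_le_maxFn f hx

theorem maxFn_weak_type_truncated (f : ℝ → ℝ≥0∞) {t : ℝ} (ht : 0 < t) :
    ENNReal.ofReal t * volume {x | ENNReal.ofReal t < maxFn f x} ≤
      8 * ∫⁻ y, {y | ENNReal.ofReal t < 2 * f y}.indicator f y := by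
  set E := {y | ENNReal.ofReal t < 2 * f y}
  have hle : ∀ y, f y ≤ E.indicator f y + ENNReal.ofReal (t / 2) := by
    intro y
    by_cases hy : y ∈ E
    · simp [hy]
    · have h2 : 2 * f y ≤ ENNReal.ofReal t := not_lt.1 hy
      rw [indicator_of_notMem hy, zero_add, ENNReal.ofReal_div_of_pos (by norm_num),
        ENNReal.le_div_iff_mul_le (by simp) (by simp)]
      simpa [mul_comm] using h2
  have hsub : {x | ENNReal.ofReal t < maxFn f x} ⊆
      {x | ENNReal.ofReal (t / 2) < maxFn (E.indicator f) x} := by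
    intro x hx
    have h1 := maxFn_add_const_le _ _ hle x
    have h2 : ENNReal.ofReal t = ENNReal.ofReal (t / 2) + ENNReal.ofReal (t / 2) := by
      rw [← ENNReal.ofReal_add (by positivity) (by positivity), add_halves]
    have h3 := lt_of_lt_of_le (show ENNReal.ofReal t < maxFn f x from hx) h1
    rw [h2] at h3
    exact (ENNReal.add_lt_add_iff_right ENNReal.ofReal_ne_top).1 h3
  have h2 : ENNReal.ofReal t = 2 * ENNReal.ofReal (t / 2) := by
    rw [show (2 : ℝ≥0∞) = ENNReal.ofReal 2 by simp, ← ENNReal.ofReal_mul (by norm_num)]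
    congr 1; ring
  calc _ ≤ 2 * (ENNReal.ofReal (t / 2) *
        volume {x | ENNReal.ofReal (t / 2) < maxFn (E.indicator f) x}) := by
        rw [← mul_assoc, ← h2]
        gcongr
    _ ≤ 2 * (4 * ∫⁻ y, E.indicator f y) := by
        exact mul_le_mul' le_rfl (maxFn_weak_type _ _)
    _ = _ := by rw [← mul_assoc]; norm_num

theorem setLIntegral_Ioo_rpow {p b : ℝ} (hp : 0 < p) (hb : 0 ≤ b) :
    ENNReal.ofReal p * ∫⁻ t in Ioo 0 b, ENNReal.ofReal (t ^ (p - 1)) = ENNReal.ofReal (b ^ p) := by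
  have hint : IntegrableOn (fun t : ℝ => t ^ (p - 1)) (Ioo 0 b) := by
    have := (intervalIntegral.intervalIntegrable_rpow' (a := 0) (b := b)
      (by linarith : -1 < p - 1)).1
    exact this.mono_set Ioo_subset_Ioc_self
  rw [← ofReal_integral_eq_lintegral_ofReal hint, ← ENNReal.ofReal_mul hp.le,
    ← integral_Ioc_eq_integral_Ioo, ← intervalIntegral.integral_of_le hb,
    integral_rpow (Or.inl (by linarith))]
  · congr 1
    simp only [sub_add_cancel, Real.zero_rpow hp.ne']
    field_simp
    ring
  · exact (ae_restrict_mem measurableSet_Ioo).mono fun t ht => Real.rpow_nonneg ht.1.le _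

theorem rpow_eq_lintegral_layer {p : ℝ} (hp : 0 < p) (a : ℝ≥0∞) :
    a ^ p = ENNReal.ofReal p * ∫⁻ t in Ioi (0 : ℝ), ENNReal.ofReal (t ^ (p - 1)) *
      {t : ℝ | ENNReal.ofReal t < a}.indicator 1 t := by
  have key : ∀ s : Set ℝ, MeasurableSet s →
      ∫⁻ t in Ioi (0 : ℝ), ENNReal.ofReal (t ^ (p - 1)) * s.indicator 1 t =
        ∫⁻ t in s ∩ Ioi 0, ENNReal.ofReal (t ^ (p - 1)) := by
    intro s hs
    rw [← Measure.restrict_restrict hs, ← lintegral_indicator hs]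
    congr 1 with t
    by_cases h : t ∈ s <;> simp [h]
  have hm : MeasurableSet {t : ℝ | ENNReal.ofReal t < a} :=
    measurableSet_lt ENNReal.measurable_ofReal measurable_const
  rw [key _ hm]
  induction a with
  | top =>
    rw [ENNReal.top_rpow_of_pos hp]
    symm
    refine ENNReal.eq_top_of_forall_nnreal_le fun r => ?_
    have h1 := setLIntegral_Ioo_rpow hp (b := (r : ℝ) ^ p⁻¹) (by positivity)
    rw [← Real.rpow_mul r.coe_nonneg, inv_mul_cancel₀ hp.ne', Real.rpow_one] at h1
    simp only [ENNReal.ofReal_coe_nnreal] at h1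
    rw [← h1]
    gcongr
    intro t ht
    exact ⟨by simp, ht.1⟩
  | coe b =>
    have : {t : ℝ | ENNReal.ofReal t < (b : ℝ≥0∞)} ∩ Ioi 0 = Ioo 0 (b : ℝ) := by
      ext t
      simp only [mem_inter_iff, mem_ofPred_eq, mem_Ioi, mem_Ioo]
      rw [← ENNReal.ofReal_coe_nnreal, and_comm]
      refine and_congr_right fun ht => ?_
      rw [ENNReal.ofReal_lt_ofReal_iff_of_nonneg ht.le]
    rw [this, setLIntegral_Ioo_rpow hp b.coe_nonneg, ← ENNReal.ofReal_rpow_of_nonneg b.coe_nonneg hp.le,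
      ENNReal.ofReal_coe_nnreal]

theorem measurable_indicator_ofReal_lt {α : Type*} [MeasurableSpace α] {u : α → ℝ≥0∞}
    (hu : Measurable u) :
    Measurable fun z : α × ℝ => {t : ℝ | ENNReal.ofReal t < u z.1}.indicator (1 : ℝ → ℝ≥0∞) z.2 := by
  have : (fun z : α × ℝ => {t : ℝ | ENNReal.ofReal t < u z.1}.indicator (1 : ℝ → ℝ≥0∞) z.2) =
      {z : α × ℝ | ENNReal.ofReal z.2 < u z.1}.indicator 1 := by
    ext z
    simp [indicator]
  rw [this]
  exact measurable_one.indicator (measurableSet_lt (by fun_prop) (by fun_prop))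

theorem lintegral_mul_rpow_layer {α : Type*} [MeasurableSpace α] {μ : Measure α} [SFinite μ]
    {p : ℝ} (hp : 0 < p) {u w : α → ℝ≥0∞} (hu : Measurable u) (hw : Measurable w) :
    ∫⁻ x, w x * u x ^ p ∂μ = ENNReal.ofReal p * ∫⁻ t in Ioi (0 : ℝ),
      ENNReal.ofReal (t ^ (p - 1)) * ∫⁻ x, {x | ENNReal.ofReal t < u x}.indicator w x ∂μ := by
  have hm := measurable_indicator_ofReal_lt hu
  calc ∫⁻ x, w x * u x ^ p ∂μ
      = ∫⁻ x, (ENNReal.ofReal p * ∫⁻ t in Ioi (0 : ℝ), w x * (ENNReal.ofReal (t ^ (p - 1)) *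
          {t : ℝ | ENNReal.ofReal t < u x}.indicator 1 t)) ∂μ := by
        congr 1 with x
        rw [rpow_eq_lintegral_layer hp (u x), lintegral_const_mul]
        · ring
        · exact (by fun_prop : Measurable fun t : ℝ => ENNReal.ofReal (t ^ (p - 1))).mul
            (hm.comp measurable_prodMk_left)
    _ = ENNReal.ofReal p * ∫⁻ x, (∫⁻ t in Ioi (0 : ℝ), w x * (ENNReal.ofReal (t ^ (p - 1)) *
          {t : ℝ | ENNReal.ofReal t < u x}.indicator 1 t)) ∂μ := by
        rw [lintegral_const_mul' _ _ ENNReal.ofReal_ne_top]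
    _ = _ := by
        rw [lintegral_lintegral_swap]
        · congr 2 with t
          rw [← lintegral_const_mul' _ _ ENNReal.ofReal_ne_top]
          congr 1 with x
          by_cases h : ENNReal.ofReal t < u x <;> simp [indicator, h, mul_comm]
        · refine Measurable.aemeasurable ?_
          exact (hw.comp measurable_fst).mul
            ((by fun_prop : Measurable fun z : α × ℝ => ENNReal.ofReal (z.2 ^ (p - 1))).mul hm)

theorem lintegral_rpow_layer {α : Type*} [MeasurableSpace α] {μ : Measure α} [SFinite μ]
    {p : ℝ} (hp : 0 < p) {u : α → ℝ≥0∞} (hu : Measurable u) :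
    ∫⁻ x, u x ^ p ∂μ = ENNReal.ofReal p * ∫⁻ t in Ioi (0 : ℝ),
      ENNReal.ofReal (t ^ (p - 1)) * μ {x | ENNReal.ofReal t < u x} := by
  have := lintegral_mul_rpow_layer (μ := μ) hp hu
    (measurable_const (a := (1 : ℝ≥0∞)))
  simp only [one_mul] at this
  rw [this]
  congr 2 with t
  rw [lintegral_indicator_const (measurableSet_lt measurable_const hu), one_mul]

theorem ofReal_rpow_pred {t p : ℝ} (ht : 0 < t) :
    ENNReal.ofReal (t ^ (p - 1)) = ENNReal.ofReal (t ^ (p - 1 - 1)) * ENNReal.ofReal t := by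
  rw [← ENNReal.ofReal_mul (by positivity)]
  congr 1
  rw [Real.rpow_sub_one ht.ne' (p - 1)]
  field_simp

theorem maxFn_strong_type {p : ℝ} (hp : 1 < p) : ∃ C : ℝ≥0∞, C ≠ ⊤ ∧ ∀ f : ℝ → ℝ≥0∞,
    Measurable f → ∫⁻ x, maxFn f x ^ p ≤ C * ∫⁻ x, f x ^ p := by
  have hp0 : 0 < p := by linarith
  have hp1 : 0 < p - 1 := by linarith
  refine ⟨ENNReal.ofReal p * 8 * (ENNReal.ofReal (p - 1))⁻¹ * 2 ^ (p - 1), ?_, fun f hf => ?_⟩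
  · have : ENNReal.ofReal (p - 1) ≠ 0 := by simp [hp]
    finiteness
  have h2 : ∫⁻ x, f x * (2 * f x) ^ (p - 1) = 2 ^ (p - 1) * ∫⁻ x, f x ^ p := by
    rw [← lintegral_const_mul _ (by fun_prop)]
    congr 1 with x
    rw [ENNReal.mul_rpow_of_nonneg _ _ hp1.le, mul_left_comm]
    congr 1
    nth_rw 1 [← ENNReal.rpow_one (f x)]
    rw [← ENNReal.rpow_add_of_nonneg _ _ (by norm_num) hp1.le]
    congr 1; ring
  have h3 := lintegral_mul_rpow_layer (μ := volume) hp1 (hf.const_mul 2) hf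
  rw [h2] at h3
  rw [lintegral_rpow_layer hp0 (measurable_maxFn f)]
  calc _ ≤ ENNReal.ofReal p * ∫⁻ t in Ioi (0 : ℝ), 8 * (ENNReal.ofReal (t ^ (p - 1 - 1)) *
        ∫⁻ x, {x | ENNReal.ofReal t < 2 * f x}.indicator f x) := by
        gcongr ENNReal.ofReal p * ?_
        refine setLIntegral_mono' measurableSet_Ioi fun t ht => ?_
        rw [ofReal_rpow_pred ht, mul_assoc, mul_left_comm 8]
        exact mul_le_mul' le_rfl (maxFn_weak_type_truncated f ht)
    _ = ENNReal.ofReal p * 8 * (ENNReal.ofReal (p - 1))⁻¹ * (2 ^ (p - 1) * ∫⁻ x, f x ^ p) := by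
        rw [lintegral_const_mul' _ _ (by simp), h3, ← mul_assoc, ← mul_assoc,
          mul_assoc (ENNReal.ofReal p * 8) (_⁻¹),
          ENNReal.inv_mul_cancel (by simp [hp]) ENNReal.ofReal_ne_top, mul_one]
    _ = _ := by ring

/-- The tail weight `(1 + |y - c| / L)⁻¹` adapted to the interval of center `c` and length `L`. -/
def tailWt (c L y : ℝ) : ℝ := (1 + |y - c| / L)⁻¹

theorem tailWt_pos {c L y : ℝ} (hL : 0 < L) : 0 < tailWt c L y := by
  unfold tailWt; positivity

theorem tailWt_le_one {c L y : ℝ} (hL : 0 < L) : tailWt c L y ≤ 1 := by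
  unfold tailWt
  apply inv_le_one_of_one_le₀
  have : 0 ≤ |y - c| / L := by positivity
  linarith

theorem continuous_tailWt {c L : ℝ} (hL : 0 < L) : Continuous (tailWt c L) := by
  unfold tailWt
  refine Continuous.inv₀ (by fun_prop) fun y => ?_
  positivity

theorem tailWt_le_mul {c L x y K : ℝ} (hL : 0 < L)
    (h : L + |x - c| ≤ K * (L + |y - c|)) : tailWt c L y ≤ K * tailWt c L x := by
  unfold tailWt
  rw [inv_le_iff_one_le_mul₀ (by positivity), mul_assoc, ← div_eq_inv_mul, mul_div_assoc',
    one_le_div (by positivity)]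
  have h1 : 1 + |x - c| / L = (L + |x - c|) / L := by field_simp
  have h2 : 1 + |y - c| / L = (L + |y - c|) / L := by field_simp
  rw [h1, h2, ← mul_div_assoc]
  gcongr

theorem ofReal_tailWt_sq_le_tsum {c L y : ℝ} (hL : 0 < L) :
    ENNReal.ofReal (tailWt c L y ^ 2) ≤ ∑' k : ℕ, ENNReal.ofReal (4 * (1 / 4) ^ k) *
      (Metric.ball c (2 ^ k * L)).indicator 1 y := by
  obtain ⟨k, hk, hle⟩ : ∃ k : ℕ, |y - c| < 2 ^ k * L ∧ tailWt c L y ^ 2 ≤ 4 * (1 / 4) ^ k := by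
    have hex : ∃ k : ℕ, |y - c| < 2 ^ k * L := by
      obtain ⟨k, hk⟩ := pow_unbounded_of_one_lt (|y - c| / L) (by norm_num : (1 : ℝ) < 2)
      exact ⟨k, by rwa [div_lt_iff₀ hL] at hk⟩
    classical
    refine ⟨Nat.find hex, Nat.find_spec hex, ?_⟩
    rcases h : Nat.find hex with _ | m
    · have := tailWt_le_one (c := c) (y := y) hL
      have := tailWt_pos (c := c) (y := y) hL
      norm_num
      nlinarith
    · have hm : 2 ^ m * L ≤ |y - c| := not_lt.1 (Nat.find_min hex (by omega))
      have h1 : tailWt c L y ≤ (2 ^ m)⁻¹ := by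
        unfold tailWt
        gcongr
        have : (2 : ℝ) ^ m ≤ |y - c| / L := by rwa [le_div_iff₀ hL]
        linarith
      calc tailWt c L y ^ 2 ≤ ((2 ^ m)⁻¹) ^ 2 := by
            have := tailWt_pos (c := c) (y := y) hL
            gcongr
        _ = 4 * (1 / 4) ^ (m + 1) := by
            rw [← inv_pow, ← pow_mul, mul_comm m 2, pow_mul]
            norm_num
            ring
  refine le_trans ?_ (ENNReal.le_tsum k)
  rw [indicator_of_mem (by simpa [Real.dist_eq] using hk)]
  simpa using ENNReal.ofReal_le_ofReal hle

theorem lintegral_mul_tailWt_sq_le (f : ℝ → ℝ≥0∞) (hf : AEMeasurable f) {c L : ℝ} (hL : 0 < L)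
    {m : ℝ≥0∞}
    (h : ∀ k : ℕ, ∫⁻ y in Metric.ball c (2 ^ k * L), f y ≤ ENNReal.ofReal (2 * (2 ^ k * L)) * m) :
    ∫⁻ y, f y * ENNReal.ofReal (tailWt c L y ^ 2) ≤ 16 * ENNReal.ofReal L * m := by
  calc ∫⁻ y, f y * ENNReal.ofReal (tailWt c L y ^ 2)
      ≤ ∫⁻ y, ∑' k : ℕ, ENNReal.ofReal (4 * (1 / 4) ^ k) *
          (Metric.ball c (2 ^ k * L)).indicator f y := by
        refine lintegral_mono fun y => ?_
        refine (mul_le_mul' le_rfl (ofReal_tailWt_sq_le_tsum hL)).trans ?_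
        rw [← ENNReal.tsum_mul_left]
        refine ENNReal.tsum_le_tsum fun k => le_of_eq ?_
        by_cases hy : y ∈ Metric.ball c (2 ^ k * L)
        · simp only [indicator_of_mem hy, Pi.one_apply, mul_one]
          ring
        · simp only [indicator_of_notMem hy, mul_zero]
    _ = ∑' k : ℕ, ENNReal.ofReal (4 * (1 / 4) ^ k) * ∫⁻ y in Metric.ball c (2 ^ k * L), f y := by
        rw [lintegral_tsum]
        · refine tsum_congr fun k => ?_
          rw [lintegral_const_mul' _ _ ENNReal.ofReal_ne_top, lintegral_indicator measurableSet_ball]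
        · exact fun k => (hf.indicator measurableSet_ball).const_mul _
    _ ≤ ∑' k : ℕ, ENNReal.ofReal (8 * L * (1 / 2) ^ k) * m := by
        refine ENNReal.tsum_le_tsum fun k => (mul_le_mul' le_rfl (h k)).trans (le_of_eq ?_)
        rw [← mul_assoc, ← ENNReal.ofReal_mul (by positivity)]
        congr 2
        have : (1 / 4 : ℝ) ^ k * 2 ^ k = (1 / 2) ^ k := by rw [← mul_pow]; norm_num
        rw [← this]; ring
    _ = 16 * ENNReal.ofReal L * m := by
        rw [ENNReal.tsum_mul_right, ← ENNReal.ofReal_tsum_of_nonneg (fun k => by positivity)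
          ((summable_geometric_of_lt_one (by norm_num) (by norm_num)).mul_left _), tsum_mul_left,
          tsum_geometric_of_lt_one (by norm_num) (by norm_num)]
        congr 1
        rw [show (16 : ℝ≥0∞) = ENNReal.ofReal 16 by simp, ← ENNReal.ofReal_mul (by norm_num)]
        congr 1; ring

theorem lintegral_tailWt_sq_le {c L : ℝ} (hL : 0 < L) :
    ∫⁻ y, ENNReal.ofReal (tailWt c L y ^ 2) ≤ 16 * ENNReal.ofReal L := by
  have := lintegral_mul_tailWt_sq_le (fun _ => 1) aemeasurable_const (c := c) hL (m := 1)
    (fun k => by simp)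
  simpa using this

theorem lintegral_mul_tailWt_sq_le_maxFn {f : ℝ → ℝ≥0∞} (hf : AEMeasurable f) {c L x : ℝ}
    (hL : 0 < L) (hx : |x - c| < L) :
    ∫⁻ y, f y * ENNReal.ofReal (tailWt c L y ^ 2) ≤ 16 * ENNReal.ofReal L * maxFn f x := by
  refine lintegral_mul_tailWt_sq_le f hf hL fun k => lintegral_ball_le_maxFn f ?_
  have : (1 : ℝ) ≤ 2 ^ k := one_le_pow₀ (by norm_num)
  rw [Metric.mem_ball, Real.dist_eq]
  nlinarith

theorem integrable_tailWt_sq {c L : ℝ} (hL : 0 < L) :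
    Integrable fun y => tailWt c L y ^ 2 := by
  refine ⟨((continuous_tailWt hL).pow 2).aestronglyMeasurable, ?_⟩
  rw [hasFiniteIntegral_iff_ofReal (Filter.Eventually.of_forall fun y => sq_nonneg _)]
  exact (lintegral_tailWt_sq_le hL).trans_lt (by finiteness)

theorem integral_tailWt_sq_le {c L : ℝ} (hL : 0 < L) : ∫ y, tailWt c L y ^ 2 ≤ 16 * L := by
  rw [integral_eq_lintegral_of_nonneg_ae (Filter.Eventually.of_forall fun y => sq_nonneg _)
    ((continuous_tailWt hL).pow 2).aestronglyMeasurable]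
  refine ENNReal.toReal_le_of_le_ofReal (by positivity) ?_
  refine (lintegral_tailWt_sq_le hL).trans (le_of_eq ?_)
  rw [ENNReal.ofReal_mul (by norm_num)]
  simp

/-- A function concentrated, together with its derivative, around the interval of center `c` and
length `L`, in the `L^∞` normalization. -/
structure IsTailBump (A c L : ℝ) (φ : ℝ → ℂ) : Prop where
  differentiable : Differentiable ℝ φ
  norm_le : ∀ y, ‖φ y‖ ≤ A * tailWt c L y ^ 5
  norm_deriv_le : ∀ y, ‖deriv φ y‖ ≤ A / L * tailWt c L y ^ 5

theorem div_infDist_le {c L y K : ℝ} (hL : 0 < L) :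
    K / (1 + Metric.infDist y (Icc (c - L / 2) (c + L / 2)) / L) ^ 5 ≤
      32 * |K| * tailWt c L y ^ 5 := by
  set d := Metric.infDist y (Icc (c - L / 2) (c + L / 2)) with hd
  have hd0 : 0 ≤ d := Metric.infDist_nonneg
  have h1 : |y - c| ≤ d + L / 2 := by
    have hne : (Icc (c - L / 2) (c + L / 2)).Nonempty := ⟨c, by constructor <;> linarith⟩
    suffices |y - c| - L / 2 ≤ d by linarith
    rw [hd, Metric.le_infDist hne]
    rintro z ⟨hz1, hz2⟩
    rw [Real.dist_eq]
    have h2 : |z - c| ≤ L / 2 := abs_le.2 ⟨by linarith, by linarith⟩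
    have h3 : |y - c| ≤ |y - z| + |z - c| := abs_sub_le _ _ _
    linarith
  have h2 : (1 + |y - c| / L) / 2 ≤ 1 + d / L := by
    have : |y - c| / L ≤ d / L + 1 / 2 := by
      rw [div_le_iff₀ hL]; field_simp; linarith
    have : 0 ≤ d / L := by positivity
    linarith
  calc K / (1 + d / L) ^ 5 ≤ |K| / ((1 + |y - c| / L) / 2) ^ 5 := by
        have := le_abs_self K
        gcongr
    _ = 32 * |K| * tailWt c L y ^ 5 := by
        unfold tailWt
        have : (1 + |y - c| / L) ≠ 0 := by positivity
        field_simp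
        norm_num

theorem IsBump.isTailBump {C : ℕ → ℕ → ℝ} {c L : ℝ} {φ : ℝ → ℂ} (hL : 0 < L)
    (h : IsBump C c L φ) : IsTailBump (32 * (|C 0 5| + |C 1 5|) + 1) c L φ := by
  refine ⟨h.1.differentiable (by simp), fun y => ?_, fun y => ?_⟩
  · have h1 := h.2 0 5 y
    rw [iteratedDeriv_zero, pow_zero, one_mul] at h1
    refine h1.trans ((div_infDist_le hL).trans ?_)
    have := tailWt_pos (c := c) (y := y) hL
    gcongr
    linarith [abs_nonneg (C 1 5)]
  · have h1 := h.2 1 5 y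
    rw [iteratedDeriv_one, pow_one, mul_comm L, ← div_div] at h1
    refine h1.trans ?_
    rw [div_mul_eq_mul_div]
    gcongr
    refine (div_infDist_le hL).trans ?_
    have := tailWt_pos (c := c) (y := y) hL
    gcongr
    linarith [abs_nonneg (C 0 5)]

namespace IsTailBump

variable {A c L : ℝ} {φ : ℝ → ℂ}

theorem norm_le_sq (h : IsTailBump A c L φ) (hA : 0 ≤ A) (hL : 0 < L) (y : ℝ) :
    ‖φ y‖ ≤ A * tailWt c L y ^ 2 := by
  refine (h.norm_le y).trans ?_
  exact mul_le_mul_of_nonneg_left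
    (pow_le_pow_of_le_one (tailWt_pos hL).le (tailWt_le_one hL) (by norm_num)) hA

theorem norm_le_const (h : IsTailBump A c L φ) (hA : 0 ≤ A) (hL : 0 < L) (y : ℝ) :
    ‖φ y‖ ≤ A := by
  refine (h.norm_le y).trans ?_
  exact mul_le_of_le_one_right hA (pow_le_one₀ (tailWt_pos hL).le (tailWt_le_one hL))

theorem continuous (h : IsTailBump A c L φ) : Continuous φ := h.differentiable.continuous

theorem integrable (h : IsTailBump A c L φ) (hA : 0 ≤ A) (hL : 0 < L) : Integrable φ :=
  ((integrable_tailWt_sq hL).const_mul A).mono' h.continuous.aestronglyMeasurable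
    (Filter.Eventually.of_forall (h.norm_le_sq hA hL))

end IsTailBump

theorem dyadLen_pos (p : ℤ × ℤ) : 0 < dyadLen p := by unfold dyadLen; positivity

/-- The half-open dyadic interval `2^k [n, n+1)` encoded as `(k, n)`. -/
def dyadIco (p : ℤ × ℤ) : Set ℝ := Ico ((2 : ℝ) ^ p.1 * p.2) ((2 : ℝ) ^ p.1 * (p.2 + 1))

theorem measurableSet_dyadIco (p : ℤ × ℤ) : MeasurableSet (dyadIco p) := measurableSet_Ico

theorem volume_dyadIco (p : ℤ × ℤ) : volume (dyadIco p) = ENNReal.ofReal (dyadLen p) := by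
  rw [dyadIco, Real.volume_Ico, dyadLen]
  congr 1; ring

theorem abs_sub_dyadCenter_le {p : ℤ × ℤ} {y : ℝ} (hy : y ∈ dyadIco p) :
    |y - dyadCenter p| ≤ dyadLen p / 2 := by
  obtain ⟨h1, h2⟩ := hy
  unfold dyadCenter dyadLen
  rw [abs_le]; constructor <;> linarith

theorem mem_dyadIco_iff_floor {p : ℤ × ℤ} {y : ℝ} :
    y ∈ dyadIco p ↔ ⌊y / (2 : ℝ) ^ p.1⌋ = p.2 := by
  have : (0 : ℝ) < 2 ^ p.1 := by positivity
  rw [Int.floor_eq_iff, dyadIco, mem_Ico, le_div_iff₀ this, div_lt_iff₀ this, mul_comm,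
    mul_comm ((2 : ℝ) ^ p.1)]

theorem dyadCenter_mem_dyadIco (p : ℤ × ℤ) : dyadCenter p ∈ dyadIco p := by
  have : (0 : ℝ) < 2 ^ p.1 := by positivity
  unfold dyadCenter dyadIco
  constructor
  · gcongr; linarith
  · gcongr; linarith

theorem dyadLen_le_iff {p q : ℤ × ℤ} : dyadLen p ≤ dyadLen q ↔ p.1 ≤ q.1 :=
  zpow_le_zpow_iff_right₀ (by norm_num)

theorem dyadIco_subset {p q : ℤ × ℤ} (h : p.1 ≤ q.1) {y : ℝ} (hp : y ∈ dyadIco p)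
    (hq : y ∈ dyadIco q) : dyadIco p ⊆ dyadIco q := by
  intro x hx
  rw [mem_dyadIco_iff_floor] at *
  obtain ⟨n, hn⟩ := Int.le.dest h
  have key : ∀ z : ℝ, ⌊z / (2 : ℝ) ^ q.1⌋ = ⌊z / (2 : ℝ) ^ p.1⌋ / ((2 ^ n : ℕ) : ℤ) := by
    intro z
    rw [← Int.floor_div_natCast, ← hn, zpow_add₀ (by norm_num), zpow_natCast, ← div_div]
    push_cast
    rfl
  rw [key] at hq ⊢
  rw [hx, ← hp, hq]

theorem eq_of_mem_dyadIco {p q : ℤ × ℤ} (h : p.1 = q.1) {y : ℝ} (hp : y ∈ dyadIco p)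
    (hq : y ∈ dyadIco q) : p = q := by
  rw [mem_dyadIco_iff_floor] at *
  rw [h] at hp
  exact Prod.ext h (hp.symm.trans hq)

theorem dyadIco_disjoint_or_subset {p q : ℤ × ℤ} (h : p.1 ≤ q.1) :
    dyadIco p ⊆ dyadIco q ∨ Disjoint (dyadIco p) (dyadIco q) := by
  by_cases hd : Disjoint (dyadIco p) (dyadIco q)
  · exact Or.inr hd
  · obtain ⟨y, hp, hq⟩ := not_disjoint_iff.1 hd
    exact Or.inl (dyadIco_subset h hp hq)

theorem sum_tailWt_sq_le {𝓙 : Finset (ℤ × ℤ)} {k : ℤ} (h𝓙 : ∀ J ∈ 𝓙, J.1 = k) {u R : ℝ}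
    (hR : (2 : ℝ) ^ k ≤ R) :
    ∑ J ∈ 𝓙, tailWt u R (dyadCenter J) ^ 2 ≤ 36 * R / (2 : ℝ) ^ k := by
  have hk : (0 : ℝ) < 2 ^ k := by positivity
  have hR0 : 0 < R := hk.trans_le hR
  rw [le_div_iff₀ hk, Finset.sum_mul]
  calc ∑ J ∈ 𝓙, tailWt u R (dyadCenter J) ^ 2 * 2 ^ k
      ≤ ∑ J ∈ 𝓙, ∫ v in dyadIco J, 9 / 4 * tailWt u R v ^ 2 := by
        refine Finset.sum_le_sum fun J hJ => ?_
        have hlen : dyadLen J = 2 ^ k := by rw [dyadLen, h𝓙 J hJ]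
        have hvol : volume.real (dyadIco J) = 2 ^ k := by
          rw [measureReal_def, volume_dyadIco, ENNReal.toReal_ofReal (dyadLen_pos J).le, hlen]
        have hconst : ∫ _ in dyadIco J, tailWt u R (dyadCenter J) ^ 2 =
            tailWt u R (dyadCenter J) ^ 2 * 2 ^ k := by
          rw [setIntegral_const, hvol, smul_eq_mul, mul_comm]
        rw [← hconst]
        refine setIntegral_mono_on ?_ ((integrable_tailWt_sq hR0).const_mul _).integrableOn
          (measurableSet_dyadIco J) fun v hv => ?_
        · rw [integrableOn_const_iff]
          right; rw [volume_dyadIco]; exact ENNReal.ofReal_lt_top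
        · have h1 : tailWt u R (dyadCenter J) ≤ 3 / 2 * tailWt u R v := by
            refine tailWt_le_mul hR0 ?_
            have h2 := abs_sub_dyadCenter_le hv
            have h3 : |v - u| ≤ |v - dyadCenter J| + |dyadCenter J - u| := abs_sub_le _ _ _
            have := abs_nonneg (dyadCenter J - u)
            rw [hlen] at h2
            linarith
          calc _ ≤ (3 / 2 * tailWt u R v) ^ 2 := by
                have := tailWt_pos (c := u) (y := dyadCenter J) hR0
                gcongr
            _ = _ := by ring
    _ = ∫ v in ⋃ J ∈ 𝓙, dyadIco J, 9 / 4 * tailWt u R v ^ 2 := by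
        rw [integral_biUnion_finset]
        · exact fun J _ => measurableSet_dyadIco J
        · intro p hp q hq hpq
          refine disjoint_left.2 fun y hy hy' => hpq ?_
          exact eq_of_mem_dyadIco ((h𝓙 p hp).trans (h𝓙 q hq).symm) hy hy'
        · exact fun J _ => ((integrable_tailWt_sq hR0).const_mul _).integrableOn
    _ ≤ ∫ v, 9 / 4 * tailWt u R v ^ 2 :=
        setIntegral_le_integral ((integrable_tailWt_sq hR0).const_mul _)
          (Filter.Eventually.of_forall fun v => by positivity)
    _ ≤ 36 * R := by
        rw [integral_const_mul]
        have := integral_tailWt_sq_le (c := u) hR0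
        linarith

theorem sum_sub_le_of_antitone {g : ℤ → ℝ} {B : ℝ} (hg : ∀ k, g (k + 1) ≤ g k)
    (h0 : ∀ k, 0 ≤ g k) (hB : ∀ k, g k ≤ B) (K : Finset ℤ) :
    ∑ k ∈ K, (g k - g (k + 1)) ≤ B := by
  obtain ⟨a, ha⟩ := K.bddBelow
  obtain ⟨b, hb⟩ := K.bddAbove
  have hsum : ∀ n : ℕ, ∑ i ∈ Finset.range n, (g (a + i) - g (a + i + 1)) ≤ B := by
    intro n
    have := Finset.sum_range_sub' (fun i : ℕ => g (a + i)) n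
    push_cast at this
    simp only [← add_assoc] at this
    rw [this]
    have := hB (a + (0 : ℕ))
    have := h0 (a + n)
    push_cast at *
    linarith
  refine le_trans ?_ (hsum (b - a + 1).toNat)
  rw [← Finset.sum_image (f := fun k => g k - g (k + 1)) (g := fun i : ℕ => a + (i : ℤ))
    (fun i _ j _ h => by simpa using h)]
  refine Finset.sum_le_sum_of_subset_of_nonneg (fun k hk => ?_)
    fun k _ _ => sub_nonneg.2 (hg k)
  have h1 := ha hk
  have h2 := hb hk
  simp only [Finset.mem_image, Finset.mem_range]
  exact ⟨(k - a).toNat, by omega, by omega⟩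

theorem sum_zpow_div_sq_le {L : ℝ} (hL : 0 < L) (K : Finset ℤ) :
    ∑ k ∈ K, (2 : ℝ) ^ k / (2 ^ k + L) ^ 2 ≤ 2 / L := by
  have h := sum_sub_le_of_antitone (g := fun k : ℤ => ((2 : ℝ) ^ k + L)⁻¹) (B := L⁻¹) (fun k => ?_)
    (fun k => by positivity) (fun k => ?_) K
  · calc ∑ k ∈ K, (2 : ℝ) ^ k / (2 ^ k + L) ^ 2
        ≤ ∑ k ∈ K, 2 * (((2 : ℝ) ^ k + L)⁻¹ - ((2 : ℝ) ^ (k + 1) + L)⁻¹) := by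
          refine Finset.sum_le_sum fun k _ => ?_
          have hk : (0 : ℝ) < 2 ^ k := by positivity
          rw [zpow_add_one₀ (by norm_num)]
          generalize (2 : ℝ) ^ k = t at *
          have : 2 * ((t + L)⁻¹ - (t * 2 + L)⁻¹) = 2 * t / ((t + L) * (t * 2 + L)) := by
            field_simp; ring
          rw [this, div_le_div_iff₀ (by positivity) (by positivity)]
          have : 0 < t * L := by positivity
          have : 0 < t * t * L := by positivity
          have : 0 < t * L * L := by positivity
          nlinarith
      _ ≤ 2 / L := by
          rw [← Finset.mul_sum, div_eq_mul_inv]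
          gcongr
  · gcongr
    · norm_num
    · omega
  · have : (0 : ℝ) < 2 ^ k := by positivity
    gcongr
    linarith

/-- The decay factor governing the interaction of two adapted families of bumps. -/
def bumpKernel (p q : ℤ × ℤ) : ℝ :=
  min (dyadLen p) (dyadLen q) ^ 2 / max (dyadLen p) (dyadLen q) *
    tailWt (dyadCenter p) (max (dyadLen p) (dyadLen q)) (dyadCenter q) ^ 2

theorem bumpKernel_comm (p q : ℤ × ℤ) : bumpKernel p q = bumpKernel q p := by
  unfold bumpKernel tailWt
  rw [min_comm, max_comm, abs_sub_comm]

theorem bumpKernel_nonneg (p q : ℤ × ℤ) : 0 ≤ bumpKernel p q := by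
  have := dyadLen_pos p
  have := dyadLen_pos q
  unfold bumpKernel
  positivity

theorem bumpKernel_of_le {p q : ℤ × ℤ} (h : dyadLen q ≤ dyadLen p) :
    bumpKernel p q = dyadLen q ^ 2 / dyadLen p *
      tailWt (dyadCenter p) (dyadLen p) (dyadCenter q) ^ 2 := by
  rw [bumpKernel, min_eq_right h, max_eq_left h]

theorem sum_bumpKernel_le (p : ℤ × ℤ) (𝓙 : Finset (ℤ × ℤ)) :
    ∑ q ∈ 𝓙, bumpKernel p q ≤ 288 * dyadLen p := by
  have hL := dyadLen_pos p
  rw [← Finset.sum_fiberwise_of_maps_to (g := Prod.fst) (t := 𝓙.image Prod.fst)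
    (fun q hq => Finset.mem_image_of_mem _ hq)]
  calc _ ≤ ∑ k ∈ 𝓙.image Prod.fst, 144 * dyadLen p ^ 2 * ((2 : ℝ) ^ k / (2 ^ k + dyadLen p) ^ 2) := by
        refine Finset.sum_le_sum fun k _ => ?_
        have hk : (0 : ℝ) < 2 ^ k := by positivity
        have hmem : ∀ q ∈ 𝓙.filter (fun q => q.1 = k), q.1 = k := fun q hq =>
          (Finset.mem_filter.1 hq).2
        have hsum := sum_tailWt_sq_le hmem (u := dyadCenter p) (R := max (dyadLen p) (2 ^ k))
          (le_max_right _ _)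
        have : ∑ q ∈ 𝓙 with q.1 = k, bumpKernel p q = min (dyadLen p) (2 ^ k) ^ 2 /
            max (dyadLen p) (2 ^ k) * ∑ q ∈ 𝓙 with q.1 = k,
              tailWt (dyadCenter p) (max (dyadLen p) (2 ^ k)) (dyadCenter q) ^ 2 := by
          rw [Finset.mul_sum]
          refine Finset.sum_congr rfl fun q hq => ?_
          have : dyadLen q = 2 ^ k := by rw [dyadLen, hmem q hq]
          rw [bumpKernel, this]
        rw [this]
        refine (mul_le_mul_of_nonneg_left hsum (by positivity)).trans ?_
        generalize (2 : ℝ) ^ k = s at *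
        generalize dyadLen p = L at *
        rw [mul_div_assoc', mul_div_assoc', le_div_iff₀ (by positivity)]
        rcases le_total L s with h | h
        · rw [min_eq_left h, max_eq_right h]
          field_simp
          nlinarith
        · rw [min_eq_right h, max_eq_left h]
          field_simp
          nlinarith
    _ ≤ 144 * dyadLen p ^ 2 * (2 / dyadLen p) := by
        rw [← Finset.mul_sum]
        gcongr
        exact sum_zpow_div_sq_le hL _
    _ = 288 * dyadLen p := by field_simp; norm_num

theorem tailWt_le_inv_mul {c R r ξ y z : ℝ} (hr : 0 < r) (hrR : r ≤ R) (hξ : ξ ∈ uIcc z y) :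
    tailWt c R ξ ≤ (tailWt z r y)⁻¹ * tailWt c R z := by
  have hR : 0 < R := hr.trans_le hrR
  refine tailWt_le_mul hR ?_
  rw [tailWt, inv_inv]
  have h1 : |z - ξ| ≤ |y - z| := by
    rw [abs_sub_comm]; exact abs_sub_left_of_mem_uIcc hξ
  have h2 : |z - c| ≤ |z - ξ| + |ξ - c| := abs_sub_le _ _ _
  have h3 : |y - z| ≤ |y - z| / r * R := by
    rw [div_mul_eq_mul_div, le_div_iff₀ hr]; gcongr
  have h4 : 0 ≤ |y - z| / r * |ξ - c| := by positivity
  nlinarith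

theorem IsTailBump.norm_sub_mul_le {A c R r : ℝ} {φ : ℝ → ℂ} (h : IsTailBump A c R φ) (hA : 0 ≤ A)
    (hr : 0 < r) (hrR : r ≤ R) (y z : ℝ) :
    ‖φ y - φ z‖ * tailWt z r y ^ 3 ≤ A * r / R * tailWt c R z ^ 2 := by
  have hR : 0 < R := hr.trans_le hrR
  have hK : 0 < tailWt z r y := tailWt_pos hr
  have hW : 0 < tailWt c R z := tailWt_pos hR
  have h1 : ‖φ y - φ z‖ ≤ A / R * ((tailWt z r y)⁻¹ * tailWt c R z) ^ 2 * ‖y - z‖ := by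
    refine Convex.norm_image_sub_le_of_norm_deriv_le (s := uIcc z y)
      (fun ξ _ => h.differentiable ξ) (fun ξ hξ => ?_) (convex_uIcc z y) left_mem_uIcc right_mem_uIcc
    refine (h.norm_deriv_le ξ).trans (mul_le_mul_of_nonneg_left ?_ (by positivity))
    have h2 : 0 < tailWt c R ξ := tailWt_pos hR
    calc tailWt c R ξ ^ 5 ≤ tailWt c R ξ ^ 2 :=
          pow_le_pow_of_le_one h2.le (tailWt_le_one hR) (by norm_num)
      _ ≤ _ := by
          have := tailWt_le_inv_mul (c := c) hr hrR hξ
          gcongr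
  have h3 : ‖y - z‖ * tailWt z r y ≤ r := by
    rw [tailWt, ← div_eq_mul_inv, div_le_iff₀ (by positivity), Real.norm_eq_abs]
    have : r * (1 + |y - z| / r) = r + |y - z| := by field_simp
    linarith
  calc ‖φ y - φ z‖ * tailWt z r y ^ 3
      ≤ A / R * ((tailWt z r y)⁻¹ * tailWt c R z) ^ 2 * ‖y - z‖ * tailWt z r y ^ 3 := by gcongr
    _ = A / R * tailWt c R z ^ 2 * (‖y - z‖ * tailWt z r y) := by field_simp
    _ ≤ A / R * tailWt c R z ^ 2 * r := by gcongr
    _ = _ := by ring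

theorem norm_pair_comm (φ ψ : ℝ → ℂ) : ‖pair φ ψ‖ = ‖pair ψ φ‖ := by
  have : pair φ ψ = (starRingEnd ℂ) (pair ψ φ) := by
    unfold pair
    rw [← integral_conj]
    congr 1 with x
    simp [mul_comm]
  rw [this, RCLike.norm_conj]

theorem norm_pair_bump_le_of_le {A : ℝ} (hA : 0 ≤ A) {p q : ℤ × ℤ} (hpq : dyadLen q ≤ dyadLen p)
    {φ ψ : ℝ → ℂ} (hφ : IsTailBump A (dyadCenter p) (dyadLen p) φ)
    (hψ : IsTailBump A (dyadCenter q) (dyadLen q) ψ) (hψ0 : ∫ y, ψ y = 0) :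
    ‖pair φ ψ‖ ≤ 16 * A ^ 2 * bumpKernel p q := by
  have hp := dyadLen_pos p
  have hq := dyadLen_pos q
  have hint : Integrable fun y => (starRingEnd ℂ) (ψ y) :=
    (hψ.integrable hA hq).mono (RCLike.continuous_conj.comp hψ.continuous).aestronglyMeasurable
      (by simp)
  have h0 : ∫ y, (starRingEnd ℂ) (ψ y) = 0 := by
    rw [integral_conj, hψ0, map_zero]
  have hint2 : Integrable fun y => φ y * (starRingEnd ℂ) (ψ y) :=
    hint.bdd_mul hφ.continuous.aestronglyMeasurable
      (Filter.Eventually.of_forall (hφ.norm_le_const hA hp))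
  have heq : pair φ ψ = ∫ y, (φ y - φ (dyadCenter q)) * (starRingEnd ℂ) (ψ y) := by
    simp_rw [sub_mul]
    rw [integral_sub hint2 (hint.const_mul _), integral_const_mul, h0, mul_zero, sub_zero, pair]
  set W := tailWt (dyadCenter p) (dyadLen p) (dyadCenter q) with hW
  have hb : ∀ y, ‖(φ y - φ (dyadCenter q)) * (starRingEnd ℂ) (ψ y)‖ ≤
      A ^ 2 * dyadLen q / dyadLen p * W ^ 2 * tailWt (dyadCenter q) (dyadLen q) y ^ 2 := by
    intro y
    have hK := tailWt_pos (c := dyadCenter q) (y := y) hq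
    rw [norm_mul, RCLike.norm_conj]
    calc _ ≤ ‖φ y - φ (dyadCenter q)‖ * (A * tailWt (dyadCenter q) (dyadLen q) y ^ 5) := by
          gcongr; exact hψ.norm_le y
      _ = A * (‖φ y - φ (dyadCenter q)‖ * tailWt (dyadCenter q) (dyadLen q) y ^ 3) *
          tailWt (dyadCenter q) (dyadLen q) y ^ 2 := by ring
      _ ≤ A * (A * dyadLen q / dyadLen p * W ^ 2) *
          tailWt (dyadCenter q) (dyadLen q) y ^ 2 := by
          refine mul_le_mul_of_nonneg_right (mul_le_mul_of_nonneg_left ?_ hA) (sq_nonneg _)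
          exact hφ.norm_sub_mul_le hA hq hpq y _
      _ = _ := by ring
  rw [heq]
  calc _ ≤ ∫ y, A ^ 2 * dyadLen q / dyadLen p * W ^ 2 *
        tailWt (dyadCenter q) (dyadLen q) y ^ 2 :=
        norm_integral_le_of_norm_le ((integrable_tailWt_sq hq).const_mul _)
          (Filter.Eventually.of_forall hb)
    _ ≤ A ^ 2 * dyadLen q / dyadLen p * W ^ 2 * (16 * dyadLen q) := by
        rw [integral_const_mul]
        gcongr
        exact integral_tailWt_sq_le hq
    _ = _ := by rw [bumpKernel_of_le hpq]; ring

/-- A family of mean-zero bumps indexed by the dyadic intervals, in the `L^∞` normalization. -/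
structure IsBumpFamily (A : ℝ) (φ : ℤ × ℤ → ℝ → ℂ) : Prop where
  pos : 0 < A
  bump : ∀ J, IsTailBump A (dyadCenter J) (dyadLen J) (φ J)
  integral_eq_zero : ∀ J, ∫ y, φ J y = 0

theorem IsBumpFamily.norm_pair_le {A : ℝ} {φ : ℤ × ℤ → ℝ → ℂ} (h : IsBumpFamily A φ)
    (p q : ℤ × ℤ) : ‖pair (φ p) (φ q)‖ ≤ 16 * A ^ 2 * bumpKernel p q := by
  rcases le_total (dyadLen q) (dyadLen p) with hpq | hpq
  · exact norm_pair_bump_le_of_le h.pos.le hpq (h.bump p) (h.bump q) (h.integral_eq_zero q)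
  · rw [norm_pair_comm, bumpKernel_comm]
    exact norm_pair_bump_le_of_le h.pos.le hpq (h.bump q) (h.bump p) (h.integral_eq_zero p)

theorem sum_sum_mul_bumpKernel_le (𝓙 : Finset (ℤ × ℤ)) (a : ℤ × ℤ → ℝ) :
    ∑ p ∈ 𝓙, ∑ q ∈ 𝓙, a p * a q * bumpKernel p q ≤ 288 * ∑ p ∈ 𝓙, a p ^ 2 * dyadLen p := by
  have h1 : ∀ p q, a p * a q * bumpKernel p q ≤
      1 / 2 * (a p ^ 2 * bumpKernel p q) + 1 / 2 * (a q ^ 2 * bumpKernel q p) := fun p q => by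
    rw [bumpKernel_comm q p]
    nlinarith [bumpKernel_nonneg p q, sq_nonneg (a p - a q),
      mul_nonneg (sq_nonneg (a p - a q)) (bumpKernel_nonneg p q)]
  have h2 : ∑ p ∈ 𝓙, ∑ q ∈ 𝓙, a p ^ 2 * bumpKernel p q ≤ 288 * ∑ p ∈ 𝓙, a p ^ 2 * dyadLen p := by
    rw [Finset.mul_sum]
    refine Finset.sum_le_sum fun p _ => ?_
    rw [← Finset.mul_sum, mul_left_comm]
    exact mul_le_mul_of_nonneg_left (sum_bumpKernel_le p 𝓙) (sq_nonneg _)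
  have h3 := Finset.sum_comm (s := 𝓙) (t := 𝓙) (f := fun p q => a q ^ 2 * bumpKernel q p)
  calc _ ≤ ∑ p ∈ 𝓙, ∑ q ∈ 𝓙,
        (1 / 2 * (a p ^ 2 * bumpKernel p q) + 1 / 2 * (a q ^ 2 * bumpKernel q p)) :=
        Finset.sum_le_sum fun p _ => Finset.sum_le_sum fun q _ => h1 p q
    _ ≤ _ := by
        have h4 : ∀ F : ℤ × ℤ → ℤ × ℤ → ℝ, ∑ p ∈ 𝓙, ∑ q ∈ 𝓙, 1 / 2 * F p q =
            1 / 2 * ∑ p ∈ 𝓙, ∑ q ∈ 𝓙, F p q := fun F => by simp_rw [Finset.mul_sum]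
        simp_rw [Finset.sum_add_distrib]
        rw [h4, h4, h3]
        linarith

namespace IsTailBump

variable {A c L : ℝ} {φ : ℝ → ℂ}

theorem integrable_norm_sq (h : IsTailBump A c L φ) (hA : 0 ≤ A) (hL : 0 < L) :
    Integrable fun y => ‖φ y‖ ^ 2 := by
  refine ((h.integrable hA hL).norm.const_mul A).mono'
    (h.continuous.norm.pow 2).aestronglyMeasurable (Filter.Eventually.of_forall fun y => ?_)
  rw [Real.norm_of_nonneg (by positivity), sq]
  exact mul_le_mul_of_nonneg_right (h.norm_le_const hA hL y) (norm_nonneg _)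

theorem integrable_mul_conj (h : IsTailBump A c L φ) (hA : 0 ≤ A) (hL : 0 < L) {f : ℝ → ℂ}
    (hf : AEStronglyMeasurable f) (hf2 : Integrable fun y => ‖f y‖ ^ 2) :
    Integrable fun y => f y * (starRingEnd ℂ) (φ y) := by
  refine (hf2.add (h.integrable_norm_sq hA hL)).mono'
    (hf.mul (RCLike.continuous_conj.comp h.continuous).aestronglyMeasurable)
    (Filter.Eventually.of_forall fun y => ?_)
  rw [norm_mul, RCLike.norm_conj]
  simp only [Pi.add_apply]
  nlinarith [sq_nonneg (‖f y‖ - ‖φ y‖), sq_nonneg (‖f y‖), sq_nonneg (‖φ y‖)]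

end IsTailBump

theorem IsBumpFamily.sum_sq_pair_le {A : ℝ} {φ : ℤ × ℤ → ℝ → ℂ} (h : IsBumpFamily A φ)
    (𝓙 : Finset (ℤ × ℤ)) {f : ℝ → ℂ} (hf : AEStronglyMeasurable f)
    (hf2 : Integrable fun y => ‖f y‖ ^ 2) :
    ∑ J ∈ 𝓙, ‖pair f (φ J)‖ ^ 2 / dyadLen J ≤ 4608 * A ^ 2 * ∫ y, ‖f y‖ ^ 2 := by
  set a : ℤ × ℤ → ℂ := fun J => pair f (φ J) / dyadLen J with ha
  set F : ℝ → ℂ := fun y => ∑ J ∈ 𝓙, a J * φ J y with hF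
  set X := ∑ J ∈ 𝓙, ‖pair f (φ J)‖ ^ 2 / dyadLen J with hX
  set t := 4608 * A ^ 2 with ht
  have hA := h.pos
  have ht0 : 0 < t := by positivity
  have hnorm : ∀ J, ‖a J‖ ^ 2 * dyadLen J = ‖pair f (φ J)‖ ^ 2 / dyadLen J := fun J => by
    have := dyadLen_pos J
    rw [ha]
    simp only [norm_div, Complex.norm_real, Real.norm_of_nonneg this.le]
    field_simp
  have hFc : Continuous F := continuous_finsetSum _ fun J _ =>
    continuous_const.mul (h.bump J).continuous
  have hint : ∀ p q, Integrable fun y => a p * φ p y * (starRingEnd ℂ) (a q * φ q y) := fun p q => by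
    have := ((h.bump q).integrable_mul_conj hA.le (dyadLen_pos q)
      (h.bump p).continuous.aestronglyMeasurable
      ((h.bump p).integrable_norm_sq hA.le (dyadLen_pos p))).const_mul (a p * (starRingEnd ℂ) (a q))
    refine this.congr (Filter.Eventually.of_forall fun y => ?_)
    simp only [map_mul]; ring
  have hFF : ∀ y, ((‖F y‖ ^ 2 : ℝ) : ℂ) =
      ∑ p ∈ 𝓙, ∑ q ∈ 𝓙, a p * φ p y * (starRingEnd ℂ) (a q * φ q y) := fun y => by
    rw [Complex.ofReal_pow, ← Complex.mul_conj', hF, map_sum, Finset.sum_mul_sum]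
  have hF2 : Integrable fun y => ‖F y‖ ^ 2 := by
    have : Integrable fun y => ((‖F y‖ ^ 2 : ℝ) : ℂ) := by
      simp_rw [hFF]
      exact integrable_finsetSum _ fun p _ => integrable_finsetSum _ fun q _ => hint p q
    have h2 := this.re
    simpa only [RCLike.re_eq_complex_re, Complex.ofReal_re] using h2
  have hFle : ∫ y, ‖F y‖ ^ 2 ≤ t * X := by
    have h1 : ((∫ y, ‖F y‖ ^ 2 : ℝ) : ℂ) =
        ∑ p ∈ 𝓙, ∑ q ∈ 𝓙, a p * (starRingEnd ℂ) (a q) * pair (φ p) (φ q) := by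
      rw [← integral_complex_ofReal]
      simp only [hFF]
      rw [integral_finsetSum _ fun p _ => integrable_finsetSum _ fun q _ => hint p q]
      refine Finset.sum_congr rfl fun p _ => ?_
      rw [integral_finsetSum _ fun q _ => hint p q]
      refine Finset.sum_congr rfl fun q _ => ?_
      rw [pair, ← integral_const_mul]
      congr 1 with y
      simp only [map_mul]; ring
    have h2 : ∫ y, ‖F y‖ ^ 2 = ‖((∫ y, ‖F y‖ ^ 2 : ℝ) : ℂ)‖ := by
      rw [Complex.norm_real, Real.norm_of_nonneg (integral_nonneg fun y => by positivity)]
    rw [h2, h1]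
    calc _ ≤ ∑ p ∈ 𝓙, ∑ q ∈ 𝓙, ‖a p * (starRingEnd ℂ) (a q) * pair (φ p) (φ q)‖ :=
          (norm_sum_le _ _).trans (Finset.sum_le_sum fun p _ => norm_sum_le _ _)
      _ ≤ ∑ p ∈ 𝓙, ∑ q ∈ 𝓙, 16 * A ^ 2 * (‖a p‖ * ‖a q‖ * bumpKernel p q) := by
          refine Finset.sum_le_sum fun p _ => Finset.sum_le_sum fun q _ => ?_
          rw [norm_mul, norm_mul, RCLike.norm_conj]
          calc _ ≤ ‖a p‖ * ‖a q‖ * (16 * A ^ 2 * bumpKernel p q) := by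
                gcongr; exact h.norm_pair_le p q
            _ = _ := by ring
      _ = 16 * A ^ 2 * ∑ p ∈ 𝓙, ∑ q ∈ 𝓙, ‖a p‖ * ‖a q‖ * bumpKernel p q := by
          simp_rw [Finset.mul_sum]
      _ ≤ 16 * A ^ 2 * (288 * ∑ p ∈ 𝓙, ‖a p‖ ^ 2 * dyadLen p) := by
          gcongr
          exact sum_sum_mul_bumpKernel_le 𝓙 fun p => ‖a p‖
      _ = t * X := by
          simp_rw [hnorm]
          rw [ht, hX]; ring
  have hXle : X ≤ ∫ y, (t / 2 * ‖f y‖ ^ 2 + (2 * t)⁻¹ * ‖F y‖ ^ 2) := by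
    have h1 : pair f F = (X : ℂ) := by
      have hi : ∀ J, Integrable fun y => (starRingEnd ℂ) (a J) * (f y * (starRingEnd ℂ) (φ J y)) :=
        fun J => ((h.bump J).integrable_mul_conj hA.le (dyadLen_pos J) hf hf2).const_mul _
      have h2 : ∀ y, f y * (starRingEnd ℂ) (F y) =
          ∑ J ∈ 𝓙, (starRingEnd ℂ) (a J) * (f y * (starRingEnd ℂ) (φ J y)) := fun y => by
        rw [hF, map_sum, Finset.mul_sum]
        refine Finset.sum_congr rfl fun J _ => ?_
        rw [map_mul]; ring
      unfold pair
      simp_rw [h2]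
      rw [integral_finsetSum _ fun J _ => hi J, hX]
      push_cast
      refine Finset.sum_congr rfl fun J _ => ?_
      rw [integral_const_mul, ← pair, ha]
      simp only [map_div₀, Complex.conj_ofReal]
      rw [← Complex.mul_conj']
      ring
    have h3 : X ≤ ‖pair f F‖ := by
      rw [h1, Complex.norm_real]; exact le_abs_self X
    refine h3.trans (norm_integral_le_of_norm_le
      ((hf2.const_mul _).add (hF2.const_mul _)) (Filter.Eventually.of_forall fun y => ?_))
    rw [norm_mul, RCLike.norm_conj]
    have : t / 2 * ‖f y‖ ^ 2 + (2 * t)⁻¹ * ‖F y‖ ^ 2 - ‖f y‖ * ‖F y‖ =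
        (2 * t)⁻¹ * (t * ‖f y‖ - ‖F y‖) ^ 2 := by
      field_simp; ring
    have : 0 ≤ (2 * t)⁻¹ * (t * ‖f y‖ - ‖F y‖) ^ 2 := by positivity
    linarith
  rw [integral_add (hf2.const_mul _) (hF2.const_mul _), integral_const_mul,
    integral_const_mul] at hXle
  have : (2 * t)⁻¹ * ∫ y, ‖F y‖ ^ 2 ≤ (2 * t)⁻¹ * (t * X) := by gcongr
  have h4 : (2 * t)⁻¹ * (t * X) = X / 2 := by field_simp
  linarith

/-- The coefficient of `f` against a bump on `J`, normalized by the length of `J`. -/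
def bumpCoeff (φ : ℤ × ℤ → ℝ → ℂ) (f : ℝ → ℂ) (J : ℤ × ℤ) : ℝ≥0∞ :=
  ENNReal.ofReal (‖pair f (φ J)‖ / dyadLen J)

/-- The square of the dyadic square function in the `L^∞` normalization of the bumps. -/
def sqFn (𝓙 : Finset (ℤ × ℤ)) (φ : ℤ × ℤ → ℝ → ℂ) (f : ℝ → ℂ) (y : ℝ) : ℝ≥0∞ :=
  ∑ J ∈ 𝓙, bumpCoeff φ f J ^ 2 * (dyadIco J).indicator 1 y

theorem measurable_sqFn (𝓙 : Finset (ℤ × ℤ)) (φ : ℤ × ℤ → ℝ → ℂ) (f : ℝ → ℂ) :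
    Measurable (sqFn 𝓙 φ f) :=
  Finset.measurable_fun_sum _ fun J _ =>
    (measurable_one.indicator (measurableSet_dyadIco J)).const_mul _

theorem lintegral_sqFn_mul (𝓙 : Finset (ℤ × ℤ)) (φ : ℤ × ℤ → ℝ → ℂ) (f : ℝ → ℂ)
    {w : ℝ → ℝ≥0∞} (hw : Measurable w) : ∫⁻ y, sqFn 𝓙 φ f y * w y =
      ∑ J ∈ 𝓙, bumpCoeff φ f J ^ 2 * ∫⁻ y in dyadIco J, w y := by
  simp_rw [sqFn, Finset.sum_mul]
  rw [lintegral_finsetSum 𝓙 (f := fun J y => bumpCoeff φ f J ^ 2 *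
    (dyadIco J).indicator 1 y * w y) fun J _ =>
    ((measurable_one.indicator (measurableSet_dyadIco J)).const_mul _).mul hw]
  refine Finset.sum_congr rfl fun J _ => ?_
  rw [← lintegral_indicator (measurableSet_dyadIco J), ← lintegral_const_mul _
    (hw.indicator (measurableSet_dyadIco J))]
  congr 1 with y
  by_cases hy : y ∈ dyadIco J <;> simp [hy]

theorem IsBumpFamily.sum_sq_coeff_le {A : ℝ} {φ : ℤ × ℤ → ℝ → ℂ} (h : IsBumpFamily A φ)
    (𝓙 : Finset (ℤ × ℤ)) {f : ℝ → ℂ} (hf : Measurable f) :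
    ∑ J ∈ 𝓙, bumpCoeff φ f J ^ 2 * ENNReal.ofReal (dyadLen J) ≤
      ENNReal.ofReal (4608 * A ^ 2) * ∫⁻ y, ‖f y‖ₑ ^ 2 := by
  have hA := h.pos
  by_cases htop : ∫⁻ y, ‖f y‖ₑ ^ 2 = ⊤
  · rw [htop, ENNReal.mul_top (by simp; positivity)]
    exact le_top
  have heq : ∀ y, ‖f y‖ₑ ^ 2 = ENNReal.ofReal (‖f y‖ ^ 2) := fun y => by
    rw [ENNReal.ofReal_pow (norm_nonneg _), ofReal_norm]
  have hf2 : Integrable fun y => ‖f y‖ ^ 2 := by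
    refine ⟨(hf.norm.pow_const 2).aestronglyMeasurable, ?_⟩
    rw [hasFiniteIntegral_iff_ofReal (Filter.Eventually.of_forall fun y => by positivity)]
    simp_rw [← heq]
    exact lt_top_iff_ne_top.2 htop
  simp_rw [heq]
  rw [← ofReal_integral_eq_lintegral_ofReal hf2
    (Filter.Eventually.of_forall fun y => by positivity), ← ENNReal.ofReal_mul (by positivity)]
  have hterm : ∀ J, bumpCoeff φ f J ^ 2 * ENNReal.ofReal (dyadLen J) =
      ENNReal.ofReal (‖pair f (φ J)‖ ^ 2 / dyadLen J) := fun J => by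
    have := dyadLen_pos J
    rw [bumpCoeff, ← ENNReal.ofReal_pow (by positivity), ← ENNReal.ofReal_mul (by positivity)]
    congr 1
    field_simp
  simp_rw [hterm]
  rw [← ENNReal.ofReal_sum_of_nonneg fun J _ => by have := dyadLen_pos J; positivity]
  exact ENNReal.ofReal_le_ofReal (h.sum_sq_pair_le 𝓙 hf.aestronglyMeasurable hf2)

theorem IsBumpFamily.lintegral_sqFn_le {A : ℝ} {φ : ℤ × ℤ → ℝ → ℂ} (h : IsBumpFamily A φ)
    (𝓙 : Finset (ℤ × ℤ)) {f : ℝ → ℂ} (hf : Measurable f) :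
    ∫⁻ y, sqFn 𝓙 φ f y ≤ ENNReal.ofReal (4608 * A ^ 2) * ∫⁻ y, ‖f y‖ₑ ^ 2 := by
  have := lintegral_sqFn_mul 𝓙 φ f (w := fun _ => 1) measurable_const
  simp only [mul_one, setLIntegral_const, one_mul, volume_dyadIco] at this
  rw [this]
  exact h.sum_sq_coeff_le 𝓙 hf

theorem sq_lintegral_mul_le {μ : Measure ℝ} {u v : ℝ → ℝ≥0∞} (hu : Measurable u) (hv : Measurable v) :
    (∫⁻ y, u y * v y ∂μ) ^ 2 ≤ (∫⁻ y, u y ^ 2 * v y ∂μ) * ∫⁻ y, v y ∂μ := by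
  have h := ENNReal.lintegral_mul_norm_pow_le (μ := μ) (f := fun y => u y ^ 2 * v y) (g := v)
    ((hu.pow_const 2).mul hv).aemeasurable hv.aemeasurable (p := 1 / 2) (q := 1 / 2)
    (by norm_num) (by norm_num) (by norm_num)
  have h1 : ∀ a b : ℝ≥0∞, (a ^ 2 * b) ^ (1 / 2 : ℝ) * b ^ (1 / 2 : ℝ) = a * b := fun a b => by
    rw [← ENNReal.mul_rpow_of_nonneg _ _ (by norm_num), mul_assoc, ← sq, ← mul_pow,
      ← ENNReal.rpow_natCast, ← ENNReal.rpow_mul]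
    norm_num
  simp_rw [h1] at h
  calc _ ≤ ((∫⁻ y, u y ^ 2 * v y ∂μ) ^ (1 / 2 : ℝ) * (∫⁻ y, v y ∂μ) ^ (1 / 2 : ℝ)) ^ 2 := by
        gcongr
    _ = _ := by
        rw [← ENNReal.mul_rpow_of_nonneg _ _ (by norm_num), ← ENNReal.rpow_natCast,
          ← ENNReal.rpow_mul]
        norm_num

theorem tailWt_le_of_subset {p q : ℤ × ℤ} {y : ℝ} (hsub : dyadIco q ⊆ dyadIco p)
    (hy : 2 * dyadLen p ≤ |y - dyadCenter p|) :
    tailWt (dyadCenter q) (dyadLen q) y ≤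
      2 * (dyadLen q / dyadLen p) * tailWt (dyadCenter p) (dyadLen p) y := by
  have hp := dyadLen_pos p
  have hq := dyadLen_pos q
  have h1 := abs_sub_dyadCenter_le (hsub (dyadCenter_mem_dyadIco q))
  have h2 : |y - dyadCenter p| ≤ |y - dyadCenter q| + |dyadCenter q - dyadCenter p| :=
    abs_sub_le _ _ _
  unfold tailWt
  rw [inv_le_iff_one_le_mul₀ (by positivity), mul_assoc, ← div_eq_inv_mul, mul_div_assoc',
    one_le_div (by positivity)]
  field_simp
  linarith

theorem sq_len_div_le_bumpKernel {p q : ℤ × ℤ} (hle : dyadLen q ≤ dyadLen p)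
    (hsub : dyadIco q ⊆ dyadIco p) :
    dyadLen q ^ 2 / dyadLen p ≤ 9 / 4 * bumpKernel p q := by
  have hp := dyadLen_pos p
  have h1 := abs_sub_dyadCenter_le (hsub (dyadCenter_mem_dyadIco q))
  have h2 : 2 / 3 ≤ tailWt (dyadCenter p) (dyadLen p) (dyadCenter q) := by
    rw [tailWt, ← one_div, div_le_div_iff₀ (by norm_num) (by positivity)]
    have : |dyadCenter q - dyadCenter p| / dyadLen p ≤ 1 / 2 := by
      rw [div_le_iff₀ hp]; linarith
    linarith
  have h3 : 1 ≤ 9 / 4 * tailWt (dyadCenter p) (dyadLen p) (dyadCenter q) ^ 2 := by nlinarith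
  rw [bumpKernel_of_le hle, mul_left_comm]
  exact le_mul_of_one_le_right (by positivity) h3

theorem dyadLen_le_of_subset {p q : ℤ × ℤ} (h : dyadIco q ⊆ dyadIco p) : dyadLen q ≤ dyadLen p := by
  have := measure_mono (μ := volume) h
  rwa [volume_dyadIco, volume_dyadIco, ENNReal.ofReal_le_ofReal_iff (dyadLen_pos p).le] at this

theorem bumpCoeff_eq (φ : ℤ × ℤ → ℝ → ℂ) (f : ℝ → ℂ) (J : ℤ × ℤ) :
    bumpCoeff φ f J = ‖pair f (φ J)‖ₑ * (ENNReal.ofReal (dyadLen J))⁻¹ := by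
  rw [bumpCoeff, ENNReal.ofReal_div_of_pos (dyadLen_pos J), div_eq_mul_inv, ofReal_norm]

theorem bumpCoeff_ne_top (φ : ℤ × ℤ → ℝ → ℂ) (f : ℝ → ℂ) (J : ℤ × ℤ) : bumpCoeff φ f J ≠ ⊤ :=
  ENNReal.ofReal_ne_top

theorem enorm_pair_le (f g : ℝ → ℂ) : ‖pair f g‖ₑ ≤ ∫⁻ y, ‖f y‖ₑ * ‖g y‖ₑ := by
  refine (enorm_integral_le_lintegral_enorm _).trans (le_of_eq ?_)
  simp

/-- If the product with the second function is not integrable, the pairing is zero by convention. -/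
theorem enorm_pair_le_add_indicator (f g : ℝ → ℂ) {s : Set ℝ} (hs : MeasurableSet s) :
    ‖pair f g‖ₑ ≤ ‖pair (s.indicator f) g‖ₑ + ‖pair (sᶜ.indicator f) g‖ₑ := by
  by_cases hi : Integrable fun y => f y * (starRingEnd ℂ) (g y)
  · have : pair f g = pair (s.indicator f) g + pair (sᶜ.indicator f) g := by
      have h1 : ∀ t : Set ℝ, (fun y => t.indicator f y * (starRingEnd ℂ) (g y)) =
          t.indicator fun y => f y * (starRingEnd ℂ) (g y) := fun t => by
        ext y; by_cases hy : y ∈ t <;> simp [hy]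
      unfold pair
      rw [h1, h1, integral_indicator hs, integral_indicator hs.compl, integral_add_compl hs hi]
    rw [this]
    exact enorm_add_le _ _
  · rw [pair, integral_undef hi]
    simp

theorem add_sq_le_two_mul (a b : ℝ≥0∞) : (a + b) ^ 2 ≤ 2 * a ^ 2 + 2 * b ^ 2 := by
  have := ENNReal.rpow_add_le_mul_rpow_add_rpow a b (p := 2) (by norm_num)
  norm_num at this
  rwa [mul_add] at this

theorem IsBumpFamily.sum_sq_coeff_subset_le {A : ℝ} {φ : ℤ × ℤ → ℝ → ℂ} (h : IsBumpFamily A φ)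
    (𝓙 : Finset (ℤ × ℤ)) {f : ℝ → ℂ} (hf : Measurable f) {p : ℤ × ℤ}
    (h𝓙 : ∀ J ∈ 𝓙, dyadIco J ⊆ dyadIco p) {x : ℝ} (hx : x ∈ dyadIco p) :
    ∑ J ∈ 𝓙, bumpCoeff φ f J ^ 2 * ENNReal.ofReal (dyadLen J) ≤
      ENNReal.ofReal (10000000 * A ^ 2) * ENNReal.ofReal (dyadLen p) *
        maxFn (fun y => ‖f y‖ₑ ^ 2) x := by
  have hA := h.pos
  have hp := dyadLen_pos p
  set B := Metric.ball (dyadCenter p) (2 * dyadLen p) with hB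
  have hBm : MeasurableSet B := measurableSet_ball
  set M := maxFn (fun y => ‖f y‖ₑ ^ 2) x with hM
  have hxc := abs_sub_dyadCenter_le hx
  have hlocal : ∑ J ∈ 𝓙, bumpCoeff φ (B.indicator f) J ^ 2 * ENNReal.ofReal (dyadLen J) ≤
      ENNReal.ofReal (4608 * A ^ 2) * (ENNReal.ofReal (4 * dyadLen p) * M) := by
    refine (h.sum_sq_coeff_le 𝓙 (hf.indicator hBm)).trans ?_
    gcongr
    have : ∀ y, ‖B.indicator f y‖ₑ ^ 2 = B.indicator (fun y => ‖f y‖ₑ ^ 2) y := fun y => by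
      by_cases hy : y ∈ B <;> simp [hy]
    simp_rw [this]
    rw [lintegral_indicator hBm]
    have := lintegral_ball_le_maxFn (fun y => ‖f y‖ₑ ^ 2) (x := x) (c := dyadCenter p)
      (r := 2 * dyadLen p) (by rw [Metric.mem_ball, Real.dist_eq]; linarith)
    rwa [← mul_assoc, show (2 : ℝ) * 2 = 4 by norm_num] at this
  set T := ∫⁻ y, ‖f y‖ₑ * ENNReal.ofReal (tailWt (dyadCenter p) (dyadLen p) y ^ 2) with hT
  have hT2 : T ^ 2 ≤ (16 * ENNReal.ofReal (dyadLen p) * M) * (16 * ENNReal.ofReal (dyadLen p)) := by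
    refine (sq_lintegral_mul_le hf.enorm
      ((continuous_tailWt hp).pow 2).measurable.ennreal_ofReal).trans ?_
    exact mul_le_mul' (lintegral_mul_tailWt_sq_le_maxFn (hf.enorm.pow_const 2).aemeasurable hp
      (by linarith)) (lintegral_tailWt_sq_le hp)
  have htail : ∀ J ∈ 𝓙, bumpCoeff φ (Bᶜ.indicator f) J ^ 2 * ENNReal.ofReal (dyadLen J) ≤
      ENNReal.ofReal (36 * A ^ 2 / dyadLen p ^ 2 * bumpKernel p J) * T ^ 2 := by
    intro J hJ
    have hJp := dyadLen_pos J
    have hle := dyadLen_le_of_subset (h𝓙 J hJ)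
    have h1 : ‖pair (Bᶜ.indicator f) (φ J)‖ₑ ≤
        ENNReal.ofReal (4 * A * (dyadLen J / dyadLen p) ^ 2) * T := by
      refine (enorm_pair_le _ _).trans ?_
      rw [hT, ← lintegral_const_mul' _ _ ENNReal.ofReal_ne_top]
      refine lintegral_mono fun y => ?_
      by_cases hy : y ∈ B
      · simp [hy]
      · rw [indicator_of_mem (by exact hy), mul_left_comm]
        refine mul_le_mul' le_rfl ?_
        rw [← ENNReal.ofReal_mul (by positivity), ← ofReal_norm]
        refine ENNReal.ofReal_le_ofReal (((h.bump J).norm_le_sq hA.le hJp y).trans ?_)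
        have hy' : 2 * dyadLen p ≤ |y - dyadCenter p| := by
          rw [hB, Metric.mem_ball, Real.dist_eq, not_lt] at hy
          exact hy
        have := tailWt_pos (c := dyadCenter J) (y := y) hJp
        calc _ ≤ A * (2 * (dyadLen J / dyadLen p) * tailWt (dyadCenter p) (dyadLen p) y) ^ 2 := by
              gcongr; exact tailWt_le_of_subset (h𝓙 J hJ) hy'
          _ = _ := by ring
    have h2 : bumpCoeff φ (Bᶜ.indicator f) J ≤
        ENNReal.ofReal (4 * A * dyadLen J / dyadLen p ^ 2) * T := by
      rw [bumpCoeff_eq]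
      refine (mul_le_mul' h1 le_rfl).trans (le_of_eq ?_)
      rw [mul_right_comm, ← ENNReal.ofReal_inv_of_pos hJp, ← ENNReal.ofReal_mul (by positivity)]
      congr 2
      field_simp
    calc _ ≤ (ENNReal.ofReal (4 * A * dyadLen J / dyadLen p ^ 2) * T) ^ 2 *
          ENNReal.ofReal (dyadLen J) := by gcongr
      _ = ENNReal.ofReal (16 * A ^ 2 / dyadLen p ^ 2 *
          (dyadLen J ^ 2 / dyadLen p) * (dyadLen J / dyadLen p)) * T ^ 2 := by
          rw [mul_pow, mul_right_comm, ← ENNReal.ofReal_pow (by positivity),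
            ← ENNReal.ofReal_mul (by positivity)]
          congr 2
          field_simp
          norm_num
      _ ≤ _ := by
          refine mul_le_mul' (ENNReal.ofReal_le_ofReal ?_) le_rfl
          have h3 := sq_len_div_le_bumpKernel hle (h𝓙 J hJ)
          have h4 : dyadLen J / dyadLen p ≤ 1 := (div_le_one hp).2 hle
          calc _ ≤ 16 * A ^ 2 / dyadLen p ^ 2 * (9 / 4 * bumpKernel p J) * 1 := by
                have := bumpKernel_nonneg p J
                exact mul_le_mul (mul_le_mul_of_nonneg_left h3 (by positivity)) h4 (by positivity)
                  (by positivity)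
            _ = _ := by ring
  calc ∑ J ∈ 𝓙, bumpCoeff φ f J ^ 2 * ENNReal.ofReal (dyadLen J)
      ≤ ∑ J ∈ 𝓙, (2 * (bumpCoeff φ (B.indicator f) J ^ 2 * ENNReal.ofReal (dyadLen J)) +
          2 * (bumpCoeff φ (Bᶜ.indicator f) J ^ 2 * ENNReal.ofReal (dyadLen J))) := by
        refine Finset.sum_le_sum fun J _ => ?_
        rw [← mul_assoc, ← mul_assoc, ← add_mul]
        gcongr
        refine le_trans ?_ (add_sq_le_two_mul _ _)
        gcongr
        rw [bumpCoeff_eq, bumpCoeff_eq, bumpCoeff_eq, ← add_mul]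
        gcongr
        exact enorm_pair_le_add_indicator f (φ J) hBm
    _ ≤ 2 * (ENNReal.ofReal (4608 * A ^ 2) * (ENNReal.ofReal (4 * dyadLen p) * M)) +
        2 * (ENNReal.ofReal (36 * A ^ 2 / dyadLen p ^ 2 * (288 * dyadLen p)) *
          ((16 * ENNReal.ofReal (dyadLen p) * M) * (16 * ENNReal.ofReal (dyadLen p)))) := by
        rw [Finset.sum_add_distrib, ← Finset.mul_sum, ← Finset.mul_sum]
        gcongr
        refine (Finset.sum_le_sum htail).trans ?_
        rw [← Finset.sum_mul, ← ENNReal.ofReal_sum_of_nonneg fun J _ =>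
          mul_nonneg (by positivity) (bumpKernel_nonneg p J), ← Finset.mul_sum]
        refine mul_le_mul' (ENNReal.ofReal_le_ofReal ?_) hT2
        gcongr
        exact sum_bumpKernel_le p 𝓙
    _ = ENNReal.ofReal ((2 * 4608 * 4 + 2 * 36 * 288 * 16 * 16) * A ^ 2 * dyadLen p) * M := by
        have e2 : (2 : ℝ≥0∞) = ENNReal.ofReal 2 := by simp
        have e16 : (16 : ℝ≥0∞) = ENNReal.ofReal 16 := by simp
        rw [e2, e16, show ∀ a b c d m e : ℝ≥0∞, a * (b * (c * m)) + a * (d * ((e * m) * e)) =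
          (a * b * c + a * d * e * e) * m by intros; ring]
        congr 1
        simp (discharger := positivity) only [← ENNReal.ofReal_mul, ← ENNReal.ofReal_add]
        congr 1
        field_simp
    _ ≤ _ := by
        rw [← ENNReal.ofReal_mul (by positivity)]
        gcongr
        norm_num

theorem sum_le_setLIntegral_biUnion {𝓙 : Finset (ℤ × ℤ)} {b : ℤ × ℤ → ℝ≥0∞} {G : ℝ → ℝ≥0∞}
    (hb : ∀ 𝓚 ⊆ 𝓙, ∀ p ∈ 𝓙, (∀ J ∈ 𝓚, dyadIco J ⊆ dyadIco p) →
      ∑ J ∈ 𝓚, b J ≤ ∫⁻ y in dyadIco p, G y) :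
    ∑ J ∈ 𝓙, b J ≤ ∫⁻ y in ⋃ J ∈ 𝓙, dyadIco J, G y := by
  classical
  induction 𝓙 using Finset.strongInduction with
  | H 𝓙 ih =>
    rcases 𝓙.eq_empty_or_nonempty with rfl | hne
    · simp
    obtain ⟨p, hp, hmax⟩ := 𝓙.exists_max_image Prod.fst hne
    rw [← Finset.sum_filter_add_sum_filter_not 𝓙 (fun J => dyadIco J ⊆ dyadIco p)]
    have h1 := hb (𝓙.filter fun J => dyadIco J ⊆ dyadIco p) (Finset.filter_subset _ _) p hp
      fun J hJ => (Finset.mem_filter.1 hJ).2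
    have hss : 𝓙.filter (fun J => ¬ dyadIco J ⊆ dyadIco p) ⊂ 𝓙 :=
      Finset.filter_ssubset.2 ⟨p, hp, by simp⟩
    have h2 := ih _ hss fun 𝓚 h𝓚 q hq => hb 𝓚 (h𝓚.trans hss.subset) q (hss.subset hq)
    refine (add_le_add h1 h2).trans ?_
    rw [← lintegral_union]
    · refine lintegral_mono_set (union_subset (subset_biUnion_of_mem (u := dyadIco) hp) ?_)
      exact biUnion_mono (fun J hJ => hss.subset hJ) fun _ _ => le_rfl
    · exact Finset.measurableSet_biUnion _ fun J _ => measurableSet_dyadIco J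
    · refine disjoint_iUnion₂_right.2 fun J hJ => ?_
      rw [Finset.mem_filter] at hJ
      exact ((dyadIco_disjoint_or_subset (hmax J hJ.1)).resolve_left hJ.2).symm

theorem setLIntegral_dyadIco_le (w : ℝ → ℝ≥0∞) {J : ℤ × ℤ} {y : ℝ} (hy : y ∈ dyadIco J) :
    ∫⁻ x in dyadIco J, w x ≤ ENNReal.ofReal (dyadLen J) * (2 * maxFn w y) := by
  have hsub : dyadIco J ⊆ Metric.ball (dyadCenter J) (dyadLen J) := fun x hx => by
    have := abs_sub_dyadCenter_le hx
    have := dyadLen_pos J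
    rw [Metric.mem_ball, Real.dist_eq]; linarith
  refine (lintegral_mono_set hsub).trans ((lintegral_ball_le_maxFn w (hsub hy)).trans (le_of_eq ?_))
  rw [mul_comm 2, ENNReal.ofReal_mul (dyadLen_pos J).le, mul_assoc]
  simp

/-- A Carleson embedding theorem for finite dyadic families. -/
theorem sum_mul_setLIntegral_le {𝓙 : Finset (ℤ × ℤ)} {b : ℤ × ℤ → ℝ≥0∞} {G w : ℝ → ℝ≥0∞}
    (hG : Measurable G)
    (hb : ∀ 𝓚 ⊆ 𝓙, ∀ p ∈ 𝓙, (∀ J ∈ 𝓚, dyadIco J ⊆ dyadIco p) →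
      ∑ J ∈ 𝓚, b J * ENNReal.ofReal (dyadLen J) ≤ ∫⁻ y in dyadIco p, G y) :
    ∑ J ∈ 𝓙, b J * ∫⁻ y in dyadIco J, w y ≤ ∫⁻ y, G y * (2 * maxFn w y) := by
  set W : ℤ × ℤ → ℝ≥0∞ := fun J => (ENNReal.ofReal (dyadLen J))⁻¹ * ∫⁻ y in dyadIco J, w y with hW
  have hW' : ∀ J, b J * ∫⁻ y in dyadIco J, w y = b J * ENNReal.ofReal (dyadLen J) * W J := by
    intro J
    have h0 : ENNReal.ofReal (dyadLen J) ≠ 0 := by simp [dyadLen_pos J]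
    rw [hW, mul_assoc, ← mul_assoc (ENNReal.ofReal _),
      ENNReal.mul_inv_cancel h0 ENNReal.ofReal_ne_top, one_mul]
  have hWle : ∀ J, ∀ y ∈ dyadIco J, W J ≤ 2 * maxFn w y := fun J y hy => by
    have h0 : ENNReal.ofReal (dyadLen J) ≠ 0 := by simp [dyadLen_pos J]
    rw [hW, ENNReal.inv_mul_le_iff h0 ENNReal.ofReal_ne_top]
    exact setLIntegral_dyadIco_le w hy
  have hm : Measurable fun y => 2 * maxFn w y := (measurable_maxFn w).const_mul 2
  have hL := lintegral_mul_rpow_layer (μ := volume) one_pos hm hG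
  simp only [ENNReal.rpow_one, ENNReal.ofReal_one, one_mul, sub_self, Real.rpow_zero] at hL
  rw [hL]
  have hlayer : ∀ a : ℝ≥0∞, a = ∫⁻ t in Ioi (0 : ℝ), {t : ℝ | ENNReal.ofReal t < a}.indicator 1 t :=
    fun a => by
      have := rpow_eq_lintegral_layer one_pos a
      simpa only [ENNReal.rpow_one, ENNReal.ofReal_one, one_mul, sub_self, Real.rpow_zero] using this
  have hmeas : ∀ a : ℝ≥0∞, Measurable ({t : ℝ | ENNReal.ofReal t < a}.indicator (1 : ℝ → ℝ≥0∞)) :=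
    fun a => measurable_one.indicator (measurableSet_lt ENNReal.measurable_ofReal measurable_const)
  calc _ = ∑ J ∈ 𝓙, ∫⁻ t in Ioi (0 : ℝ), b J * ENNReal.ofReal (dyadLen J) *
        {t : ℝ | ENNReal.ofReal t < W J}.indicator 1 t := by
        refine Finset.sum_congr rfl fun J _ => ?_
        rw [hW', lintegral_const_mul _ (hmeas _), ← hlayer]
    _ = ∫⁻ t in Ioi (0 : ℝ), ∑ J ∈ 𝓙, b J * ENNReal.ofReal (dyadLen J) *
        {t : ℝ | ENNReal.ofReal t < W J}.indicator 1 t :=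
        (lintegral_finsetSum _ fun J _ => (hmeas _).const_mul _).symm
    _ ≤ _ := by
        refine lintegral_mono fun t => ?_
        classical
        have h1 : ∑ J ∈ 𝓙, b J * ENNReal.ofReal (dyadLen J) *
            {t : ℝ | ENNReal.ofReal t < W J}.indicator 1 t =
            ∑ J ∈ 𝓙 with ENNReal.ofReal t < W J, b J * ENNReal.ofReal (dyadLen J) := by
          rw [Finset.sum_filter]
          refine Finset.sum_congr rfl fun J _ => ?_
          by_cases h : ENNReal.ofReal t < W J <;> simp [indicator, h]
        rw [h1, lintegral_indicator (measurableSet_lt measurable_const hm)]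
        refine (sum_le_setLIntegral_biUnion fun 𝓚 h𝓚 p hp => hb 𝓚
          (h𝓚.trans (Finset.filter_subset _ _)) p (Finset.filter_subset _ _ hp)).trans ?_
        refine lintegral_mono_set (iUnion₂_subset fun J hJ y hy => ?_)
        exact (Finset.mem_filter.1 hJ).2.trans_le (hWle J y hy)

theorem lintegral_sqFn_rpow_ne_top (𝓙 : Finset (ℤ × ℤ)) (φ : ℤ × ℤ → ℝ → ℂ) (f : ℝ → ℂ) {r : ℝ}
    (hr : 0 < r) : ∫⁻ y, sqFn 𝓙 φ f y ^ r ≠ ⊤ := by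
  set U : Set ℝ := ⋃ J ∈ 𝓙, dyadIco J with hU
  set M := ∑ J ∈ 𝓙, bumpCoeff φ f J ^ 2 with hM
  have hMtop : M ≠ ⊤ := by
    refine ENNReal.sum_ne_top.2 fun J _ => ENNReal.pow_ne_top (bumpCoeff_ne_top φ f J)
  have hUm : MeasurableSet U := Finset.measurableSet_biUnion _ fun J _ => measurableSet_dyadIco J
  have hUtop : volume U ≠ ⊤ := by
    refine ne_top_of_le_ne_top ?_ (measure_biUnion_finset_le 𝓙 dyadIco)
    simp_rw [volume_dyadIco]
    exact ENNReal.sum_ne_top.2 fun J _ => ENNReal.ofReal_ne_top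
  have hle : ∀ y, sqFn 𝓙 φ f y ^ r ≤ U.indicator (fun _ => M ^ r) y := by
    intro y
    by_cases hy : y ∈ U
    · rw [indicator_of_mem hy]
      gcongr
      refine Finset.sum_le_sum fun J _ => ?_
      refine mul_le_of_le_one_right zero_le (indicator_le_self' (fun _ _ => zero_le) y)
    · have : sqFn 𝓙 φ f y = 0 := by
        refine Finset.sum_eq_zero fun J hJ => ?_
        rw [indicator_of_notMem (fun h => hy (mem_biUnion hJ h)), mul_zero]
      rw [this, ENNReal.zero_rpow_of_pos hr]
      exact zero_le
  refine ne_top_of_le_ne_top ?_ (lintegral_mono hle)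
  rw [lintegral_indicator_const hUm]
  exact ENNReal.mul_ne_top (ENNReal.rpow_ne_top_of_nonneg hr.le hMtop) hUtop

theorem sqFn_strong_type_of_two_lt {A p : ℝ} (hp : 2 < p) : ∃ C : ℝ≥0∞, C ≠ ⊤ ∧
    ∀ (𝓙 : Finset (ℤ × ℤ)) (φ : ℤ × ℤ → ℝ → ℂ) (f : ℝ → ℂ), IsBumpFamily A φ → Measurable f →
      ∫⁻ y, sqFn 𝓙 φ f y ^ (p / 2) ≤ C * ∫⁻ y, ‖f y‖ₑ ^ p := by
  set r := p / 2 with hr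
  have hr1 : 1 < r := by rw [hr]; linarith
  have hrr := Real.HolderConjugate.conjExponent hr1
  set s := r.conjExponent with hs
  obtain ⟨C₁, hC₁, hM₁⟩ := maxFn_strong_type hr1
  obtain ⟨C₂, hC₂, hM₂⟩ := maxFn_strong_type hrr.symm.lt
  set K := ENNReal.ofReal (10000000 * A ^ 2) with hK
  have hr0 := hrr.pos
  have hs0 := hrr.symm.pos
  refine ⟨(2 * K) ^ r * C₁ * C₂ ^ (r / s), ?_, fun 𝓙 φ f h hf => ?_⟩
  · finiteness
  set S := sqFn 𝓙 φ f with hS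
  have hSm : Measurable S := measurable_sqFn 𝓙 φ f
  set F : ℝ → ℝ≥0∞ := maxFn fun y => ‖f y‖ₑ ^ 2 with hF
  have hFm : Measurable F := measurable_maxFn _
  set w : ℝ → ℝ≥0∞ := fun y => S y ^ (r - 1) with hw
  have hwm : Measurable w := hSm.pow_const _
  set X := ∫⁻ y, S y ^ r with hX
  have hXtop : X ≠ ⊤ := lintegral_sqFn_rpow_ne_top 𝓙 φ f hr0
  set Y := ∫⁻ y, ‖f y‖ₑ ^ p with hY
  have h1 : X ≤ ∫⁻ y, (K * F y) * (2 * maxFn w y) := by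
    have : X = ∫⁻ y, S y * w y := by
      rw [hX]; congr 1 with y
      nth_rw 2 [← ENNReal.rpow_one (S y)]
      rw [← ENNReal.rpow_add_of_nonneg _ _ (by norm_num) (by linarith)]
      congr 1; ring
    rw [this, lintegral_sqFn_mul 𝓙 φ f hwm]
    refine sum_mul_setLIntegral_le (hFm.const_mul K) fun 𝓚 _ q _ h𝓚 => ?_
    calc _ = (∑ J ∈ 𝓚, bumpCoeff φ f J ^ 2 * ENNReal.ofReal (dyadLen J)) *
          ((ENNReal.ofReal (dyadLen q))⁻¹ * volume (dyadIco q)) := by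
          rw [volume_dyadIco, ENNReal.inv_mul_cancel (by simp [dyadLen_pos q])
            ENNReal.ofReal_ne_top, mul_one]
      _ = ∫⁻ _ in dyadIco q, (∑ J ∈ 𝓚, bumpCoeff φ f J ^ 2 * ENNReal.ofReal (dyadLen J)) *
          (ENNReal.ofReal (dyadLen q))⁻¹ := by
          rw [setLIntegral_const]; ring
      _ ≤ _ := by
          refine setLIntegral_mono' (measurableSet_dyadIco q) fun x hx => ?_
          rw [← div_eq_mul_inv]
          refine ENNReal.div_le_of_le_mul ?_
          refine (h.sum_sq_coeff_subset_le 𝓚 hf h𝓚 hx).trans (le_of_eq ?_)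
          ring
  have h2 : X ≤ 2 * K * ((C₁ * Y) ^ (1 / r) * (C₂ * X) ^ (1 / s)) := by
    refine h1.trans ?_
    have e : ∀ y, (K * F y) * (2 * maxFn w y) = 2 * K * (F * maxFn w) y := fun y => by
      simp only [Pi.mul_apply]; ring
    simp_rw [e]
    rw [lintegral_const_mul _ (hFm.mul (measurable_maxFn w))]
    gcongr
    refine (ENNReal.lintegral_mul_le_Lp_mul_Lq volume hrr hFm.aemeasurable
      (measurable_maxFn w).aemeasurable).trans ?_
    gcongr
    · refine (hM₁ _ (hf.enorm.pow_const 2)).trans (le_of_eq ?_)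
      congr 2 with y
      rw [← ENNReal.rpow_natCast, ← ENNReal.rpow_mul]
      congr 1; rw [hr]; push_cast; ring
    · refine (hM₂ _ hwm).trans (le_of_eq ?_)
      congr 2 with y
      rw [hw, ← ENNReal.rpow_mul, hrr.sub_one_mul_conj]
  rcases eq_or_ne X 0 with h0 | h0
  · rw [h0]; exact zero_le
  have h3 : X ^ r ≤ (2 * K) ^ r * C₁ * C₂ ^ (r / s) * Y * X ^ (r / s) := by
    calc X ^ r ≤ (2 * K * ((C₁ * Y) ^ (1 / r) * (C₂ * X) ^ (1 / s))) ^ r := by gcongr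
      _ = _ := by
          rw [ENNReal.mul_rpow_of_nonneg (2 * K) _ hr0.le,
            ENNReal.mul_rpow_of_nonneg ((C₁ * Y) ^ (1 / r)) _ hr0.le, ← ENNReal.rpow_mul,
            ← ENNReal.rpow_mul, one_div_mul_cancel hr0.ne', ENNReal.rpow_one,
            one_div_mul_eq_div, ENNReal.mul_rpow_of_nonneg C₂ X (by positivity)]
          ring
  have h4 : r = 1 + r / s := by
    have := hrr.inv_add_inv_eq_one
    field_simp at this ⊢
    linarith
  have h5 : X ^ r = X * X ^ (r / s) := by
    nth_rw 1 [h4]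
    rw [ENNReal.rpow_add _ _ h0 hXtop, ENNReal.rpow_one]
  rw [h5] at h3
  have hne : X ^ (r / s) ≠ 0 := by simp [ENNReal.rpow_eq_zero_iff, h0, hXtop]
  have hnt : X ^ (r / s) ≠ ⊤ := ENNReal.rpow_ne_top_of_nonneg (by positivity) hXtop
  exact (ENNReal.mul_le_mul_iff_left hne hnt).1 h3

/-- The dyadic interval of scale `k` containing `y`. -/
def dyadAt (k : ℤ) (y : ℝ) : ℤ × ℤ := (k, ⌊y / (2 : ℝ) ^ k⌋)

theorem mem_dyadIco_dyadAt (k : ℤ) (y : ℝ) : y ∈ dyadIco (dyadAt k y) :=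
  mem_dyadIco_iff_floor.2 rfl

theorem eq_dyadAt {q : ℤ × ℤ} {y : ℝ} (hy : y ∈ dyadIco q) : q = dyadAt q.1 y :=
  Prod.ext rfl (mem_dyadIco_iff_floor.1 hy).symm

theorem le_add_mul_rpow {p t : ℝ} (hp : 1 < p) (ht : 0 < t) (a : ℝ≥0∞) :
    a ≤ ENNReal.ofReal t + ENNReal.ofReal (t ^ (1 - p)) * a ^ p := by
  rcases le_total a (ENNReal.ofReal t) with h | h
  · exact h.trans le_self_add
  refine le_trans ?_ le_add_self
  rcases eq_or_ne a ⊤ with rfl | ha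
  · rw [ENNReal.top_rpow_of_pos (by linarith), ENNReal.mul_top (by simp; positivity)]
  · lift a to NNReal using ha
    have h' : t ≤ a := by
      rw [← ENNReal.ofReal_coe_nnreal] at h
      exact (ENNReal.ofReal_le_ofReal_iff a.coe_nonneg).1 h
    have ha0 : (0 : ℝ) < a := ht.trans_le h'
    rw [← ENNReal.ofReal_coe_nnreal, ENNReal.ofReal_rpow_of_pos ha0,
      ← ENNReal.ofReal_mul (by positivity)]
    refine ENNReal.ofReal_le_ofReal ?_
    calc (a : ℝ) = a ^ (1 - p) * (a : ℝ) ^ p := by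
          rw [← Real.rpow_add ha0]; simp
      _ ≤ t ^ (1 - p) * (a : ℝ) ^ p := by
          gcongr ?_ * _
          exact Real.rpow_le_rpow_of_nonpos ht h' (by linarith)

theorem setLIntegral_ne_top_of_rpow {p : ℝ} (hp : 1 < p) {u : ℝ → ℝ≥0∞}
    (hfin : ∫⁻ y, u y ^ p ≠ ⊤) {s : Set ℝ} (hs : volume s ≠ ⊤) : ∫⁻ y in s, u y ≠ ⊤ := by
  have h : ∫⁻ y in s, u y ≤ ∫⁻ y in s, (1 + u y ^ p) := by
    refine lintegral_mono fun y => ?_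
    simpa using le_add_mul_rpow hp one_pos (u y)
  refine ne_top_of_le_ne_top ?_ h
  rw [lintegral_add_left measurable_const, setLIntegral_const, one_mul]
  exact ENNReal.add_ne_top.2 ⟨hs, ne_top_of_le_ne_top hfin (setLIntegral_le_lintegral _ _)⟩

theorem exists_dyadLen_le_of_avg_lt {p t : ℝ} (hp : 1 < p) (ht : 0 < t) {u : ℝ → ℝ≥0∞}
    (hfin : ∫⁻ y, u y ^ p ≠ ⊤) :
    ∃ R : ℝ, ∀ q : ℤ × ℤ, ENNReal.ofReal t * ENNReal.ofReal (dyadLen q) < ∫⁻ y in dyadIco q, u y →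
      dyadLen q ≤ R := by
  set c := ENNReal.ofReal ((t / 2) ^ (1 - p)) * ∫⁻ y, u y ^ p with hc
  have hctop : c ≠ ⊤ := ENNReal.mul_ne_top ENNReal.ofReal_ne_top hfin
  refine ⟨2 / t * c.toReal, fun q hq => ?_⟩
  have hq0 := dyadLen_pos q
  have h1 : ∫⁻ y in dyadIco q, u y ≤ ENNReal.ofReal (t / 2) * ENNReal.ofReal (dyadLen q) + c := by
    calc _ ≤ ∫⁻ y in dyadIco q, (ENNReal.ofReal (t / 2) +
          ENNReal.ofReal ((t / 2) ^ (1 - p)) * u y ^ p) :=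
          lintegral_mono fun y => le_add_mul_rpow hp (by positivity) (u y)
      _ ≤ _ := by
          rw [lintegral_add_left measurable_const, setLIntegral_const, volume_dyadIco,
            lintegral_const_mul' _ _ ENNReal.ofReal_ne_top, hc]
          gcongr
          exact Measure.restrict_le_self
  have h2 := hq.le.trans h1
  rw [← ENNReal.ofReal_mul ht.le, ← ENNReal.ofReal_mul (by positivity), ← ENNReal.ofReal_toReal hctop,
    ← ENNReal.ofReal_add (by positivity) (by positivity),
    ENNReal.ofReal_le_ofReal_iff (by positivity)] at h2
  rw [div_mul_eq_mul_div, le_div_iff₀ ht]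
  linarith

theorem exists_maximal_dyadIco {P : ℤ × ℤ → Prop} {R : ℝ} (hR : ∀ q, P q → dyadLen q ≤ R)
    {q : ℤ × ℤ} (hq : P q) : ∃ q', P q' ∧ dyadIco q ⊆ dyadIco q' ∧
      ∀ r, P r → dyadIco q' ⊆ dyadIco r → r = q' := by
  set y := dyadCenter q with hy
  obtain ⟨n, hn⟩ := pow_unbounded_of_one_lt R (by norm_num : (1 : ℝ) < 2)
  have hbdd : ∀ k : ℤ, P (dyadAt k y) → k ≤ n := fun k hk => by
    have h1 : (2 : ℝ) ^ k ≤ 2 ^ (n : ℤ) := by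
      rw [zpow_natCast]; exact (hR _ hk).trans hn.le
    exact (zpow_le_zpow_iff_right₀ (by norm_num)).1 h1
  have hqy : q = dyadAt q.1 y := eq_dyadAt (dyadCenter_mem_dyadIco q)
  obtain ⟨k, hk, hmax⟩ := Int.exists_greatest_of_bdd ⟨n, hbdd⟩ ⟨q.1, hqy ▸ hq⟩
  refine ⟨dyadAt k y, hk, dyadIco_subset (hmax _ (hqy ▸ hq)) (dyadCenter_mem_dyadIco q)
    (mem_dyadIco_dyadAt k y), fun r hr hsub => ?_⟩
  have hry : r = dyadAt r.1 y := eq_dyadAt (hsub (mem_dyadIco_dyadAt k y))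
  have h1 : r.1 ≤ k := hmax _ (hry ▸ hr)
  have h2 : k ≤ r.1 := dyadLen_le_iff.1 (dyadLen_le_of_subset hsub)
  rw [hry, le_antisymm h1 h2]

theorem ae_enorm_le_of_avg_le {f : ℝ → ℂ} (hf : LocallyIntegrable f) {t : ℝ} (ht : 0 ≤ t) :
    ∀ᵐ y : ℝ, (∀ k : ℤ, ∫⁻ x in dyadIco (dyadAt k y), ‖f x‖ₑ ≤
      ENNReal.ofReal t * ENNReal.ofReal (dyadLen (dyadAt k y))) → ‖f y‖ₑ ≤ ENNReal.ofReal t := by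
  have hfn : LocallyIntegrable fun x => ‖f x‖ := fun x => (hf x).norm
  filter_upwards [IsUnifLocDoublingMeasure.ae_tendsto_average volume hfn 1] with y hy hk
  have hδ : Filter.Tendsto (fun n : ℕ => dyadLen (dyadAt (-n) y) / 2) Filter.atTop
      (nhdsWithin 0 (Ioi 0)) := by
    refine tendsto_nhdsWithin_iff.2 ⟨?_, Filter.Eventually.of_forall fun n => ?_⟩
    · have h : Filter.Tendsto (fun n : ℕ => (1 / 2 : ℝ) ^ n / 2) Filter.atTop (nhds (0 / 2)) :=
        (tendsto_pow_atTop_nhds_zero_of_lt_one (by norm_num) (by norm_num)).div_const 2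
      rw [zero_div] at h
      refine h.congr fun n => ?_
      simp [dyadLen, dyadAt]
    · exact half_pos (dyadLen_pos _)
  have hlim := hy (fun n : ℕ => dyadCenter (dyadAt (-n) y)) _ hδ
    (Filter.Eventually.of_forall fun n => by
      rw [Metric.mem_closedBall, Real.dist_eq, one_mul]
      exact abs_sub_dyadCenter_le (mem_dyadIco_dyadAt _ y))
  rw [← ofReal_norm]
  refine ENNReal.ofReal_le_ofReal (le_of_tendsto hlim (Filter.Eventually.of_forall fun n => ?_))
  set q := dyadAt (-n) y with hq
  have hq0 := dyadLen_pos q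
  have hball : Metric.closedBall (dyadCenter q) (dyadLen q / 2) =
      Icc ((2 : ℝ) ^ q.1 * q.2) ((2 : ℝ) ^ q.1 * (q.2 + 1)) := by
    rw [Real.closedBall_eq_Icc, dyadCenter, dyadLen]
    congr 1 <;> ring
  have hvol : volume.real (Metric.closedBall (dyadCenter q) (dyadLen q / 2)) = dyadLen q := by
    rw [measureReal_def, Real.volume_closedBall, ENNReal.toReal_ofReal (by positivity)]
    ring
  rw [setAverage_eq, hvol, smul_eq_mul, inv_mul_le_iff₀ hq0, hball, integral_Icc_eq_integral_Ico]
  have h1 := hk (-n)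
  rw [← hq, ← ENNReal.ofReal_mul ht, mul_comm] at h1
  rw [integral_norm_eq_lintegral_enorm hf.aestronglyMeasurable.restrict]
  exact ENNReal.toReal_le_of_le_ofReal (by positivity) h1

/-- A Calderón–Zygmund decomposition of `f` at height `t`. -/
structure IsCZDecomp (f : ℝ → ℂ) (t : ℝ) (𝒬 : Set (ℤ × ℤ)) (g : ℝ → ℂ) : Prop where
  measurable : Measurable g
  disjoint : ∀ q ∈ 𝒬, ∀ r ∈ 𝒬, q ≠ r → Disjoint (dyadIco q) (dyadIco r)
  lt_lintegral : ∀ q ∈ 𝒬, ENNReal.ofReal t * ENNReal.ofReal (dyadLen q) < ∫⁻ y in dyadIco q, ‖f y‖ₑ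
  lintegral_le : ∀ q ∈ 𝒬,
    ∫⁻ y in dyadIco q, ‖f y‖ₑ ≤ 2 * ENNReal.ofReal t * ENNReal.ofReal (dyadLen q)
  eq_of_mem : ∀ q ∈ 𝒬, ∀ y ∈ dyadIco q, g y = (dyadLen q : ℂ)⁻¹ * ∫ x in dyadIco q, f x
  eq_of_notMem : ∀ y ∉ ⋃ q ∈ 𝒬, dyadIco q, g y = f y
  ae_le : ∀ᵐ y : ℝ, y ∉ ⋃ q ∈ 𝒬, dyadIco q → ‖f y‖ₑ ≤ ENNReal.ofReal t

theorem exists_isCZDecomp {f : ℝ → ℂ} (hf : Measurable f) {p : ℝ} (hp : 1 < p)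
    (hfin : ∫⁻ y, ‖f y‖ₑ ^ p ≠ ⊤) {t : ℝ} (ht : 0 < t) : ∃ 𝒬 g, IsCZDecomp f t 𝒬 g := by
  set P : ℤ × ℤ → Prop := fun q =>
    ENNReal.ofReal t * ENNReal.ofReal (dyadLen q) < ∫⁻ y in dyadIco q, ‖f y‖ₑ with hP
  set 𝒬 : Set (ℤ × ℤ) := {q | P q ∧ ∀ r, P r → dyadIco q ⊆ dyadIco r → r = q} with h𝒬
  obtain ⟨R, hR⟩ := exists_dyadLen_le_of_avg_lt hp ht hfin
  have hdisj : ∀ q ∈ 𝒬, ∀ r ∈ 𝒬, q ≠ r → Disjoint (dyadIco q) (dyadIco r) := by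
    intro q hq r hr hne
    rcases le_total q.1 r.1 with h | h
    · exact (dyadIco_disjoint_or_subset h).resolve_left fun hs => hne (hq.2 r hr.1 hs).symm
    · exact ((dyadIco_disjoint_or_subset h).resolve_left fun hs => hne (hr.2 q hq.1 hs)).symm
  set Ω : Set ℝ := ⋃ q ∈ 𝒬, dyadIco q with hΩ
  have hΩm : MeasurableSet Ω := MeasurableSet.biUnion 𝒬.to_countable fun q _ => measurableSet_dyadIco q
  obtain ⟨g, hg, hgeq⟩ := exists_measurable_piecewise
    (fun o : Option 𝒬 => o.elim Ωᶜ fun q => dyadIco q)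
    (fun o => by
      cases o with
      | none => exact hΩm.compl
      | some q => exact measurableSet_dyadIco _)
    (fun o => o.elim f fun q => Function.const ℝ ((dyadLen q : ℂ)⁻¹ * ∫ x in dyadIco q, f x))
    (fun o => by
      cases o with
      | none => exact hf
      | some q => exact measurable_const)
    (fun o o' hne y hy => by
      exfalso
      cases o with
      | none =>
        cases o' with
        | none => exact hne rfl
        | some q => exact hy.1 (mem_biUnion q.2 hy.2)
      | some q =>
        cases o' with
        | none => exact hy.2 (mem_biUnion q.2 hy.1)
        | some r =>
          exact disjoint_left.1 (hdisj q q.2 r r.2 fun h => hne (by rw [Subtype.ext h])) hy.1 hy.2)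
  have hloc : LocallyIntegrable f := by
    rw [locallyIntegrable_iff]
    intro K hK
    refine ⟨hf.aestronglyMeasurable, lt_top_iff_ne_top.2 ?_⟩
    exact setLIntegral_ne_top_of_rpow hp hfin hK.measure_lt_top.ne
  refine ⟨𝒬, g, hg, hdisj, fun q hq => hq.1, fun q hq => ?_, fun q hq y hy => ?_, fun y hy => ?_, ?_⟩
  · set r := dyadAt (q.1 + 1) (dyadCenter q) with hr
    have hsub : dyadIco q ⊆ dyadIco r := dyadIco_subset (by simp [hr, dyadAt])
      (dyadCenter_mem_dyadIco q) (mem_dyadIco_dyadAt _ _)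
    have hnP : ¬ P r := fun h => by
      have := congrArg Prod.fst (hq.2 r h hsub)
      simp [hr, dyadAt] at this
    have hlen : dyadLen r = 2 * dyadLen q := by
      simp only [hr, dyadAt, dyadLen]
      rw [zpow_add_one₀ (by norm_num), mul_comm]
    refine (lintegral_mono_set hsub).trans ((not_lt.1 hnP).trans (le_of_eq ?_))
    rw [hlen, ENNReal.ofReal_mul (by norm_num), ENNReal.ofReal_ofNat]
    ring
  · exact hgeq (some ⟨q, hq⟩) hy
  · exact hgeq none hy
  · filter_upwards [ae_enorm_le_of_avg_le hloc ht.le] with y hy hyΩ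
    refine hy fun k => not_lt.1 fun hk => hyΩ ?_
    obtain ⟨q', hq', hsub, hmax⟩ := exists_maximal_dyadIco (P := P) hR hk
    exact mem_biUnion (show q' ∈ 𝒬 from ⟨hq', hmax⟩) (hsub (mem_dyadIco_dyadAt k y))

theorem IsTailBump.norm_sub_dyadCenter_le {A : ℝ} {q J : ℤ × ℤ} {φ : ℝ → ℂ}
    (h : IsTailBump A (dyadCenter J) (dyadLen J) φ) (hA : 0 ≤ A)
    (hfar : ¬ dyadIco J ⊆ Metric.ball (dyadCenter q) (2 * dyadLen q)) {u : ℝ} (hu : u ∈ dyadIco q) :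
    ‖φ u - φ (dyadCenter q)‖ ≤ 18 * A * (bumpKernel q J / dyadLen q) := by
  have hq := dyadLen_pos q
  have hJ := dyadLen_pos J
  have hk := bumpKernel_nonneg q J
  have huq := abs_sub_dyadCenter_le hu
  rcases le_or_gt (dyadLen q) (dyadLen J) with hle | hlt
  · have h1 := h.norm_sub_mul_le hA hq hle u (dyadCenter q)
    have h2 : (2 / 3 : ℝ) ≤ tailWt (dyadCenter q) (dyadLen q) u := by
      unfold tailWt
      rw [le_inv_comm₀ (by norm_num) (by positivity)]
      have : |u - dyadCenter q| / dyadLen q ≤ 1 / 2 := by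
        rw [div_le_iff₀ hq]; linarith
      linarith
    have h3 : (1 / 4 : ℝ) ≤ tailWt (dyadCenter q) (dyadLen q) u ^ 3 :=
      le_trans (by norm_num) (pow_le_pow_left₀ (by norm_num) h2 3)
    have h4 : A * dyadLen q / dyadLen J * tailWt (dyadCenter J) (dyadLen J) (dyadCenter q) ^ 2 =
        A * (bumpKernel q J / dyadLen q) := by
      rw [bumpKernel_comm, bumpKernel_of_le hle]
      field_simp
    rw [h4] at h1
    have h5 := mul_le_mul_of_nonneg_left h3 (norm_nonneg (φ u - φ (dyadCenter q)))
    have h6 : 0 ≤ A * (bumpKernel q J / dyadLen q) := by positivity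
    linarith
  · set d := |dyadCenter J - dyadCenter q| with hd
    have hd1 : 3 / 2 * dyadLen q ≤ d := by
      by_contra! hcon
      refine hfar fun y hy => ?_
      rw [Metric.mem_ball, Real.dist_eq]
      have := abs_sub_dyadCenter_le hy
      have := abs_sub_le y (dyadCenter J) (dyadCenter q)
      linarith
    have hpt : ∀ v ∈ dyadIco q, ‖φ v‖ ≤ 9 * A * (bumpKernel q J / dyadLen q) := fun v hv => by
      have hv1 := abs_sub_dyadCenter_le hv
      have hv2 : 2 / 3 * d ≤ |v - dyadCenter J| := by
        have := abs_sub_le (dyadCenter J) v (dyadCenter q)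
        rw [abs_sub_comm (dyadCenter J) v] at this
        linarith
      have hd0 : 0 < d := by linarith
      have hW : tailWt (dyadCenter J) (dyadLen J) v ≤
          3 * dyadLen J / dyadLen q * tailWt (dyadCenter q) (dyadLen q) (dyadCenter J) := by
        have e1 : tailWt (dyadCenter J) (dyadLen J) v =
            dyadLen J / (dyadLen J + |v - dyadCenter J|) := by
          unfold tailWt; field_simp
        have e2 : 3 * dyadLen J / dyadLen q * tailWt (dyadCenter q) (dyadLen q) (dyadCenter J) =
            3 * dyadLen J / (dyadLen q + d) := by
          unfold tailWt; rw [← hd]; field_simp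
        rw [e1, e2, div_le_div_iff₀ (by positivity) (by positivity)]
        nlinarith
      refine (h.norm_le_sq hA hJ v).trans ?_
      refine (mul_le_mul_of_nonneg_left (pow_le_pow_left₀ (tailWt_pos hJ).le hW 2) hA).trans
        (le_of_eq ?_)
      rw [bumpKernel_of_le hlt.le]
      field_simp
      ring
    have h1 := hpt u hu
    have h2 := hpt _ (dyadCenter_mem_dyadIco q)
    have h3 := norm_sub_le (φ u) (φ (dyadCenter q))
    linarith

namespace IsCZDecomp

variable {f g : ℝ → ℂ} {t : ℝ} {𝒬 : Set (ℤ × ℤ)}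

theorem integrableOn (h : IsCZDecomp f t 𝒬 g) (hf : Measurable f) {q : ℤ × ℤ} (hq : q ∈ 𝒬) :
    IntegrableOn f (dyadIco q) :=
  ⟨hf.aestronglyMeasurable, (h.lintegral_le q hq).trans_lt (by finiteness)⟩

theorem integrableOn_good (h : IsCZDecomp f t 𝒬 g) {q : ℤ × ℤ} (hq : q ∈ 𝒬) :
    IntegrableOn g (dyadIco q) := by
  refine (integrableOn_congr_fun (h.eq_of_mem q hq) (measurableSet_dyadIco q)).2 ?_
  exact integrableOn_const (by rw [volume_dyadIco]; finiteness)

theorem setIntegral_good (h : IsCZDecomp f t 𝒬 g) {q : ℤ × ℤ} (hq : q ∈ 𝒬) :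
    ∫ x in dyadIco q, g x = ∫ x in dyadIco q, f x := by
  have hq0 := dyadLen_pos q
  rw [setIntegral_congr_fun (measurableSet_dyadIco q) (h.eq_of_mem q hq), setIntegral_const,
    measureReal_def, volume_dyadIco, ENNReal.toReal_ofReal hq0.le, Complex.real_smul, ← mul_assoc,
    mul_inv_cancel₀ (by exact_mod_cast hq0.ne'), one_mul]


theorem enorm_good_le (h : IsCZDecomp f t 𝒬 g) {q : ℤ × ℤ} (hq : q ∈ 𝒬) {y : ℝ}
    (hy : y ∈ dyadIco q) :
    ‖g y‖ₑ ≤ (ENNReal.ofReal (dyadLen q))⁻¹ * ∫⁻ x in dyadIco q, ‖f x‖ₑ := by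
  have hq0 := dyadLen_pos q
  rw [h.eq_of_mem q hq y hy, enorm_mul]
  refine mul_le_mul' (le_of_eq ?_) (enorm_integral_le_lintegral_enorm _)
  rw [← ofReal_norm, norm_inv, Complex.norm_real, Real.norm_of_nonneg hq0.le,
    ENNReal.ofReal_inv_of_pos hq0]

theorem enorm_good_le_two_mul (h : IsCZDecomp f t 𝒬 g) {y : ℝ} (hy : y ∈ ⋃ q ∈ 𝒬, dyadIco q) :
    ‖g y‖ₑ ≤ 2 * ENNReal.ofReal t := by
  obtain ⟨q, hq, hyq⟩ := mem_iUnion₂.1 hy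
  have hq0 : ENNReal.ofReal (dyadLen q) ≠ 0 := (ENNReal.ofReal_pos.2 (dyadLen_pos q)).ne'
  refine (h.enorm_good_le hq hyq).trans ((mul_le_mul' le_rfl (h.lintegral_le q hq)).trans ?_)
  rw [mul_comm (2 * ENNReal.ofReal t), ← mul_assoc, ENNReal.inv_mul_cancel hq0 ENNReal.ofReal_ne_top,
    one_mul]

theorem setLIntegral_good_le (h : IsCZDecomp f t 𝒬 g) {q : ℤ × ℤ} (hq : q ∈ 𝒬) :
    ∫⁻ y in dyadIco q, ‖g y‖ₑ ≤ ∫⁻ y in dyadIco q, ‖f y‖ₑ := by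
  have hq0 : ENNReal.ofReal (dyadLen q) ≠ 0 := (ENNReal.ofReal_pos.2 (dyadLen_pos q)).ne'
  refine (setLIntegral_mono' (measurableSet_dyadIco q) fun y hy => h.enorm_good_le hq hy).trans ?_
  rw [setLIntegral_const, volume_dyadIco, mul_comm, ← mul_assoc,
    ENNReal.mul_inv_cancel hq0 ENNReal.ofReal_ne_top, one_mul]

theorem enorm_setIntegral_sub_mul_conj_le (h : IsCZDecomp f t 𝒬 g) (hf : Measurable f)
    {q : ℤ × ℤ} (hq : q ∈ 𝒬) {φ : ℝ → ℂ} {K : ℝ}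
    (hK : ∀ u ∈ dyadIco q, ‖φ u - φ (dyadCenter q)‖ ≤ K)
    (hint : IntegrableOn (fun y => (f y - g y) * (starRingEnd ℂ) (φ y)) (dyadIco q)) :
    ‖∫ y in dyadIco q, (f y - g y) * (starRingEnd ℂ) (φ y)‖ₑ ≤
      ENNReal.ofReal K * (2 * ∫⁻ y in dyadIco q, ‖f y‖ₑ) := by
  have hfq := h.integrableOn hf hq
  have hgq := h.integrableOn_good hq
  have h0 : ∫ y in dyadIco q, (f y - g y) = 0 := by
    rw [integral_sub hfq hgq, h.setIntegral_good hq, sub_self]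
  have h1 : ∫ y in dyadIco q, (f y - g y) * (starRingEnd ℂ) (φ y) =
      ∫ y in dyadIco q, (f y - g y) * (starRingEnd ℂ) (φ y - φ (dyadCenter q)) := by
    have hc : IntegrableOn (fun y => (f y - g y) * (starRingEnd ℂ) (φ (dyadCenter q))) (dyadIco q) :=
      (hfq.sub hgq).mul_const _
    simp only [map_sub, mul_sub]
    rw [integral_sub hint hc, integral_mul_const, h0, zero_mul, sub_zero]
  rw [h1]
  refine (enorm_integral_le_lintegral_enorm _).trans ?_
  calc ∫⁻ y in dyadIco q, ‖(f y - g y) * (starRingEnd ℂ) (φ y - φ (dyadCenter q))‖ₑ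
      ≤ ∫⁻ y in dyadIco q, ENNReal.ofReal K * (‖f y‖ₑ + ‖g y‖ₑ) := by
        refine setLIntegral_mono' (measurableSet_dyadIco q) fun y hy => ?_
        rw [enorm_mul, mul_comm]
        refine mul_le_mul' ?_ (enorm_sub_le)
        rw [← ofReal_norm, RCLike.norm_conj]
        exact ENNReal.ofReal_le_ofReal (hK y hy)
    _ = ENNReal.ofReal K * ((∫⁻ y in dyadIco q, ‖f y‖ₑ) + ∫⁻ y in dyadIco q, ‖g y‖ₑ) := by
        rw [lintegral_const_mul' _ _ ENNReal.ofReal_ne_top, lintegral_add_left hf.enorm]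
    _ ≤ _ := by
        rw [two_mul]
        exact mul_le_mul' le_rfl (add_le_add le_rfl (h.setLIntegral_good_le hq))

theorem pairwise_disjoint (h : IsCZDecomp f t 𝒬 g) :
    Pairwise (Function.onFun Disjoint fun q : 𝒬 => dyadIco q) :=
  fun q r hne => h.disjoint q q.2 r r.2 fun e => hne (Subtype.ext e)

theorem volume_iUnion (h : IsCZDecomp f t 𝒬 g) :
    volume (⋃ q ∈ 𝒬, dyadIco q) = ∑' q : 𝒬, ENNReal.ofReal (dyadLen q) := by
  rw [biUnion_eq_iUnion, measure_iUnion h.pairwise_disjoint fun q => measurableSet_dyadIco _]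
  simp only [volume_dyadIco]

theorem enorm_pair_sub_le (h : IsCZDecomp f t 𝒬 g) (hf : Measurable f) {A : ℝ} (hA : 0 ≤ A)
    {J : ℤ × ℤ} {φ : ℝ → ℂ} (hφ : IsTailBump A (dyadCenter J) (dyadLen J) φ)
    (hfar : ∀ q ∈ 𝒬, ¬ dyadIco J ⊆ Metric.ball (dyadCenter q) (2 * dyadLen q)) :
    ‖pair (fun y => f y - g y) φ‖ₑ ≤ ∑' q : 𝒬, ENNReal.ofReal (bumpKernel q J) *
      (ENNReal.ofReal (36 * A / dyadLen q) * ∫⁻ y in dyadIco q, ‖f y‖ₑ) := by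
  unfold pair
  by_cases hint : Integrable fun y => (f y - g y) * (starRingEnd ℂ) (φ y)
  swap
  · rw [integral_undef hint]; simp
  have hsupp : ∀ y ∉ ⋃ q : 𝒬, dyadIco q, (f y - g y) * (starRingEnd ℂ) (φ y) = 0 := fun y hy => by
    rw [← biUnion_eq_iUnion (s := 𝒬) (t := fun q _ => dyadIco q)] at hy
    rw [h.eq_of_notMem y hy, sub_self, zero_mul]
  rw [← setIntegral_eq_integral_of_forall_compl_eq_zero hsupp,
    integral_iUnion (fun q => measurableSet_dyadIco _) h.pairwise_disjoint hint.integrableOn]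
  refine enorm_tsum_le_tsum_enorm.trans (ENNReal.tsum_le_tsum fun q => ?_)
  refine (h.enorm_setIntegral_sub_mul_conj_le hf q.2 (K := 18 * A * (bumpKernel q J / dyadLen q))
    (fun u hu => hφ.norm_sub_dyadCenter_le hA (hfar q q.2) (u := u) hu) hint.integrableOn).trans (le_of_eq ?_)
  have hk := bumpKernel_nonneg q J
  have hq := dyadLen_pos q
  rw [← mul_assoc, ← mul_assoc, ← ENNReal.ofReal_mul hk, ← ENNReal.ofReal_ofNat, ← ENNReal.ofReal_mul
    (by positivity)]
  congr 2
  ring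

theorem sum_enorm_pair_sub_le (h : IsCZDecomp f t 𝒬 g) (hf : Measurable f) {A : ℝ}
    {φ : ℤ × ℤ → ℝ → ℂ} (hφ : IsBumpFamily A φ) (𝓙 : Finset (ℤ × ℤ))
    (hfar : ∀ J ∈ 𝓙, ∀ q ∈ 𝒬, ¬ dyadIco J ⊆ Metric.ball (dyadCenter q) (2 * dyadLen q)) :
    ∑ J ∈ 𝓙, ‖pair (fun y => f y - g y) (φ J)‖ₑ ≤
      ENNReal.ofReal (20736 * A) * ENNReal.ofReal t * volume (⋃ q ∈ 𝒬, dyadIco q) := by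
  have hA := hφ.pos
  calc ∑ J ∈ 𝓙, ‖pair (fun y => f y - g y) (φ J)‖ₑ
      ≤ ∑ J ∈ 𝓙, ∑' q : 𝒬, ENNReal.ofReal (bumpKernel q J) *
          (ENNReal.ofReal (36 * A / dyadLen q) * ∫⁻ y in dyadIco q, ‖f y‖ₑ) :=
        Finset.sum_le_sum fun J hJ => h.enorm_pair_sub_le hf hA.le (hφ.bump J) (hfar J hJ)
    _ = ∑' q : 𝒬, (∑ J ∈ 𝓙, ENNReal.ofReal (bumpKernel q J)) *
          (ENNReal.ofReal (36 * A / dyadLen q) * ∫⁻ y in dyadIco q, ‖f y‖ₑ) := by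
        rw [← Summable.tsum_finsetSum fun _ _ => ENNReal.summable]
        simp only [Finset.sum_mul]
    _ ≤ ∑' q : 𝒬, ENNReal.ofReal (20736 * A) * ENNReal.ofReal t * ENNReal.ofReal (dyadLen q) := by
        refine ENNReal.tsum_le_tsum fun q => ?_
        have hq := dyadLen_pos q
        rw [← ENNReal.ofReal_sum_of_nonneg fun J _ => bumpKernel_nonneg q J]
        refine (mul_le_mul' (ENNReal.ofReal_le_ofReal (sum_bumpKernel_le q 𝓙))
          (mul_le_mul' le_rfl (h.lintegral_le q q.2))).trans (le_of_eq ?_)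
        rw [← mul_assoc, ← ENNReal.ofReal_mul (by positivity), ← mul_assoc, ← mul_assoc,
          ← ENNReal.ofReal_ofNat 2, ← ENNReal.ofReal_mul (by positivity)]
        congr 3
        field_simp
        ring
    _ = _ := by rw [ENNReal.tsum_mul_left, h.volume_iUnion]

theorem enorm_good_le_add (h : IsCZDecomp f t 𝒬 g) (y : ℝ) :
    ‖g y‖ₑ ≤ ‖f y‖ₑ + 2 * ENNReal.ofReal t := by
  by_cases hy : y ∈ ⋃ q ∈ 𝒬, dyadIco q
  · exact (h.enorm_good_le_two_mul hy).trans le_add_self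
  · rw [h.eq_of_notMem y hy]; exact le_self_add

theorem enorm_pair_le_add (h : IsCZDecomp f t 𝒬 g) (ht : 0 ≤ t) {φ : ℝ → ℂ}
    (hφc : Continuous φ) (hφ : Integrable φ) :
    ‖pair f φ‖ₑ ≤ ‖pair g φ‖ₑ + ‖pair (fun y => f y - g y) φ‖ₑ := by
  by_cases hint : Integrable fun y => f y * (starRingEnd ℂ) (φ y)
  swap
  · unfold pair; rw [integral_undef hint]; simp
  have hg : Integrable fun y => g y * (starRingEnd ℂ) (φ y) := by
    refine (hint.norm.add (hφ.norm.const_mul (2 * t))).mono'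
      (h.measurable.aestronglyMeasurable.mul
        (Complex.continuous_conj.comp hφc).aestronglyMeasurable) (Filter.Eventually.of_forall fun y => ?_)
    have h1 : ‖g y‖ ≤ ‖f y‖ + 2 * t := by
      rw [← ENNReal.ofReal_le_ofReal_iff (by positivity), ENNReal.ofReal_add (by positivity)
        (by positivity), ENNReal.ofReal_mul (by norm_num), ofReal_norm, ofReal_norm,
        ENNReal.ofReal_ofNat]
      exact h.enorm_good_le_add y
    simp only [norm_mul, RCLike.norm_conj, Pi.add_apply]
    rw [← add_mul]
    exact mul_le_mul_of_nonneg_right h1 (norm_nonneg _)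
  have : pair f φ = pair g φ + pair (fun y => f y - g y) φ := by
    unfold pair
    simp only [sub_mul]
    rw [integral_sub hint hg]
    ring
  rw [this]
  exact enorm_add_le _ _

theorem sqFn_le (h : IsCZDecomp f t 𝒬 g) (ht : 0 ≤ t) {A : ℝ}
    {φ : ℤ × ℤ → ℝ → ℂ} (hφ : IsBumpFamily A φ) (𝓙 : Finset (ℤ × ℤ)) (y : ℝ) :
    sqFn 𝓙 φ f y ≤ 2 * (sqFn 𝓙 φ g y + sqFn 𝓙 φ (fun y => f y - g y) y) := by
  unfold sqFn
  rw [← Finset.sum_add_distrib, Finset.mul_sum]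
  refine Finset.sum_le_sum fun J _ => ?_
  rw [← add_mul, ← mul_assoc, mul_add]
  refine mul_le_mul' ((pow_le_pow_left₀ zero_le (?_ : _ ≤ bumpCoeff φ g J +
    bumpCoeff φ (fun y => f y - g y) J) 2).trans (add_sq_le_two_mul _ _)) le_rfl
  simp only [bumpCoeff_eq, ← add_mul]
  exact mul_le_mul' (h.enorm_pair_le_add ht (hφ.bump J).continuous
    ((hφ.bump J).integrable hφ.pos.le (dyadLen_pos J))) le_rfl

theorem volume_iUnion_le (h : IsCZDecomp f t 𝒬 g) :
    volume (⋃ q ∈ 𝒬, dyadIco q) ≤ volume {y | ENNReal.ofReal t < 2 * maxFn (fun x => ‖f x‖ₑ) y} := by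
  refine measure_mono (iUnion₂_subset fun q hq y hy => ?_)
  have hq0 : ENNReal.ofReal (dyadLen q) ≠ 0 := (ENNReal.ofReal_pos.2 (dyadLen_pos q)).ne'
  have h1 := (h.lt_lintegral q hq).trans_le (setLIntegral_dyadIco_le (fun x => ‖f x‖ₑ) hy)
  rw [mul_comm] at h1
  exact (ENNReal.mul_lt_mul_iff_right hq0 ENNReal.ofReal_ne_top).1 h1

theorem volume_iUnion_ball_le (h : IsCZDecomp f t 𝒬 g) :
    volume (⋃ q ∈ 𝒬, Metric.ball (dyadCenter q) (2 * dyadLen q)) ≤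
      4 * volume (⋃ q ∈ 𝒬, dyadIco q) := by
  rw [h.volume_iUnion, ← ENNReal.tsum_mul_left, biUnion_eq_iUnion]
  refine (measure_iUnion_le _).trans (ENNReal.tsum_le_tsum fun q => le_of_eq ?_)
  rw [Real.volume_ball, ← ENNReal.ofReal_ofNat 4, ← ENNReal.ofReal_mul (by norm_num)]
  congr 1; ring

theorem lintegral_good_sq_le (h : IsCZDecomp f t 𝒬 g) :
    ∫⁻ y, ‖g y‖ₑ ^ 2 ≤ (2 * ENNReal.ofReal t) ^ 2 * volume (⋃ q ∈ 𝒬, dyadIco q) +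
      ∫⁻ y, {y | ‖f y‖ₑ ≤ ENNReal.ofReal t}.indicator (fun y => ‖f y‖ₑ ^ 2) y := by
  have hΩm : MeasurableSet (⋃ q ∈ 𝒬, dyadIco q) :=
    MeasurableSet.biUnion 𝒬.to_countable fun q _ => measurableSet_dyadIco q
  rw [← setLIntegral_const, ← lintegral_indicator hΩm,
    ← lintegral_add_left (measurable_const.indicator hΩm)]
  refine lintegral_mono_ae ?_
  filter_upwards [h.ae_le] with y hy
  by_cases hyΩ : y ∈ ⋃ q ∈ 𝒬, dyadIco q
  · rw [indicator_of_mem hyΩ]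
    exact (pow_le_pow_left₀ zero_le (h.enorm_good_le_two_mul hyΩ) 2).trans le_self_add
  · rw [indicator_of_mem (show y ∈ {y | ‖f y‖ₑ ≤ ENNReal.ofReal t} from hy hyΩ),
      h.eq_of_notMem y hyΩ]
    exact le_add_self

theorem volume_sqFn_bad_le (h : IsCZDecomp f t 𝒬 g) (hf : Measurable f) (ht : 0 < t) {A : ℝ}
    {φ : ℤ × ℤ → ℝ → ℂ} (hφ : IsBumpFamily A φ) (𝓙 : Finset (ℤ × ℤ)) :
    volume {y | y ∉ ⋃ q ∈ 𝒬, Metric.ball (dyadCenter q) (2 * dyadLen q) ∧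
      ENNReal.ofReal t ^ 2 < sqFn 𝓙 φ (fun y => f y - g y) y} ≤
        ENNReal.ofReal (20736 * A) * volume (⋃ q ∈ 𝒬, dyadIco q) := by
  classical
  set b : ℝ → ℂ := fun y => f y - g y with hb
  set 𝓖 := 𝓙.filter fun J => ∀ q ∈ 𝒬, ¬ dyadIco J ⊆ Metric.ball (dyadCenter q) (2 * dyadLen q)
    with h𝓖
  set v : ℝ → ℝ≥0∞ := fun y => ∑ J ∈ 𝓖, bumpCoeff φ b J * (dyadIco J).indicator 1 y with hv
  have ht0 : ENNReal.ofReal t ≠ 0 := (ENNReal.ofReal_pos.2 ht).ne'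
  have hvm : Measurable v := Finset.measurable_sum _ fun J _ =>
    measurable_const.mul (measurable_one.indicator (measurableSet_dyadIco J))
  have hint : ∫⁻ y, v y = ∑ J ∈ 𝓖, ‖pair b (φ J)‖ₑ := by
    rw [hv, lintegral_finsetSum 𝓖 (f := fun J y => bumpCoeff φ b J * (dyadIco J).indicator 1 y)
      fun J _ => measurable_const.mul (measurable_one.indicator (measurableSet_dyadIco J))]
    refine Finset.sum_congr rfl fun J _ => ?_
    have hJ0 : ENNReal.ofReal (dyadLen J) ≠ 0 := (ENNReal.ofReal_pos.2 (dyadLen_pos J)).ne'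
    rw [lintegral_const_mul _ (measurable_one.indicator (measurableSet_dyadIco J)),
      lintegral_indicator_one (measurableSet_dyadIco J), volume_dyadIco, bumpCoeff_eq, mul_assoc,
      ENNReal.inv_mul_cancel hJ0 ENNReal.ofReal_ne_top, mul_one]
  have hsub : {y | y ∉ ⋃ q ∈ 𝒬, Metric.ball (dyadCenter q) (2 * dyadLen q) ∧
      ENNReal.ofReal t ^ 2 < sqFn 𝓙 φ b y} ⊆ {y | ENNReal.ofReal t ≤ v y} := by
    rintro y ⟨hy, hlt⟩
    have hle : sqFn 𝓙 φ b y ≤ v y ^ 2 := by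
      calc sqFn 𝓙 φ b y = ∑ J ∈ 𝓖, (bumpCoeff φ b J * (dyadIco J).indicator 1 y) ^ 2 := by
            rw [sqFn, h𝓖, Finset.sum_filter]
            refine Finset.sum_congr rfl fun J _ => ?_
            by_cases hyJ : y ∈ dyadIco J
            · rw [if_pos fun q hq hs => hy (mem_biUnion hq (hs hyJ))]
              simp [hyJ]
            · simp [hyJ]
        _ ≤ v y ^ 2 := by
            simp only [sq, hv, Finset.sum_mul]
            refine Finset.sum_le_sum fun J hJ => mul_le_mul' le_rfl ?_
            exact Finset.single_le_sum
              (f := fun J => bumpCoeff φ b J * (dyadIco J).indicator 1 y) (fun _ _ => zero_le) hJ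
    refine not_lt.1 fun (hgt : v y < ENNReal.ofReal t) => absurd (hlt.trans_le hle) (not_lt.2 ?_)
    exact pow_le_pow_left₀ zero_le hgt.le 2
  refine (measure_mono hsub).trans ((meas_ge_le_lintegral_div hvm.aemeasurable ht0
    ENNReal.ofReal_ne_top).trans (ENNReal.div_le_of_le_mul ?_))
  rw [hint, mul_right_comm]
  exact h.sum_enorm_pair_sub_le hf hφ 𝓖 fun J hJ => (Finset.mem_filter.1 hJ).2

end IsCZDecomp

theorem IsBumpFamily.volume_lt_sqFn_le {A p t : ℝ} {φ : ℤ × ℤ → ℝ → ℂ} (hφ : IsBumpFamily A φ)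
    (𝓙 : Finset (ℤ × ℤ)) {f : ℝ → ℂ} (hf : Measurable f) (hp : 1 < p)
    (hfin : ∫⁻ y, ‖f y‖ₑ ^ p ≠ ⊤) (ht : 0 < t) :
    volume {y | 4 * ENNReal.ofReal t ^ 2 < sqFn 𝓙 φ f y} ≤
      ENNReal.ofReal (4 + 20736 * A + 18432 * A ^ 2) *
        volume {y | ENNReal.ofReal t < 2 * maxFn (fun x => ‖f x‖ₑ) y} +
      ENNReal.ofReal (4608 * A ^ 2) * ((ENNReal.ofReal t ^ 2)⁻¹ *
        ∫⁻ y, {y | ‖f y‖ₑ ≤ ENNReal.ofReal t}.indicator (fun y => ‖f y‖ₑ ^ 2) y) := by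
  have hA := hφ.pos
  obtain ⟨𝒬, g, h⟩ := exists_isCZDecomp hf hp hfin ht
  have ht0 : ENNReal.ofReal t ^ 2 ≠ 0 := pow_ne_zero 2 (ENNReal.ofReal_pos.2 ht).ne'
  have httop : ENNReal.ofReal t ^ 2 ≠ ⊤ := by finiteness
  set S := ∫⁻ y, {y | ‖f y‖ₑ ≤ ENNReal.ofReal t}.indicator (fun y => ‖f y‖ₑ ^ 2) y
  set Ω := ⋃ q ∈ 𝒬, dyadIco q with hΩ
  set B := ⋃ q ∈ 𝒬, Metric.ball (dyadCenter q) (2 * dyadLen q) with hB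
  have hsub : {y | 4 * ENNReal.ofReal t ^ 2 < sqFn 𝓙 φ f y} ⊆
      (B ∪ {y | y ∉ B ∧ ENNReal.ofReal t ^ 2 < sqFn 𝓙 φ (fun y => f y - g y) y}) ∪
        {y | ENNReal.ofReal t ^ 2 ≤ sqFn 𝓙 φ g y} := by
    intro y hy
    by_contra! hcon
    simp only [mem_union, mem_ofPred_eq, not_or, not_and, not_lt, not_le] at hcon
    obtain ⟨⟨h1, h2⟩, h3⟩ := hcon
    refine absurd hy (not_lt.2 ((h.sqFn_le ht.le hφ 𝓙 y).trans ?_))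
    refine (mul_le_mul' le_rfl (add_le_add h3.le (h2 h1))).trans (le_of_eq ?_)
    ring
  have hgood : volume {y | ENNReal.ofReal t ^ 2 ≤ sqFn 𝓙 φ g y} ≤
      ENNReal.ofReal (18432 * A ^ 2) * volume Ω +
        ENNReal.ofReal (4608 * A ^ 2) * ((ENNReal.ofReal t ^ 2)⁻¹ * S) := by
    refine (meas_ge_le_lintegral_div (measurable_sqFn _ _ _).aemeasurable ht0 httop).trans ?_
    rw [ENNReal.div_eq_inv_mul]
    refine (mul_le_mul' le_rfl ((hφ.lintegral_sqFn_le 𝓙 h.measurable).trans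
      (mul_le_mul' le_rfl (h.lintegral_good_sq_le)))).trans (le_of_eq ?_)
    have e : ENNReal.ofReal (18432 * A ^ 2) = 4 * ENNReal.ofReal (4608 * A ^ 2) := by
      rw [← ENNReal.ofReal_ofNat 4, ← ENNReal.ofReal_mul (by norm_num)]
      congr 1; ring
    rw [e, mul_add, mul_add]
    congr 1
    · calc (ENNReal.ofReal t ^ 2)⁻¹ * (ENNReal.ofReal (4608 * A ^ 2) *
            ((2 * ENNReal.ofReal t) ^ 2 * volume Ω))
          = ((ENNReal.ofReal t ^ 2)⁻¹ * ENNReal.ofReal t ^ 2) *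
            (4 * ENNReal.ofReal (4608 * A ^ 2) * volume Ω) := by ring
        _ = _ := by rw [ENNReal.inv_mul_cancel ht0 httop, one_mul]
    · ring
  calc volume {y | 4 * ENNReal.ofReal t ^ 2 < sqFn 𝓙 φ f y}
      ≤ (4 * volume Ω + ENNReal.ofReal (20736 * A) * volume Ω) +
        (ENNReal.ofReal (18432 * A ^ 2) * volume Ω +
          ENNReal.ofReal (4608 * A ^ 2) * ((ENNReal.ofReal t ^ 2)⁻¹ * S)) :=
        (measure_mono hsub).trans ((measure_union_le _ _).trans (add_le_add
          ((measure_union_le _ _).trans (add_le_add h.volume_iUnion_ball_le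
            (h.volume_sqFn_bad_le hf ht hφ 𝓙))) hgood))
    _ = ENNReal.ofReal (4 + 20736 * A + 18432 * A ^ 2) * volume Ω +
          ENNReal.ofReal (4608 * A ^ 2) * ((ENNReal.ofReal t ^ 2)⁻¹ * S) := by
        rw [ENNReal.ofReal_add (by positivity) (by positivity), ENNReal.ofReal_add (by positivity)
          (by positivity), ENNReal.ofReal_ofNat]
        ring
    _ ≤ _ := add_le_add (mul_le_mul' le_rfl h.volume_iUnion_le) le_rfl

theorem setLIntegral_Ioi_rpow {a r : ℝ} (ha : 0 < a) (hr : r < -1) :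
    ∫⁻ t in Ioi a, ENNReal.ofReal (t ^ r) = ENNReal.ofReal (a ^ (r + 1) / (-(r + 1))) := by
  rw [← ofReal_integral_eq_lintegral_ofReal (integrableOn_Ioi_rpow_of_lt hr ha)
    (ae_restrict_of_forall_mem measurableSet_Ioi fun t ht =>
      Real.rpow_nonneg (ha.le.trans (le_of_lt ht)) _), integral_Ioi_rpow_of_lt hr ha]
  congr 1
  rw [neg_div, div_neg]

theorem lintegral_truncated_sq_layer_le {p : ℝ} (hp2 : p < 2) {u : ℝ → ℝ≥0∞}
    (hu : Measurable u) :
    ∫⁻ t in Ioi (0 : ℝ), ENNReal.ofReal (t ^ (p - 1)) * ((ENNReal.ofReal t ^ 2)⁻¹ *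
      ∫⁻ y, {y | u y ≤ ENNReal.ofReal t}.indicator (fun y => u y ^ 2) y) ≤
      (ENNReal.ofReal (2 - p))⁻¹ * ∫⁻ y, u y ^ p := by
  have hm : Measurable fun z : ℝ × ℝ => {y | u y ≤ ENNReal.ofReal z.1}.indicator
      (fun y => u y ^ 2) z.2 := by
    have hS : MeasurableSet {z : ℝ × ℝ | u z.2 ≤ ENNReal.ofReal z.1} :=
      measurableSet_le (hu.comp measurable_snd) (by fun_prop)
    exact ((hu.comp measurable_snd).pow_const 2).indicator hS
  calc _ = ∫⁻ t in Ioi (0 : ℝ), ∫⁻ y, ENNReal.ofReal (t ^ (p - 3)) *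
        {y | u y ≤ ENNReal.ofReal t}.indicator (fun y => u y ^ 2) y := by
        refine setLIntegral_congr_fun measurableSet_Ioi fun t (ht : 0 < t) => ?_
        rw [lintegral_const_mul' _ _ ENNReal.ofReal_ne_top, ← mul_assoc]
        congr 1
        rw [← ENNReal.ofReal_pow ht.le, ← ENNReal.ofReal_inv_of_pos (by positivity),
          ← ENNReal.ofReal_mul (by positivity)]
        congr 1
        rw [show p - 3 = p - 1 - (2 : ℕ) by push_cast; ring, Real.rpow_sub_natCast ht.ne',
          div_eq_mul_inv]
    _ = ∫⁻ y, ∫⁻ t in Ioi (0 : ℝ), ENNReal.ofReal (t ^ (p - 3)) *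
        {y | u y ≤ ENNReal.ofReal t}.indicator (fun y => u y ^ 2) y :=
        lintegral_lintegral_swap (Measurable.aemeasurable
          ((by fun_prop : Measurable fun z : ℝ × ℝ => ENNReal.ofReal (z.1 ^ (p - 3))).mul hm))
    _ ≤ ∫⁻ y, (ENNReal.ofReal (2 - p))⁻¹ * u y ^ p := by
        refine lintegral_mono fun y => ?_
        rcases eq_or_ne (u y) 0 with h0 | h0
        · simp [indicator, h0]
        rcases eq_or_ne (u y) ⊤ with h1 | h1
        · simp [indicator, h1]
        obtain ⟨a, ha0, ha⟩ : ∃ a : ℝ, 0 < a ∧ u y = ENNReal.ofReal a :=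
          ⟨(u y).toReal, ENNReal.toReal_pos h0 h1, (ENNReal.ofReal_toReal h1).symm⟩
        calc ∫⁻ t in Ioi (0 : ℝ), ENNReal.ofReal (t ^ (p - 3)) *
              {y | u y ≤ ENNReal.ofReal t}.indicator (fun y => u y ^ 2) y
            = ∫⁻ t in Ioi (0 : ℝ), (Ici a).indicator (fun t => ENNReal.ofReal (t ^ (p - 3))) t *
                ENNReal.ofReal a ^ 2 := by
              refine setLIntegral_congr_fun measurableSet_Ioi fun t (ht : 0 < t) => ?_
              have hiff : y ∈ {y | u y ≤ ENNReal.ofReal t} ↔ t ∈ Ici a := by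
                rw [mem_ofPred_eq, ha, ENNReal.ofReal_le_ofReal_iff ht.le, mem_Ici]
              by_cases hta : t ∈ Ici a
              · simp only [indicator_of_mem hta, indicator_of_mem (hiff.2 hta), ha]
              · simp only [indicator_of_notMem hta, indicator_of_notMem (mt hiff.1 hta), mul_zero,
                  zero_mul]
          _ = (∫⁻ t in Ioi a, ENNReal.ofReal (t ^ (p - 3))) * ENNReal.ofReal a ^ 2 := by
              rw [lintegral_mul_const' _ _ (by finiteness), setLIntegral_indicator measurableSet_Ici,
                inter_eq_left.2 (Ici_subset_Ioi.2 ha0), setLIntegral_congr Ioi_ae_eq_Ici.symm]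
          _ ≤ (ENNReal.ofReal (2 - p))⁻¹ * u y ^ p := by
              rw [setLIntegral_Ioi_rpow ha0 (by linarith), ha, ENNReal.ofReal_rpow_of_pos ha0,
                ← ENNReal.ofReal_pow ha0.le, ← ENNReal.ofReal_inv_of_pos (by linarith),
                ← ENNReal.ofReal_mul (div_nonneg (by positivity) (by linarith)),
                ← ENNReal.ofReal_mul (by simp; linarith)]
              refine ENNReal.ofReal_le_ofReal (le_of_eq ?_)
              rw [show p - 3 + 1 = p - (2 : ℕ) by push_cast; ring, Real.rpow_sub_natCast ha0.ne']
              have : 2 - p ≠ 0 := by linarith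
              push_cast
              rw [neg_sub]
              field_simp
    _ = _ := lintegral_const_mul' _ _ (by simp; linarith)

theorem sqFn_strong_type_of_lt_two {A p : ℝ} (hp1 : 1 < p) (hp2 : p < 2) : ∃ C : ℝ≥0∞, C ≠ ⊤ ∧
    ∀ (𝓙 : Finset (ℤ × ℤ)) (φ : ℤ × ℤ → ℝ → ℂ) (f : ℝ → ℂ), IsBumpFamily A φ → Measurable f →
      ∫⁻ y, sqFn 𝓙 φ f y ^ (p / 2) ≤ C * ∫⁻ y, ‖f y‖ₑ ^ p := by
  have hp0 : 0 < p := by linarith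
  have h2p : ENNReal.ofReal (2 - p) ≠ 0 := by simp [hp2]
  obtain ⟨C₀, hC₀, hmax⟩ := maxFn_strong_type hp1
  set C₁ := ENNReal.ofReal (4 + 20736 * A + 18432 * A ^ 2) with hC₁
  set C₂ := ENNReal.ofReal (4608 * A ^ 2) with hC₂
  refine ⟨1 + 2 ^ p * (C₁ * (2 ^ p * C₀) +
    ENNReal.ofReal p * (C₂ * (ENNReal.ofReal (2 - p))⁻¹)), by finiteness,
    fun 𝓙 φ f hφ hf => ?_⟩
  rcases eq_or_ne (∫⁻ y, ‖f y‖ₑ ^ p) ⊤ with htop | hfin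
  · rw [htop, ENNReal.mul_top (by simp)]
    exact le_top
  set u : ℝ → ℝ≥0∞ := fun y => ‖f y‖ₑ with hu
  have hum : Measurable u := hf.enorm
  set v : ℝ → ℝ≥0∞ := fun y => 2⁻¹ * sqFn 𝓙 φ f y ^ (1 / 2 : ℝ) with hv
  have hvm : Measurable v := ((measurable_sqFn 𝓙 φ f).pow_const _).const_mul _
  have hsv : ∀ y, sqFn 𝓙 φ f y = (2 * v y) ^ 2 := fun y => by
    rw [hv]
    dsimp only
    rw [← mul_assoc, ENNReal.mul_inv_cancel two_ne_zero ENNReal.ofNat_ne_top, one_mul,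
      ← ENNReal.rpow_natCast, ← ENNReal.rpow_mul]
    norm_num
  have hint : ∫⁻ y, sqFn 𝓙 φ f y ^ (p / 2) = 2 ^ p * ∫⁻ y, v y ^ p := by
    rw [← lintegral_const_mul' _ _ (by finiteness)]
    congr 1 with y
    rw [hsv, ← ENNReal.mul_rpow_of_nonneg _ _ hp0.le, ← ENNReal.rpow_natCast, ← ENNReal.rpow_mul]
    congr 1
    push_cast
    ring
  have hlevel : ∀ t ∈ Ioi (0 : ℝ), ENNReal.ofReal (t ^ (p - 1)) * volume {y | ENNReal.ofReal t < v y}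
      ≤ C₁ * (ENNReal.ofReal (t ^ (p - 1)) * volume {y | ENNReal.ofReal t < 2 * maxFn u y}) +
        C₂ * (ENNReal.ofReal (t ^ (p - 1)) * ((ENNReal.ofReal t ^ 2)⁻¹ *
          ∫⁻ y, {y | u y ≤ ENNReal.ofReal t}.indicator (fun y => u y ^ 2) y)) := fun t ht => by
    have hsub : {y | ENNReal.ofReal t < v y} ⊆ {y | 4 * ENNReal.ofReal t ^ 2 < sqFn 𝓙 φ f y} := by
      intro y hy
      rw [mem_ofPred_eq, hsv, show (4 : ℝ≥0∞) * ENNReal.ofReal t ^ 2 = (2 * ENNReal.ofReal t) ^ 2 by ring]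
      refine ENNReal.pow_lt_pow_left (two_ne_zero) ?_
      exact (ENNReal.mul_lt_mul_iff_right two_ne_zero ENNReal.ofNat_ne_top).2 hy
    refine (mul_le_mul' le_rfl ((measure_mono hsub).trans
      (hφ.volume_lt_sqFn_le 𝓙 hf hp1 hfin ht))).trans (le_of_eq ?_)
    rw [mul_add, mul_left_comm, mul_left_comm (ENNReal.ofReal _) C₂]
  have hmeas : Measurable fun t : ℝ => ENNReal.ofReal (t ^ (p - 1)) *
      volume {y | ENNReal.ofReal t < 2 * maxFn u y} := by
    refine (by fun_prop : Measurable fun t : ℝ => ENNReal.ofReal (t ^ (p - 1))).mul ?_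
    refine Antitone.measurable fun s t hst => measure_mono fun y hy => ?_
    exact (ENNReal.ofReal_le_ofReal hst).trans_lt hy
  have hM : ENNReal.ofReal p * ∫⁻ t in Ioi (0 : ℝ), ENNReal.ofReal (t ^ (p - 1)) *
      volume {y | ENNReal.ofReal t < 2 * maxFn u y} ≤ 2 ^ p * C₀ * ∫⁻ y, u y ^ p := by
    rw [← lintegral_rpow_layer hp0 ((measurable_maxFn u).const_mul 2)]
    simp only [ENNReal.mul_rpow_of_nonneg _ _ hp0.le]
    rw [lintegral_const_mul' _ _ (by finiteness), mul_assoc]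
    exact mul_le_mul' le_rfl (hmax u hum)
  calc ∫⁻ y, sqFn 𝓙 φ f y ^ (p / 2) = 2 ^ p * ∫⁻ y, v y ^ p := hint
    _ ≤ 2 ^ p * (C₁ * (2 ^ p * C₀ * ∫⁻ y, u y ^ p) +
        ENNReal.ofReal p * (C₂ * ((ENNReal.ofReal (2 - p))⁻¹ * ∫⁻ y, u y ^ p))) := by
        refine mul_le_mul' le_rfl ?_
        rw [lintegral_rpow_layer hp0 hvm]
        refine (mul_le_mul' le_rfl (setLIntegral_mono' measurableSet_Ioi hlevel)).trans ?_
        rw [lintegral_add_left (hmeas.const_mul _), lintegral_const_mul' _ _ ENNReal.ofReal_ne_top,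
          lintegral_const_mul' _ _ ENNReal.ofReal_ne_top, mul_add, mul_left_comm]
        exact add_le_add (mul_le_mul' le_rfl hM) (mul_le_mul' le_rfl (mul_le_mul' le_rfl
          (lintegral_truncated_sq_layer_le hp2 hum)))
    _ = 2 ^ p * (C₁ * (2 ^ p * C₀) +
          ENNReal.ofReal p * (C₂ * (ENNReal.ofReal (2 - p))⁻¹)) * ∫⁻ y, u y ^ p := by ring
    _ ≤ _ := mul_le_mul' le_add_self le_rfl

/-- The `L^p` bound for the Littlewood–Paley square function on the line. -/
theorem sqFn_strong_type {A p : ℝ} (hp : 1 < p) : ∃ C : ℝ≥0∞, C ≠ ⊤ ∧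
    ∀ (𝓙 : Finset (ℤ × ℤ)) (φ : ℤ × ℤ → ℝ → ℂ) (f : ℝ → ℂ), IsBumpFamily A φ → Measurable f →
      ∫⁻ y, sqFn 𝓙 φ f y ^ (p / 2) ≤ C * ∫⁻ y, ‖f y‖ₑ ^ p := by
  rcases lt_trichotomy p 2 with h | rfl | h
  · exact sqFn_strong_type_of_lt_two hp h
  · refine ⟨ENNReal.ofReal (4608 * A ^ 2), ENNReal.ofReal_ne_top, fun 𝓙 φ f hφ hf => ?_⟩
    simpa using hφ.lintegral_sqFn_le 𝓙 hf
  · exact sqFn_strong_type_of_two_lt h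

/-- Minkowski's integral inequality for the `ℓ²` norm. -/
theorem sum_sq_lintegral_rpow_le {ι α : Type*} [MeasurableSpace α] {μ : Measure α} (s : Finset ι)
    {G : ι → α → ℝ≥0∞} (hG : ∀ i, Measurable (G i)) :
    (∑ i ∈ s, (∫⁻ x, G i x ∂μ) ^ 2) ^ (1 / 2 : ℝ) ≤ ∫⁻ x, (∑ i ∈ s, G i x ^ 2) ^ (1 / 2 : ℝ) ∂μ := by
  have hsq : ∀ a : ℝ≥0∞, (a ^ 2) ^ (1 / 2 : ℝ) = a := fun a => by
    rw [← ENNReal.rpow_natCast, ← ENNReal.rpow_mul]; norm_num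
  set N := ∑ i ∈ s, (∫⁻ x, G i x ∂μ) ^ 2 with hN
  by_cases htop : ∃ i ∈ s, ∫⁻ x, G i x ∂μ = ⊤
  · obtain ⟨i, hi, hi'⟩ := htop
    refine le_top.trans (hi'.symm.le.trans (lintegral_mono fun x => ?_))
    rw [← hsq (G i x)]
    exact ENNReal.rpow_le_rpow (Finset.single_le_sum (f := fun i => G i x ^ 2)
      (fun _ _ => zero_le) hi) (by norm_num)
  push Not at htop
  have hNtop : N ≠ ⊤ := ENNReal.sum_ne_top.2 fun i hi => ENNReal.pow_ne_top (htop i hi)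
  rcases eq_or_ne N 0 with h0 | h0
  · rw [h0, ENNReal.zero_rpow_of_pos (by norm_num)]; exact zero_le
  have hM0 : N ^ (1 / 2 : ℝ) ≠ 0 := by
    rw [Ne, ENNReal.rpow_eq_zero_iff]; simp [h0, hNtop]
  have hMtop : N ^ (1 / 2 : ℝ) ≠ ⊤ := ENNReal.rpow_ne_top_of_nonneg (by norm_num) hNtop
  have hMM : N ^ (1 / 2 : ℝ) * N ^ (1 / 2 : ℝ) = N := by
    rw [← ENNReal.rpow_add _ _ h0 hNtop]; norm_num
  have key : N ^ (1 / 2 : ℝ) * N ^ (1 / 2 : ℝ) ≤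
      N ^ (1 / 2 : ℝ) * ∫⁻ x, (∑ i ∈ s, G i x ^ 2) ^ (1 / 2 : ℝ) ∂μ := by
    rw [hMM, ← lintegral_const_mul' _ _ hMtop]
    calc N = ∫⁻ x, ∑ i ∈ s, (∫⁻ x, G i x ∂μ) * G i x ∂μ := by
          rw [lintegral_finsetSum s fun i _ => (hG i).const_mul _, hN]
          refine Finset.sum_congr rfl fun i _ => ?_
          rw [lintegral_const_mul _ (hG i), sq]
      _ ≤ _ := by
          refine lintegral_mono fun x => ?_
          have := ENNReal.inner_le_Lp_mul_Lq s (fun i => ∫⁻ x, G i x ∂μ) (fun i => G i x)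
            Real.HolderConjugate.two_two
          simpa [ENNReal.rpow_two] using this
  exact (ENNReal.mul_le_mul_iff_right hM0 hMtop).1 key

theorem enorm_pair2_le (f : ℝ × ℝ → ℂ) (φ ψ : ℝ → ℂ) :
    ‖pair2 f φ ψ‖ₑ ≤ ∫⁻ x, ‖pairSnd f ψ x‖ₑ * ‖φ x‖ₑ := by
  unfold pair2
  by_cases hint : Integrable fun z : ℝ × ℝ =>
      f z * (starRingEnd ℂ) (φ z.1) * (starRingEnd ℂ) (ψ z.2)
  swap
  · rw [integral_undef hint]; simp
  rw [Measure.volume_eq_prod, integral_prod _ hint]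
  refine (enorm_integral_le_lintegral_enorm _).trans (lintegral_mono fun x => le_of_eq ?_)
  have : ∫ y, f (x, y) * (starRingEnd ℂ) (φ x) * (starRingEnd ℂ) (ψ y) =
      pairSnd f ψ x * (starRingEnd ℂ) (φ x) := by
    rw [pairSnd, ← integral_mul_const]
    congr 1 with y
    ring
  rw [this, enorm_mul, ← ofReal_norm ((starRingEnd ℂ) (φ x)), RCLike.norm_conj, ofReal_norm]

theorem measurable_pairSnd {f : ℝ × ℝ → ℂ} (hf : Measurable f) {ψ : ℝ → ℂ} (hψ : Continuous ψ) :
    Measurable (pairSnd f ψ) := by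
  have h : Measurable fun z : ℝ × ℝ => f z * (starRingEnd ℂ) (ψ z.2) :=
    hf.mul ((Complex.continuous_conj.comp (hψ.comp continuous_snd)).measurable)
  exact (StronglyMeasurable.integral_prod_right (f := fun x y => f (x, y) * (starRingEnd ℂ) (ψ y))
    h.stronglyMeasurable).measurable

/-- The constant in `IsBump.isTailBump`. -/
def tailConst (C : ℕ → ℕ → ℝ) : ℝ := 32 * (|C 0 5| + |C 1 5|) + 1

theorem tailConst_pos (C : ℕ → ℕ → ℝ) : 0 < tailConst C := by
  unfold tailConst; positivity

namespace IsNormBump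

variable {C : ℕ → ℕ → ℝ} {c L : ℝ} {Φ : ℝ → ℂ}

theorem isTailBump (h : IsNormBump C c L Φ) (hL : 0 < L) :
    IsTailBump (tailConst C) c L fun x => (Real.sqrt L : ℂ) * Φ x :=
  IsBump.isTailBump hL h

theorem continuous (h : IsNormBump C c L Φ) (hL : 0 < L) : Continuous Φ := by
  have hs : (Real.sqrt L : ℂ) ≠ 0 := by
    rw [Ne, Complex.ofReal_eq_zero]; positivity
  have h1 := (h.isTailBump hL).continuous.const_mul ((Real.sqrt L : ℂ)⁻¹)
  simpa [← mul_assoc, hs] using h1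

theorem norm_le_sq (h : IsNormBump C c L Φ) (hL : 0 < L) (x : ℝ) :
    ‖Φ x‖ ≤ tailConst C / Real.sqrt L * tailWt c L x ^ 2 := by
  have hs : 0 < Real.sqrt L := by positivity
  have h1 := (h.isTailBump hL).norm_le_sq (tailConst_pos C).le hL x
  rw [norm_mul, Complex.norm_real, Real.norm_of_nonneg hs.le] at h1
  rw [div_mul_eq_mul_div, le_div_iff₀ hs]
  linarith

theorem norm_le_const (h : IsNormBump C c L Φ) (hL : 0 < L) (x : ℝ) :
    ‖Φ x‖ ≤ tailConst C / Real.sqrt L :=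
  (h.norm_le_sq hL x).trans (mul_le_of_le_one_right
    (div_nonneg (tailConst_pos C).le (Real.sqrt_nonneg L))
    (pow_le_one₀ (tailWt_pos hL).le (tailWt_le_one hL)))

theorem enorm_le (h : IsNormBump C c L Φ) (hL : 0 < L) (x : ℝ) :
    ‖Φ x‖ₑ ≤ ENNReal.ofReal (tailConst C / Real.sqrt L) * ENNReal.ofReal (tailWt c L x ^ 2) := by
  rw [← ofReal_norm, ← ENNReal.ofReal_mul (div_nonneg (tailConst_pos C).le (Real.sqrt_nonneg L))]
  exact ENNReal.ofReal_le_ofReal (h.norm_le_sq hL x)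

theorem enorm_pair2_le (h : IsNormBump C c L Φ) (hL : 0 < L) (f : ℝ × ℝ → ℂ) (ψ : ℝ → ℂ) :
    ‖pair2 f Φ ψ‖ₑ ≤ ENNReal.ofReal (tailConst C / Real.sqrt L) *
      ∫⁻ x, ‖pairSnd f ψ x‖ₑ * ENNReal.ofReal (tailWt c L x ^ 2) := by
  rw [← lintegral_const_mul' _ _ ENNReal.ofReal_ne_top]
  refine (_root_.enorm_pair2_le f Φ ψ).trans (lintegral_mono fun x => ?_)
  refine (mul_le_mul' le_rfl (h.enorm_le hL x)).trans (le_of_eq ?_)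
  ring

end IsNormBump

theorem ofReal_norm_sq_div {a : ℂ} {L : ℝ} (hL : 0 < L) :
    ENNReal.ofReal (‖a‖ ^ 2 / L) = (‖a‖ₑ * ENNReal.ofReal (Real.sqrt L)⁻¹) ^ 2 := by
  rw [← ofReal_norm, ← ENNReal.ofReal_mul (norm_nonneg _), ← ENNReal.ofReal_pow (by positivity),
    mul_pow, inv_pow, Real.sq_sqrt hL.le, div_eq_mul_inv]

theorem enorm_div_sqrt (a : ℂ) {L : ℝ} (hL : 0 < L) :
    ‖a / (Real.sqrt L : ℂ)‖ₑ = ‖a‖ₑ * ENNReal.ofReal (Real.sqrt L)⁻¹ := by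
  rw [← ofReal_norm, norm_div, Complex.norm_real, Real.norm_of_nonneg (by positivity),
    div_eq_mul_inv, ENNReal.ofReal_mul (norm_nonneg _), ofReal_norm]

theorem indE_sq (J : ℤ × ℤ) (y : ℝ) : indE J y ^ 2 = indE J y := by
  by_cases h : y ∈ dyadIcc J <;> simp [indE, h]

theorem MSfun0_le {Cb : ℕ → ℕ → ℝ} {𝒟 : Finset ((ℤ × ℤ) × (ℤ × ℤ))} {ΦI ΦJ : ℤ × ℤ → ℝ → ℂ}
    {f : ℝ × ℝ → ℂ} (hΦI : ∀ I : ℤ × ℤ, IsNormBump Cb (dyadCenter I) (dyadLen I) (ΦI I))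
    {z : ℝ × ℝ} {M : ℝ≥0∞}
    (h : ∀ I : ℤ × ℤ, z.1 ∈ dyadIcc I → (∑ J ∈ 𝒟.image Prod.snd,
      ((∫⁻ x, ‖pairSnd f (ΦJ J) x / (Real.sqrt (dyadLen J) : ℂ)‖ₑ *
        ENNReal.ofReal (tailWt (dyadCenter I) (dyadLen I) x ^ 2)) * indE J z.2) ^ 2) ^ (1 / 2 : ℝ) ≤
        16 * ENNReal.ofReal (dyadLen I) * M) :
    MSfun0 𝒟 ΦI ΦJ f z ≤ ENNReal.ofReal (16 * tailConst Cb) * M := by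
  refine iSup_le fun I => ?_
  by_cases hI : z.1 ∈ dyadIcc I
  swap
  · simp [indE, hI]
  have hL := dyadLen_pos I
  have hA := tailConst_pos Cb
  have hs : 0 < Real.sqrt (dyadLen I) := by positivity
  rw [indE, indicator_of_mem hI, mul_one]
  set K := ENNReal.ofReal (tailConst Cb / Real.sqrt (dyadLen I)) with hK
  set a : ℤ × ℤ → ℝ≥0∞ := fun J => (∫⁻ x, ‖pairSnd f (ΦJ J) x / (Real.sqrt (dyadLen J) : ℂ)‖ₑ *
    ENNReal.ofReal (tailWt (dyadCenter I) (dyadLen I) x ^ 2)) * indE J z.2 with ha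
  have hterm : ∀ J, ENNReal.ofReal (‖pair2 f (ΦI I) (ΦJ J)‖ ^ 2 / dyadLen J) * indE J z.2 ≤
      K ^ 2 * a J ^ 2 := fun J => by
    rw [ofReal_norm_sq_div (dyadLen_pos J), ← indE_sq, ← mul_pow, ← mul_pow]
    refine pow_le_pow_left₀ zero_le ?_ 2
    rw [ha]
    dsimp only
    rw [← mul_assoc]
    refine mul_le_mul' ?_ le_rfl
    refine (mul_le_mul' ((hΦI I).enorm_pair2_le hL f (ΦJ J)) le_rfl).trans (le_of_eq ?_)
    simp only [enorm_div_sqrt _ (dyadLen_pos J)]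
    rw [mul_assoc, ← lintegral_mul_const' _ _ ENNReal.ofReal_ne_top]
    congr 2 with x
    ring
  have hsum : ∑ q ∈ 𝒟.filter (fun q => q.1 = I),
      ENNReal.ofReal (‖pair2 f (ΦI I) (ΦJ q.2)‖ ^ 2 / dyadLen q.2) * indE q.2 z.2 ≤
        K ^ 2 * ∑ J ∈ 𝒟.image Prod.snd, a J ^ 2 := by
    rw [Finset.mul_sum]
    have hinj : Set.InjOn Prod.snd (𝒟.filter (fun q => q.1 = I) : Set ((ℤ × ℤ) × (ℤ × ℤ))) := by
      intro q hq r hr hqr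
      rw [Finset.mem_coe, Finset.mem_filter] at hq hr
      exact Prod.ext (hq.2.trans hr.2.symm) hqr
    rw [← Finset.sum_image (f := fun J =>
      ENNReal.ofReal (‖pair2 f (ΦI I) (ΦJ J)‖ ^ 2 / dyadLen J) * indE J z.2) hinj]
    refine (Finset.sum_le_sum fun J _ => hterm J).trans ?_
    exact Finset.sum_le_sum_of_subset (Finset.image_subset_image (Finset.filter_subset _ _))
  have hsq : ∀ b : ℝ≥0∞, (b ^ 2) ^ (1 / 2 : ℝ) = b := fun b => by
    rw [← ENNReal.rpow_natCast, ← ENNReal.rpow_mul]; norm_num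
  have hLinv : (ENNReal.ofReal (dyadLen I))⁻¹ = ENNReal.ofReal (Real.sqrt (dyadLen I))⁻¹ ^ 2 := by
    rw [← ENNReal.ofReal_pow (by positivity), inv_pow, Real.sq_sqrt hL.le,
      ENNReal.ofReal_inv_of_pos hL]
  calc ((ENNReal.ofReal (dyadLen I))⁻¹ * ∑ q ∈ 𝒟.filter (fun q => q.1 = I),
        ENNReal.ofReal (‖pair2 f (ΦI I) (ΦJ q.2)‖ ^ 2 / dyadLen q.2) * indE q.2 z.2) ^ (1 / 2 : ℝ)
      ≤ ((ENNReal.ofReal (dyadLen I))⁻¹ *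
          (K ^ 2 * ∑ J ∈ 𝒟.image Prod.snd, a J ^ 2)) ^ (1 / 2 : ℝ) :=
        ENNReal.rpow_le_rpow (mul_le_mul' le_rfl hsum) (by norm_num)
    _ = ENNReal.ofReal (Real.sqrt (dyadLen I))⁻¹ * (K *
          (∑ J ∈ 𝒟.image Prod.snd, a J ^ 2) ^ (1 / 2 : ℝ)) := by
        rw [hLinv, ENNReal.mul_rpow_of_nonneg _ _ (by norm_num),
          ENNReal.mul_rpow_of_nonneg _ _ (by norm_num), hsq, hsq]
    _ ≤ ENNReal.ofReal (Real.sqrt (dyadLen I))⁻¹ * (K * (16 * ENNReal.ofReal (dyadLen I) * M)) :=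
        mul_le_mul' le_rfl (mul_le_mul' le_rfl (h I hI))
    _ = ENNReal.ofReal (16 * tailConst Cb) * M := by
        rw [← mul_assoc, ← mul_assoc]
        congr 1
        rw [← ENNReal.ofReal_ofNat 16, ← ENNReal.ofReal_mul (by positivity),
          ← ENNReal.ofReal_mul (by positivity), ← ENNReal.ofReal_mul (by positivity)]
        congr 1
        field_simp
        rw [Real.sq_sqrt hL.le]

theorem setLIntegral_ball_le_HLM {g : ℝ → ℂ} (hg : Integrable g) {c r x : ℝ} (hr : 0 < r)
    (hx : |x - c| ≤ r) :
    ∫⁻ y in Metric.ball c r, ‖g y‖ₑ ≤ ENNReal.ofReal (2 * r) * HLM g x := by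
  have hsub : Metric.ball c r ⊆ Icc (c - r) (c + r) := by
    rw [Real.ball_eq_Ioo]; exact Ioo_subset_Icc_self
  have hxI : x ∈ Icc (c - r) (c + r) := by
    rw [abs_le] at hx; constructor <;> linarith [hx.1, hx.2]
  have hle : ENNReal.ofReal ((c + r - (c - r))⁻¹ * ∫ y in Icc (c - r) (c + r), ‖g y‖) ≤ HLM g x :=
    le_iSup_of_le (c - r) (le_iSup_of_le (c + r) (le_iSup_of_le (by linarith)
      (le_iSup_of_le hxI le_rfl)))
  refine (lintegral_mono_set hsub).trans (le_trans (le_of_eq ?_) (mul_le_mul' le_rfl hle))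
  rw [← ENNReal.ofReal_mul (by positivity), ← mul_assoc,
    show 2 * r * (c + r - (c - r))⁻¹ = 1 by
      rw [show c + r - (c - r) = 2 * r by ring, mul_inv_cancel₀ (by positivity)], one_mul,
    ofReal_integral_norm_eq_lintegral_enorm hg.integrableOn]

theorem abs_sub_dyadCenter_le_of_mem_dyadIcc {I : ℤ × ℤ} {x : ℝ} (hx : x ∈ dyadIcc I) :
    |x - dyadCenter I| ≤ dyadLen I / 2 := by
  obtain ⟨h1, h2⟩ := hx
  unfold dyadCenter dyadLen
  rw [abs_le]; constructor <;> linarith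

theorem integrable_pairSnd {f : ℝ × ℝ → ℂ} (hf : Integrable f) {ψ : ℝ → ℂ} (hψ : Continuous ψ)
    {K : ℝ} (hK : ∀ y, ‖ψ y‖ ≤ K) : Integrable (pairSnd f ψ) := by
  have h : Integrable fun z : ℝ × ℝ => f z * (starRingEnd ℂ) (ψ z.2) :=
    hf.mul_bdd (c := K) (Complex.continuous_conj.comp (hψ.comp continuous_snd)).aestronglyMeasurable
      (Filter.Eventually.of_forall fun z => by rw [RCLike.norm_conj]; exact hK _)
  exact h.integral_prod_left

theorem MSfun0_le_HLM {Cb : ℕ → ℕ → ℝ} (𝒟 : Finset ((ℤ × ℤ) × (ℤ × ℤ))) {ΦI ΦJ : ℤ × ℤ → ℝ → ℂ}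
    {f : ℝ × ℝ → ℂ} (hΦI : ∀ I : ℤ × ℤ, IsNormBump Cb (dyadCenter I) (dyadLen I) (ΦI I))
    (hΦJ : ∀ J : ℤ × ℤ, IsNormBump Cb (dyadCenter J) (dyadLen J) (ΦJ J))
    (hf : Integrable f) (z : ℝ × ℝ) :
    MSfun0 𝒟 ΦI ΦJ f z ≤ ENNReal.ofReal (16 * tailConst Cb) *
      (∑ J ∈ 𝒟.image Prod.snd,
        (HLM (fun x : ℝ => pairSnd f (ΦJ J) x / (Real.sqrt (dyadLen J) : ℂ)) z.1) ^ 2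
          * indE J z.2) ^ (1 / 2 : ℝ) := by
  refine MSfun0_le hΦI fun I hI => ?_
  have hL := dyadLen_pos I
  have hsq : ∀ b : ℝ≥0∞, (b ^ 2) ^ (1 / 2 : ℝ) = b := fun b => by
    rw [← ENNReal.rpow_natCast, ← ENNReal.rpow_mul]; norm_num
  rw [← hsq (16 * ENNReal.ofReal (dyadLen I)), ← ENNReal.mul_rpow_of_nonneg _ _ (by norm_num),
    Finset.mul_sum]
  refine ENNReal.rpow_le_rpow (Finset.sum_le_sum fun J _ => ?_) (by norm_num)
  have hJ := dyadLen_pos J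
  have hint : Integrable fun x : ℝ => pairSnd f (ΦJ J) x / (Real.sqrt (dyadLen J) : ℂ) :=
    (integrable_pairSnd hf ((hΦJ J).continuous hJ) ((hΦJ J).norm_le_const hJ)).div_const _
  rw [mul_pow, indE_sq, ← mul_assoc, ← mul_pow]
  refine mul_le_mul' (pow_le_pow_left₀ zero_le ?_ 2) le_rfl
  refine lintegral_mul_tailWt_sq_le _ hint.aestronglyMeasurable.enorm hL fun k => ?_
  refine setLIntegral_ball_le_HLM hint (by positivity) ?_
  have h1 := abs_sub_dyadCenter_le_of_mem_dyadIcc hI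
  have : (1 : ℝ) ≤ 2 ^ k := one_le_pow₀ (by norm_num)
  nlinarith

theorem isBumpFamily_of_isNormBump {C : ℕ → ℕ → ℝ} {Φ : ℤ × ℤ → ℝ → ℂ}
    (h : ∀ J : ℤ × ℤ, IsNormBump C (dyadCenter J) (dyadLen J) (Φ J))
    (h0 : ∀ J : ℤ × ℤ, (∫ y : ℝ, Φ J y) = 0) :
    IsBumpFamily (tailConst C) fun J y => (Real.sqrt (dyadLen J) : ℂ) * Φ J y where
  pos := tailConst_pos C
  bump J := (h J).isTailBump (dyadLen_pos J)
  integral_eq_zero J := by rw [integral_const_mul, h0, mul_zero]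

theorem bumpCoeff_eq_enorm_pairSnd (Φ : ℤ × ℤ → ℝ → ℂ) (f : ℝ × ℝ → ℂ) (J : ℤ × ℤ) (x : ℝ) :
    bumpCoeff (fun J y => (Real.sqrt (dyadLen J) : ℂ) * Φ J y) (fun y => f (x, y)) J =
      ‖pairSnd f (Φ J) x / (Real.sqrt (dyadLen J) : ℂ)‖ₑ := by
  have hJ := dyadLen_pos J
  have hs : 0 < Real.sqrt (dyadLen J) := by positivity
  have h1 : pair (fun y => f (x, y)) (fun y => (Real.sqrt (dyadLen J) : ℂ) * Φ J y) =
      Real.sqrt (dyadLen J) * pairSnd f (Φ J) x := by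
    rw [pair, pairSnd, ← integral_const_mul]
    congr 1 with y
    rw [map_mul, Complex.conj_ofReal]
    ring
  rw [bumpCoeff, h1, ← ofReal_norm, norm_mul, norm_div, Complex.norm_real,
    Real.norm_of_nonneg hs.le]
  congr 1
  rw [div_eq_div_iff hJ.ne' hs.ne', mul_comm (Real.sqrt _), mul_assoc, Real.mul_self_sqrt hJ.le]

theorem ae_dyadIcc_eq_dyadIco :
    ∀ᵐ y : ℝ, ∀ J : ℤ × ℤ, indE J y = (dyadIco J).indicator 1 y := by
  rw [ae_all_iff]
  intro J
  have h : dyadIcc J =ᵐ[volume] dyadIco J := Ico_ae_eq_Icc.symm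
  filter_upwards [h] with y hy
  have hy' : y ∈ dyadIcc J ↔ y ∈ dyadIco J := iff_of_eq hy
  by_cases hm : y ∈ dyadIco J
  · simp [indE, hm, hy'.2 hm]
  · simp [indE, hm, mt hy'.1 hm]

theorem measurable_indE (I : ℤ × ℤ) : Measurable (indE I) :=
  measurable_const.indicator measurableSet_Icc

theorem measurable_MSfun0 (𝒟 : Finset ((ℤ × ℤ) × (ℤ × ℤ))) (ΦI ΦJ : ℤ × ℤ → ℝ → ℂ)
    (f : ℝ × ℝ → ℂ) : Measurable (MSfun0 𝒟 ΦI ΦJ f) := by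
  refine Measurable.iSup fun I => ?_
  refine Measurable.mul (Measurable.pow_const (measurable_const.mul
    (Finset.measurable_sum _ fun q _ => ?_)) _) ((measurable_indE I).comp measurable_fst)
  exact measurable_const.mul ((measurable_indE q.2).comp measurable_snd)

theorem measurable_sqFn_slice {f : ℝ × ℝ → ℂ} (hf : Measurable f) {Φ : ℤ × ℤ → ℝ → ℂ}
    (hΦ : ∀ J, Continuous (Φ J)) (𝓙 : Finset (ℤ × ℤ)) :
    Measurable fun z : ℝ × ℝ => sqFn 𝓙 (fun J y => (Real.sqrt (dyadLen J) : ℂ) * Φ J y)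
      (fun y => f (z.1, y)) z.2 := by
  unfold sqFn
  simp only [bumpCoeff_eq_enorm_pairSnd]
  refine Finset.measurable_sum _ fun J _ => Measurable.mul (Measurable.pow_const ?_ 2)
    ((measurable_one.indicator (measurableSet_dyadIco J)).comp measurable_snd)
  exact (((measurable_pairSnd hf (hΦ J)).comp measurable_fst).div_const _).enorm

theorem ae_MSfun0_le_maxFn {Cb : ℕ → ℕ → ℝ} (𝒟 : Finset ((ℤ × ℤ) × (ℤ × ℤ)))
    {ΦI ΦJ : ℤ × ℤ → ℝ → ℂ} {f : ℝ × ℝ → ℂ}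
    (hΦI : ∀ I : ℤ × ℤ, IsNormBump Cb (dyadCenter I) (dyadLen I) (ΦI I))
    (hΦJ : ∀ J : ℤ × ℤ, Continuous (ΦJ J)) (hf : Measurable f) :
    ∀ᵐ y : ℝ, ∀ x : ℝ, MSfun0 𝒟 ΦI ΦJ f (x, y) ≤ ENNReal.ofReal (16 * tailConst Cb) *
      maxFn (fun x => sqFn (𝒟.image Prod.snd) (fun J y => (Real.sqrt (dyadLen J) : ℂ) * ΦJ J y)
        (fun y => f (x, y)) y ^ (1 / 2 : ℝ)) x := by
  filter_upwards [ae_dyadIcc_eq_dyadIco] with y hy x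
  refine MSfun0_le hΦI fun I hI => ?_
  have hL := dyadLen_pos I
  have hx : |x - dyadCenter I| < dyadLen I := by
    have := abs_sub_dyadCenter_le_of_mem_dyadIcc hI
    dsimp only at this
    linarith
  have hm : Measurable fun x => sqFn (𝒟.image Prod.snd)
      (fun J y => (Real.sqrt (dyadLen J) : ℂ) * ΦJ J y) (fun y => f (x, y)) y ^ (1 / 2 : ℝ) :=
    ((measurable_sqFn_slice hf hΦJ _).comp measurable_prodMk_right).pow_const _
  refine le_trans ?_ (lintegral_mul_tailWt_sq_le_maxFn hm.aemeasurable hL hx)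
  have hw : Measurable fun x => ENNReal.ofReal (tailWt (dyadCenter I) (dyadLen I) x ^ 2) :=
    (((continuous_tailWt hL).pow 2).measurable).ennreal_ofReal
  have hG : ∀ J, Measurable fun x => ‖pairSnd f (ΦJ J) x / (Real.sqrt (dyadLen J) : ℂ)‖ₑ :=
    fun J => ((measurable_pairSnd hf (hΦJ J)).div_const _).enorm
  have hsq : ∀ b : ℝ≥0∞, (b ^ 2) ^ (1 / 2 : ℝ) = b := fun b => by
    rw [← ENNReal.rpow_natCast, ← ENNReal.rpow_mul]; norm_num
  have h1 : ∀ J, (∫⁻ x, ‖pairSnd f (ΦJ J) x / (Real.sqrt (dyadLen J) : ℂ)‖ₑ *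
      ENNReal.ofReal (tailWt (dyadCenter I) (dyadLen I) x ^ 2)) * indE J y =
      ∫⁻ x, ‖pairSnd f (ΦJ J) x / (Real.sqrt (dyadLen J) : ℂ)‖ₑ *
        ENNReal.ofReal (tailWt (dyadCenter I) (dyadLen I) x ^ 2) * indE J y := fun J =>
    (lintegral_mul_const _ ((hG J).mul hw)).symm
  simp only [h1]
  refine (sum_sq_lintegral_rpow_le _ fun J => ((hG J).mul hw).mul_const _).trans (le_of_eq ?_)
  congr 1 with x
  rw [← hsq (ENNReal.ofReal _), ← ENNReal.mul_rpow_of_nonneg _ _ (by norm_num), sqFn,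
    Finset.sum_mul]
  congr 1
  refine Finset.sum_congr rfl fun J _ => ?_
  rw [bumpCoeff_eq_enorm_pairSnd, ← hy J, mul_pow, Pi.mul_apply, mul_pow, indE_sq]
  ring

theorem lintegral_MSfun0_rpow_le (Cb : ℕ → ℕ → ℝ) {p : ℝ} (hp : 1 < p) : ∃ C : ℝ≥0∞, C ≠ ⊤ ∧
    ∀ (𝒟 : Finset ((ℤ × ℤ) × (ℤ × ℤ))) (ΦI ΦJ : ℤ × ℤ → ℝ → ℂ) (f : ℝ × ℝ → ℂ),
      (∀ I : ℤ × ℤ, IsNormBump Cb (dyadCenter I) (dyadLen I) (ΦI I)) →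
      (∀ J : ℤ × ℤ, IsNormBump Cb (dyadCenter J) (dyadLen J) (ΦJ J)) →
      (∀ J : ℤ × ℤ, (∫ y : ℝ, ΦJ J y) = 0) → Measurable f →
        ∫⁻ z, MSfun0 𝒟 ΦI ΦJ f z ^ p ≤ C * ∫⁻ z, ‖f z‖ₑ ^ p := by
  have hp0 : 0 < p := by linarith
  obtain ⟨C₁, hC₁, hmax⟩ := maxFn_strong_type hp
  obtain ⟨C₂, hC₂, hsqFn⟩ := sqFn_strong_type (A := tailConst Cb) hp
  refine ⟨ENNReal.ofReal (16 * tailConst Cb) ^ p * C₁ * C₂, by finiteness,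
    fun 𝒟 ΦI ΦJ f hΦI hΦJ hΦ0 hf => ?_⟩
  have hc : ∀ J, Continuous (ΦJ J) := fun J => (hΦJ J).continuous (dyadLen_pos J)
  set S : ℝ → ℝ → ℝ≥0∞ := fun x y => sqFn (𝒟.image Prod.snd)
    (fun J y => (Real.sqrt (dyadLen J) : ℂ) * ΦJ J y) (fun y => f (x, y)) y with hS
  have hSm : Measurable fun z : ℝ × ℝ => S z.1 z.2 := measurable_sqFn_slice hf hc _
  have hrpow : ∀ a : ℝ≥0∞, (a ^ (1 / 2 : ℝ)) ^ p = a ^ (p / 2) := fun a => by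
    rw [← ENNReal.rpow_mul]; congr 1; ring
  calc ∫⁻ z, MSfun0 𝒟 ΦI ΦJ f z ^ p = ∫⁻ y, ∫⁻ x, MSfun0 𝒟 ΦI ΦJ f (x, y) ^ p := by
        rw [Measure.volume_eq_prod, lintegral_prod_symm]
        exact ((measurable_MSfun0 𝒟 ΦI ΦJ f).pow_const p).aemeasurable
    _ ≤ ∫⁻ y, ENNReal.ofReal (16 * tailConst Cb) ^ p * C₁ * ∫⁻ x, S x y ^ (p / 2) := by
        refine lintegral_mono_ae ?_
        filter_upwards [ae_MSfun0_le_maxFn 𝒟 hΦI hc hf] with y hy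
        have hm : Measurable fun x => S x y ^ (1 / 2 : ℝ) :=
          (hSm.comp measurable_prodMk_right).pow_const _
        calc ∫⁻ x, MSfun0 𝒟 ΦI ΦJ f (x, y) ^ p
            ≤ ∫⁻ x, ENNReal.ofReal (16 * tailConst Cb) ^ p *
                maxFn (fun x => S x y ^ (1 / 2 : ℝ)) x ^ p := by
              refine lintegral_mono fun x => ?_
              rw [← ENNReal.mul_rpow_of_nonneg _ _ hp0.le]
              exact ENNReal.rpow_le_rpow (hy x) hp0.le
          _ ≤ _ := by
              rw [lintegral_const_mul' _ _ (by finiteness), mul_assoc]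
              refine mul_le_mul' le_rfl ((hmax _ hm).trans (le_of_eq ?_))
              simp only [hrpow]
    _ = ENNReal.ofReal (16 * tailConst Cb) ^ p * C₁ * ∫⁻ x, ∫⁻ y, S x y ^ (p / 2) := by
        rw [lintegral_const_mul' _ _ (by finiteness), lintegral_lintegral_swap]
        exact ((hSm.comp measurable_swap).pow_const _).aemeasurable
    _ ≤ ENNReal.ofReal (16 * tailConst Cb) ^ p * C₁ * ∫⁻ x, C₂ * ∫⁻ y, ‖f (x, y)‖ₑ ^ p :=
        mul_le_mul' le_rfl (lintegral_mono fun x => hsqFn _ _ _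
          (isBumpFamily_of_isNormBump hΦJ hΦ0) (hf.comp measurable_prodMk_left))
    _ = ENNReal.ofReal (16 * tailConst Cb) ^ p * C₁ * C₂ * ∫⁻ z, ‖f z‖ₑ ^ p := by
        rw [lintegral_const_mul' _ _ hC₂, Measure.volume_eq_prod,
          lintegral_prod _ (hf.enorm.pow_const p).aemeasurable, ← mul_assoc]

/-- the maximal-square function `MS` is pointwise bounded by a square-maximal type
function, and consequently `MS` is bounded on `L^p(ℝ²)` for all `1 < p < ∞`. -/
theorem ms_pointwise_and_Lp (Cb : ℕ → ℕ → ℝ) :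
    (∃ C : ℝ, 0 < C ∧
      ∀ (𝒟 : Finset ((ℤ × ℤ) × (ℤ × ℤ))) (ΦI ΦJ : ℤ × ℤ → ℝ → ℂ) (f : ℝ × ℝ → ℂ),
        (∀ I : ℤ × ℤ, IsNormBump Cb (dyadCenter I) (dyadLen I) (ΦI I)) →
        (∀ J : ℤ × ℤ, IsNormBump Cb (dyadCenter J) (dyadLen J) (ΦJ J)) →
        (∀ J : ℤ × ℤ, (∫ y : ℝ, ΦJ J y) = 0) →
        MeasureTheory.Integrable f →
        ∀ z : ℝ × ℝ,
          MSfun0 𝒟 ΦI ΦJ f z ≤ ENNReal.ofReal C *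
            (∑ J ∈ 𝒟.image Prod.snd,
              (HLM (fun x : ℝ => pairSnd f (ΦJ J) x / (Real.sqrt (dyadLen J) : ℂ)) z.1) ^ 2
                * indE J z.2) ^ (1 / 2 : ℝ)) ∧
    (∀ p : ℝ, 1 < p → ∃ C : ℝ≥0∞, C ≠ ⊤ ∧
      ∀ (𝒟 : Finset ((ℤ × ℤ) × (ℤ × ℤ))) (ΦI ΦJ : ℤ × ℤ → ℝ → ℂ) (f : ℝ × ℝ → ℂ),
        (∀ I : ℤ × ℤ, IsNormBump Cb (dyadCenter I) (dyadLen I) (ΦI I)) →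
        (∀ J : ℤ × ℤ, IsNormBump Cb (dyadCenter J) (dyadLen J) (ΦJ J)) →
        (∀ J : ℤ × ℤ, (∫ y : ℝ, ΦJ J y) = 0) →
        Measurable f →
        (∫⁻ z : ℝ × ℝ, MSfun0 𝒟 ΦI ΦJ f z ^ p) ^ (1 / p)
          ≤ C * (∫⁻ z : ℝ × ℝ, (ENNReal.ofReal ‖f z‖) ^ p) ^ (1 / p)) := by
  refine ⟨⟨16 * tailConst Cb, by linarith [tailConst_pos Cb],
    fun 𝒟 ΦI ΦJ f hΦI hΦJ _ hf z => MSfun0_le_HLM 𝒟 hΦI hΦJ hf z⟩, fun p hp => ?_⟩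
  obtain ⟨C, hC, h⟩ := lintegral_MSfun0_rpow_le Cb hp
  have hp' : 0 ≤ 1 / p := by positivity
  refine ⟨C ^ (1 / p), ENNReal.rpow_ne_top_of_nonneg hp' hC, fun 𝒟 ΦI ΦJ f hΦI hΦJ hΦ0 hf => ?_⟩
  simp only [ofReal_norm]
  rw [← ENNReal.mul_rpow_of_nonneg _ _ hp']
  exact ENNReal.rpow_le_rpow (h 𝒟 ΦI ΦJ f hΦI hΦJ hΦ0 hf) hp'
end
end
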